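/- Let n ≥ 1, α > 0, and let k be the smallest integer bigger than nα. Let F be a bounded smooth function on S with L_α F = 0. Assume that for every Schwartz function φ on H^n ≅ ℝ^{2n+1} and every 0 ≤ p ≤ k+1, sup_{0 < a ≤ 1} |∫_{H^n} ∂_a^p F(w,a) φ(w) dw| < ∞. Then F is pluriharmonic. -/

import Mathlib

noncomputable section
open MeasureTheory Filter Set
open scoped Topology BigOperators

/-- The Heisenberg group `H^n = ℂ^n × ℝ` as a set. -/
abbrev Hn (n : ℕ) : Type := (Fin n → ℂ) × ℝ

/-- The extension `S = H^n × (0,∞)`; we use `H^n × ℝ` and restrict to `a > 0`. -/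
abbrev Sg (n : ℕ) : Type := Hn n × ℝ

/-- Directional derivative of a complex valued function in direction `v`. -/
def dirD {E : Type} [NormedAddCommGroup E] [NormedSpace ℝ E]
    (v : E) (f : E → ℂ) (p : E) : ℂ := fderiv ℝ f p v

def eX (n : ℕ) (j : Fin n) : Hn n := (fun i => if i = j then (1 : ℂ) else 0, 0)
def eY (n : ℕ) (j : Fin n) : Hn n := (fun i => if i = j then Complex.I else 0, 0)
def eT (n : ℕ) : Hn n := (0, 1)

/-- `X_j = ∂_{x_j} + 2 y_j ∂_t` on `H^n`. -/
def XH (n : ℕ) (j : Fin n) (f : Hn n → ℂ) (p : Hn n) : ℂ :=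
  dirD (eX n j) f p + 2 * ((p.1 j).im : ℂ) * dirD (eT n) f p

/-- `Y_j = ∂_{y_j} - 2 x_j ∂_t` on `H^n`. -/
def YH (n : ℕ) (j : Fin n) (f : Hn n → ℂ) (p : Hn n) : ℂ :=
  dirD (eY n j) f p - 2 * ((p.1 j).re : ℂ) * dirD (eT n) f p

/-- `T = ∂_t` on `H^n`. -/
def TH (n : ℕ) (f : Hn n → ℂ) (p : Hn n) : ℂ := dirD (eT n) f p

/-- `ℒ_α = -(1/4) Σ (X_j² + Y_j²) + i α T` on `H^n`. -/
def LH (n : ℕ) (α : ℝ) (f : Hn n → ℂ) (p : Hn n) : ℂ :=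
  -(1/4) * ∑ j, (XH n j (XH n j f) p + YH n j (YH n j f) p) + Complex.I * (α : ℂ) * TH n f p

/-- `Z̄_j = (1/2)(X_j + i Y_j)` on `H^n`. -/
def ZbarH (n : ℕ) (j : Fin n) (f : Hn n → ℂ) (p : Hn n) : ℂ :=
  (1/2) * (XH n j f p + Complex.I * YH n j f p)

/-- A function is bounded. -/
def BddFun {X : Type} (f : X → ℂ) : Prop := ∃ C, ∀ p, ‖f p‖ ≤ C

def eXS (n : ℕ) (j : Fin n) : Sg n := (eX n j, 0)
def eYS (n : ℕ) (j : Fin n) : Sg n := (eY n j, 0)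
def eTS (n : ℕ) : Sg n := (eT n, 0)
def eA (n : ℕ) : Sg n := (0, 1)

/-- `X_j` on `S`. -/
def XS (n : ℕ) (j : Fin n) (F : Sg n → ℂ) (p : Sg n) : ℂ :=
  dirD (eXS n j) F p + 2 * ((p.1.1 j).im : ℂ) * dirD (eTS n) F p

/-- `Y_j` on `S`. -/
def YS (n : ℕ) (j : Fin n) (F : Sg n → ℂ) (p : Sg n) : ℂ :=
  dirD (eYS n j) F p - 2 * ((p.1.1 j).re : ℂ) * dirD (eTS n) F p

/-- `T = ∂_t` on `S`. -/
def TS (n : ℕ) (F : Sg n → ℂ) (p : Sg n) : ℂ := dirD (eTS n) F p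

/-- `∂_a` on `S`. -/
def DA (n : ℕ) (F : Sg n → ℂ) : Sg n → ℂ := fun p => dirD (eA n) F p

/-- `ℒ = -(1/4) Σ (X_j² + Y_j²)` acting in the `H^n`-variables on `S`. -/
def LS0 (n : ℕ) (F : Sg n → ℂ) (p : Sg n) : ℂ :=
  -(1/4) * ∑ j, (XS n j (XS n j F) p + YS n j (YS n j F) p)

/-- `L_α = -α a (ℒ + n ∂_a) + a² (∂_a² + T²)` on `S`. -/
def Lalpha (n : ℕ) (α : ℝ) (F : Sg n → ℂ) (p : Sg n) : ℂ :=
  -(α : ℂ) * (p.2 : ℂ) * (LS0 n F p + (n : ℂ) * DA n F p)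
    + (p.2 : ℂ) ^ 2 * (DA n (DA n F) p + TS n (TS n F) p)

/-- The complex space `ℂ^{n+1}` in which the Siegel upper half-plane lives. -/
abbrev Vn (n : ℕ) : Type := (Fin n → ℂ) × ℂ

/-- The Siegel upper half-plane `U^n`. -/
def Un (n : ℕ) : Set (Vn n) := {z | ∑ j, ‖z.1 j‖ ^ 2 < z.2.im}

/-- The function `F_u` on the Siegel upper half-plane corresponding to a function `F` on `S`,
via `F[ζ,t,a] = F_u(ζ, t + i|ζ|² + ia)`, i.e.
`F_u(z', z_{n+1}) = F(z', Re z_{n+1}, Im z_{n+1} - |z'|²)`. -/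
def Fu (n : ℕ) (F : Sg n → ℂ) : Vn n → ℂ :=
  fun z => F ((z.1, z.2.re), z.2.im - ∑ j, ‖z.1 j‖ ^ 2)

/-- `F` is holomorphic if `F_u` is holomorphic on `U^n`. -/
def IsHolo (n : ℕ) (F : Sg n → ℂ) : Prop := DifferentiableOn ℂ (Fu n F) (Un n)

/-- `F` is anti-holomorphic if the conjugate of `F_u` is holomorphic on `U^n`. -/
def IsAntiHolo (n : ℕ) (F : Sg n → ℂ) : Prop :=
  DifferentiableOn ℂ (fun z => (starRingEnd ℂ) (Fu n F z)) (Un n)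

/-- Wirtinger derivative `∂_z` in complex direction `v`. -/
def dzV (n : ℕ) (v : Vn n) (f : Vn n → ℂ) (p : Vn n) : ℂ :=
  (1/2) * (fderiv ℝ f p v - Complex.I * fderiv ℝ f p (Complex.I • v))

/-- Wirtinger derivative `∂_{z̄}` in complex direction `v`. -/
def dzbarV (n : ℕ) (v : Vn n) (f : Vn n → ℂ) (p : Vn n) : ℂ :=
  (1/2) * (fderiv ℝ f p v + Complex.I * fderiv ℝ f p (Complex.I • v))

/-- The standard complex basis vectors of `ℂ^{n+1} = ℂ^n × ℂ`. -/
def basisV (n : ℕ) (k : Fin (n + 1)) : Vn n :=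
  if _h : (k : ℕ) < n then (fun i => if (i : ℕ) = (k : ℕ) then (1 : ℂ) else 0, 0) else (0, 1)

/-- `F` is pluriharmonic if `∂_{z_k} ∂_{z̄_j} F_u = 0` on `U^n` for all `1 ≤ j,k ≤ n+1`. -/
def IsPluriharmonic (n : ℕ) (F : Sg n → ℂ) : Prop :=
  ∀ p ∈ Un n, ∀ j k : Fin (n + 1),
    dzV n (basisV n k) (dzbarV n (basisV n j) (Fu n F)) p = 0

/-- `f` is the boundary value of `F` : for every `φ ∈ L¹(H^n)`,
`∫ F(w,a) φ(w) dw → ∫ f(w) φ(w) dw` as `a → 0⁺`. -/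
def IsBoundaryValue (n : ℕ) (F : Sg n → ℂ) (f : Hn n → ℂ) : Prop :=
  ∀ φ : Hn n → ℂ, Integrable φ →
    Tendsto (fun a : ℝ => ∫ w : Hn n, F (w, a) * φ w) (𝓝[>] (0 : ℝ))
      (𝓝 (∫ w : Hn n, f w * φ w))

/-! ### Part 1 : the algebra of smooth functions and its operators -/

/-- smooth complex valued functions on `Sg n` -/
def SmA (n : ℕ) : Subalgebra ℂ (Sg n → ℂ) where
  carrier := {f | ContDiff ℝ (⊤ : ℕ∞) f}
  mul_mem' := by
    intro a b ha hb
    have ha' : ContDiff ℝ (⊤ : ℕ∞) a := ha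
    exact ContDiff.mul ha' hb
  add_mem' := by
    intro a b ha hb
    have ha' : ContDiff ℝ (⊤ : ℕ∞) a := ha
    exact ContDiff.add ha' hb
  algebraMap_mem' := by
    intro r
    show ContDiff ℝ (⊤ : ℕ∞) (fun _ : Sg n => r)
    exact contDiff_const

/-- smooth complex valued functions on `Sg n`, as a type -/
def Sm (n : ℕ) : Type := SmA n
instance (n : ℕ) : CommRing (Sm n) := inferInstanceAs (CommRing (SmA n))
instance (n : ℕ) : Algebra ℂ (Sm n) := inferInstanceAs (Algebra ℂ (SmA n))
/-- the underlying function -/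
def Sm.fn {n : ℕ} (f : Sm n) : Sg n → ℂ := f.1
instance (n : ℕ) : CoeFun (Sm n) (fun _ => Sg n → ℂ) := ⟨Sm.fn⟩

/-- constructor -/
def Sm.mk {n : ℕ} (f : Sg n → ℂ) (h : ContDiff ℝ (⊤ : ℕ∞) f) : Sm n := ⟨f, h⟩

lemma Sm.cd {n : ℕ} (f : Sm n) : ContDiff ℝ (⊤ : ℕ∞) (Sm.fn f) := f.2
lemma Sm.diff {n : ℕ} (f : Sm n) : Differentiable ℝ (Sm.fn f) := f.cd.differentiable (by simp)
lemma Sm.cont {n : ℕ} (f : Sm n) : Continuous (Sm.fn f) := f.cd.continuous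

lemma Sm.ext {n : ℕ} {f g : Sm n} (h : ∀ p, f p = g p) : f = g :=
  Subtype.ext (funext h)

@[simp] lemma Sm.add_ap {n : ℕ} (f g : Sm n) (p : Sg n) : (f + g) p = f p + g p := rfl
@[simp] lemma Sm.sub_ap {n : ℕ} (f g : Sm n) (p : Sg n) : (f - g) p = f p - g p := rfl
@[simp] lemma Sm.neg_ap {n : ℕ} (f : Sm n) (p : Sg n) : (-f) p = - f p := rfl
@[simp] lemma Sm.mul_ap {n : ℕ} (f g : Sm n) (p : Sg n) : (f * g) p = f p * g p := rfl
@[simp] lemma Sm.smul_ap {n : ℕ} (c : ℂ) (f : Sm n) (p : Sg n) : (c • f) p = c * f p := rfl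
@[simp] lemma Sm.rsmul_ap {n : ℕ} (c : ℝ) (f : Sm n) (p : Sg n) : (c • f) p = (c : ℂ) * f p := rfl
@[simp] lemma Sm.zero_ap {n : ℕ} (p : Sg n) : (0 : Sm n) p = 0 := rfl
@[simp] lemma Sm.one_ap {n : ℕ} (p : Sg n) : (1 : Sm n) p = 1 := rfl
@[simp] lemma Sm.sum_ap {n : ℕ} {ι : Type*} (s : Finset ι) (f : ι → Sm n) (p : Sg n) :
    (∑ i ∈ s, f i) p = ∑ i ∈ s, f i p := by
  classical
  induction s using Finset.induction_on with
  | empty => simp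
  | insert a s ha ih => rw [Finset.sum_insert ha, Finset.sum_insert ha, Sm.add_ap, ih]

/-- operators -/
abbrev Op (n : ℕ) := Module.End ℂ (Sm n)

/-- directional derivative -/
def dv {n : ℕ} (v : Sg n) : Op n where
  toFun f := Sm.mk (fun p => fderiv ℝ (f) p v) (by
    have := (f.cd.fderiv_right (m := (⊤ : ℕ∞)) (by simp))
    exact this.clm_apply contDiff_const)
  map_add' f g := by
    apply Sm.ext; intro p
    show fderiv ℝ (Sm.fn (f + g)) p v = fderiv ℝ (Sm.fn f) p v + fderiv ℝ (Sm.fn g) p v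
    have : (Sm.fn (f + g)) = (Sm.fn (f)) + (Sm.fn (g)) := rfl
    rw [this, fderiv_add (f.diff p) (g.diff p)]; rfl
  map_smul' c f := by
    apply Sm.ext; intro p
    have : (Sm.fn (c • f)) = c • (Sm.fn (f)) := rfl
    show fderiv ℝ (Sm.fn (c • f)) p v = c * fderiv ℝ (Sm.fn f) p v
    rw [this, fderiv_const_smul (f.diff p)]; rfl

lemma dv_ap {n : ℕ} (v : Sg n) (f : Sm n) (p : Sg n) :
    (dv v f) p = fderiv ℝ (f) p v := rfl

lemma dv_mul {n : ℕ} (v : Sg n) (f g : Sm n) : dv v (f * g) = dv v f * g + f * dv v g := by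
  apply Sm.ext; intro p
  simp only [dv_ap, Sm.add_ap, Sm.mul_ap]
  have : (Sm.fn (f * g)) = (Sm.fn (f)) * (Sm.fn (g)) := rfl
  rw [this, fderiv_mul (f.diff p) (g.diff p)]
  simp; ring

lemma dv_comm {n : ℕ} (v w : Sg n) : (dv v : Op n) * dv w = dv w * dv v := by
  apply LinearMap.ext; intro f; apply Sm.ext; intro p
  simp only [Module.End.mul_apply, dv_ap]
  have h : ∀ u : Sg n, fderiv ℝ (dv u f) p = 
      (fderiv ℝ (fderiv ℝ (Sm.fn (f))) p).flip u := by
    intro u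
    have h1 : (Sm.fn (dv u f)) = fun p => fderiv ℝ (f) p u := rfl
    rw [h1]
    apply ContinuousLinearMap.ext; intro w
    rw [fderiv_clm_apply]
    · simp
    · exact (f.cd.fderiv_right (m := (⊤ : ℕ∞)) (by simp)).differentiable (by simp) p
    · exact differentiableAt_const u
  rw [h, h]
  simp only [ContinuousLinearMap.flip_apply]
  exact (f.cd.contDiffAt.isSymmSndFDerivAt (by simp; exact WithTop.coe_le_coe.2 le_top)) v w

/-- multiplication operator -/
def mu {n : ℕ} (g : Sm n) : Op n := LinearMap.mulLeft ℂ g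

@[simp] lemma mu_ap {n : ℕ} (g f : Sm n) : mu g f = g * f := rfl

lemma mu_mul {n : ℕ} (g h : Sm n) : mu (g * h) = mu g * mu h := by
  apply LinearMap.ext; intro f; apply Sm.ext; intro p; simp [mul_assoc]
lemma mu_add {n : ℕ} (g h : Sm n) : mu (g + h) = mu g + mu h := by
  apply LinearMap.ext; intro f; apply Sm.ext; intro p; simp [add_mul]
lemma mu_comm {n : ℕ} (g h : Sm n) : mu g * mu h = mu h * mu g := by
  rw [← mu_mul, ← mu_mul, mul_comm]
lemma mu_smul {n : ℕ} (c : ℂ) (g : Sm n) : mu (c • g) = c • mu g := by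
  apply LinearMap.ext; intro f; apply Sm.ext; intro p; simp
lemma mu_one {n : ℕ} : mu (1 : Sm n) = 1 := by
  apply LinearMap.ext; intro f; apply Sm.ext; intro p; simp
lemma mu_zero {n : ℕ} : mu (0 : Sm n) = 0 := by
  apply LinearMap.ext; intro f; apply Sm.ext; intro p; simp

lemma dv_mu {n : ℕ} (v : Sg n) (g : Sm n) : dv v * mu g = mu g * dv v + mu (dv v g) := by
  apply LinearMap.ext; intro f; apply Sm.ext; intro p
  simp [Module.End.mul_apply, dv_mul]; ring

/-- real coordinate functions and exponential -/
def xco {n : ℕ} (j : Fin n) : Sm n := Sm.mk (fun p => ((p.1.1 j).re : ℂ)) (by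
  exact Complex.ofRealCLM.contDiff.comp (Complex.reCLM.contDiff.comp (by fun_prop)))
def yco {n : ℕ} (j : Fin n) : Sm n := Sm.mk (fun p => ((p.1.1 j).im : ℂ)) (by
  exact Complex.ofRealCLM.contDiff.comp (Complex.imCLM.contDiff.comp (by fun_prop)))
def tco {n : ℕ} : Sm n := Sm.mk (fun p => (p.1.2 : ℂ)) (by
  exact Complex.ofRealCLM.contDiff.comp (by fun_prop))
/-- `a^c` -/
def ea {n : ℕ} (c : ℝ) : Sm n := Sm.mk (fun p => ((Real.exp (c * p.2) : ℝ) : ℂ)) (by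
  exact Complex.ofRealCLM.contDiff.comp (Real.contDiff_exp.comp (by fun_prop)))

lemma xco_ap {n : ℕ} (j : Fin n) (p : Sg n) : (xco j) p = ((p.1.1 j).re : ℂ) := rfl
lemma yco_ap {n : ℕ} (j : Fin n) (p : Sg n) : (yco j) p = ((p.1.1 j).im : ℂ) := rfl
lemma tco_ap {n : ℕ} (p : Sg n) : (tco : Sm n) p = (p.1.2 : ℂ) := rfl
lemma ea_ap {n : ℕ} (c : ℝ) (p : Sg n) : (ea c : Sm n) p = ((Real.exp (c * p.2) : ℝ) : ℂ) := rfl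

lemma ea_mul {n : ℕ} (c d : ℝ) : (ea c : Sm n) * ea d = ea (c + d) := by
  apply Sm.ext; intro p; simp only [Sm.mul_ap, ea_ap]; rw [add_mul, Real.exp_add]; push_cast; ring
lemma ea_zero {n : ℕ} : (ea 0 : Sm n) = 1 := by
  apply Sm.ext; intro p; simp [ea_ap]

lemma dv_clm {n : ℕ} (v : Sg n) (f : Sm n) (L : Sg n →L[ℝ] ℂ) (h : ∀ p, (f) p = L p)
    (p : Sg n) : (dv v f) p = L v := by
  rw [dv_ap]
  have : (Sm.fn (f)) = L := funext h
  rw [this, ContinuousLinearMap.fderiv]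

def Lx {n : ℕ} (j : Fin n) : Sg n →L[ℝ] ℂ :=
  Complex.ofRealCLM.comp (Complex.reCLM.comp ((ContinuousLinearMap.proj j).comp
    ((ContinuousLinearMap.fst ℝ (Fin n → ℂ) ℝ).comp (ContinuousLinearMap.fst ℝ (Hn n) ℝ))))
def Ly {n : ℕ} (j : Fin n) : Sg n →L[ℝ] ℂ :=
  Complex.ofRealCLM.comp (Complex.imCLM.comp ((ContinuousLinearMap.proj j).comp
    ((ContinuousLinearMap.fst ℝ (Fin n → ℂ) ℝ).comp (ContinuousLinearMap.fst ℝ (Hn n) ℝ))))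
def Lt {n : ℕ} : Sg n →L[ℝ] ℂ :=
  Complex.ofRealCLM.comp 
    ((ContinuousLinearMap.snd ℝ (Fin n → ℂ) ℝ).comp (ContinuousLinearMap.fst ℝ (Hn n) ℝ))

lemma dv_xco {n : ℕ} (v : Sg n) (j : Fin n) (p : Sg n) :
    (dv v (xco j)) p = ((v.1.1 j).re : ℂ) := dv_clm v (xco j) (Lx j) (fun _ => rfl) p
lemma dv_yco {n : ℕ} (v : Sg n) (j : Fin n) (p : Sg n) :
    (dv v (yco j)) p = ((v.1.1 j).im : ℂ) := dv_clm v (yco j) (Ly j) (fun _ => rfl) p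
lemma dv_tco {n : ℕ} (v : Sg n) (p : Sg n) :
    (dv v (tco)) p = (v.1.2 : ℂ) := dv_clm v (tco) (Lt) (fun _ => rfl) p
lemma dv_ea {n : ℕ} (v : Sg n) (c : ℝ) : dv v (ea c) = ((c * v.2 : ℝ) : ℂ) • (ea c : Sm n) := by
  apply Sm.ext; intro p
  rw [dv_ap]
  have h1 : HasFDerivAt (fun p : Sg n => c * p.2) (c • ContinuousLinearMap.snd ℝ (Hn n) ℝ) p := by
    have := (ContinuousLinearMap.snd ℝ (Hn n) ℝ).hasFDerivAt (x := p)
    exact this.const_mul c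
  have h2 := Complex.ofRealCLM.hasFDerivAt.comp p h1.exp
  have h3 : (Sm.fn (ea c : Sm n)) = ⇑Complex.ofRealCLM ∘ fun p : Sg n => Real.exp (c * p.2) := rfl
  rw [Sm.smul_ap, ea_ap, h3, h2.fderiv]
  simp
  ring

def XO {n : ℕ} (j : Fin n) : Op n := dv (eXS n j) + (2 : ℂ) • (mu (yco j) * dv (eTS n))
def YO {n : ℕ} (j : Fin n) : Op n := dv (eYS n j) - (2 : ℂ) • (mu (xco j) * dv (eTS n))
def TO {n : ℕ} : Op n := dv (eTS n)
def AO {n : ℕ} : Op n := mu (ea (-1)) * dv (eA n)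
/-- multiplication by `a` -/
def MA {n : ℕ} : Op n := mu (ea 1)

/-- Derivation property -/
def IsDer {n : ℕ} (D : Op n) : Prop := ∀ f g : Sm n, D (f * g) = D f * g + f * D g

lemma isDer_dv {n : ℕ} (v : Sg n) : IsDer (dv v) := dv_mul v
lemma IsDer.add {n : ℕ} {D E : Op n} (h : IsDer D) (k : IsDer E) : IsDer (D + E) := by
  intro f g; simp only [LinearMap.add_apply, h f g, k f g]; ring
lemma IsDer.sub {n : ℕ} {D E : Op n} (h : IsDer D) (k : IsDer E) : IsDer (D - E) := by
  intro f g; simp only [LinearMap.sub_apply, h f g, k f g]; ring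
lemma IsDer.smul {n : ℕ} {D : Op n} (h : IsDer D) (c : ℂ) : IsDer (c • D) := by
  intro f g; simp only [LinearMap.smul_apply, h f g, smul_add, smul_mul_assoc, mul_smul_comm]
lemma IsDer.mu {n : ℕ} {D : Op n} (h : IsDer D) (c : Sm n) : IsDer (mu c * D) := by
  intro f g; simp only [Module.End.mul_apply, mu_ap, h f g]; ring
lemma isDer_X {n : ℕ} (j : Fin n) : IsDer (XO j) :=
  (isDer_dv _).add (((isDer_dv _).mu _).smul _)
lemma isDer_Y {n : ℕ} (j : Fin n) : IsDer (YO j) :=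
  (isDer_dv _).sub (((isDer_dv _).mu _).smul _)
lemma isDer_T {n : ℕ} : IsDer (TO : Op n) := isDer_dv _
lemma isDer_A {n : ℕ} : IsDer (AO : Op n) := (isDer_dv _).mu _

/-- commutator of derivation with multiplication -/
lemma IsDer.comm_mu {n : ℕ} {D : Op n} (h : IsDer D) (g : Sm n) : D * _root_.mu g = _root_.mu g * D + _root_.mu (D g) := by
  apply LinearMap.ext; intro f; apply Sm.ext; intro p
  simp [Module.End.mul_apply, h g f]; ring

/-- two derivations built from commuting pieces: general commutator for mu f * D -/
lemma dv_xco' {n : ℕ} (v : Sg n) (j : Fin n) : dv v (xco j) = ((v.1.1 j).re : ℂ) • (1 : Sm n) := by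
  apply Sm.ext; intro p; rw [dv_xco]; simp
lemma dv_yco' {n : ℕ} (v : Sg n) (j : Fin n) : dv v (yco j) = ((v.1.1 j).im : ℂ) • (1 : Sm n) := by
  apply Sm.ext; intro p; rw [dv_yco]; simp
lemma dv_tco' {n : ℕ} (v : Sg n) : dv v tco = (v.1.2 : ℂ) • (1 : Sm n) := by
  apply Sm.ext; intro p; rw [dv_tco]; simp

lemma dvT_y {n : ℕ} (j : Fin n) : dv (eTS n) * mu (yco j) = mu (yco j) * dv (eTS n) := by
  rw [dv_mu, dv_yco']; simp [eTS, eT, mu_zero]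
lemma dvT_x {n : ℕ} (j : Fin n) : dv (eTS n) * mu (xco j) = mu (xco j) * dv (eTS n) := by
  rw [dv_mu, dv_xco']; simp [eTS, eT, mu_zero]
lemma dvX_y {n : ℕ} (i j : Fin n) : dv (eXS n i) * mu (yco j) = mu (yco j) * dv (eXS n i) := by
  rw [dv_mu, dv_yco']
  have : ((eXS n i).1.1 j).im = 0 := by simp only [eXS, eX]; split_ifs <;> simp
  rw [this]; simp [mu_zero]
lemma dvY_x {n : ℕ} (i j : Fin n) : dv (eYS n i) * mu (xco j) = mu (xco j) * dv (eYS n i) := by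
  rw [dv_mu, dv_xco']
  have : ((eYS n i).1.1 j).re = 0 := by simp only [eYS, eY]; split_ifs <;> simp
  rw [this]; simp [mu_zero]
lemma dvX_x {n : ℕ} (i j : Fin n) : dv (eXS n i) * mu (xco j) = mu (xco j) * dv (eXS n i) + (if j = i then 1 else 0) := by
  rw [dv_mu, dv_xco']
  congr 1
  simp only [eXS, eX]; split_ifs <;> simp [mu_one, mu_zero]
lemma dvY_y {n : ℕ} (i j : Fin n) : dv (eYS n i) * mu (yco j) = mu (yco j) * dv (eYS n i) + (if j = i then 1 else 0) := by
  rw [dv_mu, dv_yco']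
  congr 1
  simp only [eYS, eY]; split_ifs <;> simp [mu_one, mu_zero]

lemma X_T {n : ℕ} (j : Fin n) : (XO j : Op n) * TO = TO * XO j := by
  simp only [XO, TO, add_mul, mul_add, smul_mul_assoc, mul_smul_comm, mul_assoc]
  rw [← mul_assoc (dv (eTS n)) (mu _), dvT_y, dv_comm, mul_assoc]
lemma Y_T {n : ℕ} (j : Fin n) : (YO j : Op n) * TO = TO * YO j := by
  simp only [YO, TO, sub_mul, mul_sub, smul_mul_assoc, mul_smul_comm, mul_assoc]
  rw [← mul_assoc (dv (eTS n)) (mu _), dvT_x, dv_comm, mul_assoc]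
lemma X_X {n : ℕ} (i j : Fin n) : (XO i : Op n) * XO j = XO j * XO i := by
  simp only [XO]
  have h1 := dvX_y (n := n) i j
  have h2 := dvX_y (n := n) j i
  have h3 := dvT_y (n := n) i
  have h4 := dvT_y (n := n) j
  have h5 := dv_comm (eXS n i) (eXS n j)
  have h6 := dv_comm (eXS n i) (eTS n)
  have h7 := dv_comm (eXS n j) (eTS n)
  have h8 := mu_comm (yco i) (yco (n := n) j)
  generalize dv (eXS n i) = a at *
  generalize dv (eXS n j) = b at *
  generalize dv (eTS n) = t at *
  generalize mu (yco i) = u at *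
  generalize mu (yco j) = v at *
  simp only [add_mul, mul_add, smul_mul_assoc, mul_smul_comm]
  have e1 : a * (v * t) = v * t * a := by rw [← mul_assoc, h1, mul_assoc, h6, mul_assoc]
  have e2 : b * (u * t) = u * t * b := by rw [← mul_assoc, h2, mul_assoc, h7, mul_assoc]
  have e3 : u * t * (v * t) = v * t * (u * t) := by
    calc u * t * (v * t) = u * (t * v) * t := by simp only [mul_assoc]
      _ = (u * v) * t * t := by rw [h4]; simp only [mul_assoc]
      _ = v * (u * t) * t := by rw [h8]; simp only [mul_assoc]
      _ = _ := by rw [mul_assoc v t, ← mul_assoc t u t, h3]; simp only [mul_assoc]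
  rw [e1, e2, e3, h5]; module
lemma Y_Y {n : ℕ} (i j : Fin n) : (YO i : Op n) * YO j = YO j * YO i := by
  simp only [YO]
  have h1 := dvY_x (n := n) i j
  have h2 := dvY_x (n := n) j i
  have h3 := dvT_x (n := n) i
  have h4 := dvT_x (n := n) j
  have h5 := dv_comm (eYS n i) (eYS n j)
  have h6 := dv_comm (eYS n i) (eTS n)
  have h7 := dv_comm (eYS n j) (eTS n)
  have h8 := mu_comm (xco i) (xco (n := n) j)
  generalize dv (eYS n i) = a at *
  generalize dv (eYS n j) = b at *
  generalize dv (eTS n) = t at *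
  generalize mu (xco i) = u at *
  generalize mu (xco j) = v at *
  simp only [sub_mul, mul_sub, smul_mul_assoc, mul_smul_comm]
  have e1 : a * (v * t) = v * t * a := by rw [← mul_assoc, h1, mul_assoc, h6, mul_assoc]
  have e2 : b * (u * t) = u * t * b := by rw [← mul_assoc, h2, mul_assoc, h7, mul_assoc]
  have e3 : u * t * (v * t) = v * t * (u * t) := by
    calc u * t * (v * t) = u * (t * v) * t := by simp only [mul_assoc]
      _ = (u * v) * t * t := by rw [h4]; simp only [mul_assoc]
      _ = v * (u * t) * t := by rw [h8]; simp only [mul_assoc]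
      _ = _ := by rw [mul_assoc v t, ← mul_assoc t u t, h3]; simp only [mul_assoc]
  rw [e1, e2, e3, h5]; module
lemma X_Y {n : ℕ} (i j : Fin n) : (XO i : Op n) * YO j = YO j * XO i - (if i = j then (4 : ℂ) • (TO : Op n) else 0) := by
  simp only [XO, YO, TO]
  have h1 := dvX_x (n := n) i j
  have h2 := dvY_y (n := n) j i
  have h3 := dvT_x (n := n) j
  have h4 := dvT_y (n := n) i
  have h5 := dv_comm (eXS n i) (eYS n j)
  have h6 := dv_comm (eXS n i) (eTS n)
  have h7 := dv_comm (eYS n j) (eTS n)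
  have h8 := mu_comm (xco j) (yco (n := n) i)
  generalize dv (eXS n i) = a at *
  generalize dv (eYS n j) = b at *
  generalize dv (eTS n) = t at *
  generalize mu (xco j) = u at *
  generalize mu (yco i) = v at *
  simp only [sub_mul, add_mul, mul_add, mul_sub, smul_mul_assoc, mul_smul_comm]
  have e1 : a * (u * t) = u * t * a + (if i = j then t else 0) := by
    rw [← mul_assoc, h1, add_mul, mul_assoc, h6, mul_assoc]; simp [eq_comm]
  have e2 : b * (v * t) = v * t * b + (if i = j then t else 0) := by
    rw [← mul_assoc, h2, add_mul, mul_assoc, h7, mul_assoc]; simp [eq_comm]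
  have e3 : u * t * (v * t) = v * t * (u * t) := by
    calc u * t * (v * t) = u * (t * v) * t := by simp only [mul_assoc]
      _ = (u * v) * t * t := by rw [h4]; simp only [mul_assoc]
      _ = v * (u * t) * t := by rw [h8]; simp only [mul_assoc]
      _ = _ := by rw [mul_assoc v t, ← mul_assoc t u t, h3]; simp only [mul_assoc]
  rw [e1, e2, e3, h5]
  split_ifs
  · module
  · module

lemma dv_ea0 {n : ℕ} (v : Sg n) (hv : v.2 = 0) (c : ℝ) : dv v * mu (ea c) = mu (ea c) * dv v := by
  rw [dv_mu, dv_ea, hv]; simp [mu_zero]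
lemma dvA_x {n : ℕ} (j : Fin n) : dv (eA n) * mu (xco j) = mu (xco j) * dv (eA n) := by
  rw [dv_mu, dv_xco']; simp [eA, mu_zero]
lemma dvA_y {n : ℕ} (j : Fin n) : dv (eA n) * mu (yco j) = mu (yco j) * dv (eA n) := by
  rw [dv_mu, dv_yco']; simp [eA, mu_zero]

lemma X_ea {n : ℕ} (j : Fin n) (c : ℝ) : (XO j : Op n) * mu (ea c) = mu (ea c) * XO j := by
  simp only [XO, add_mul, mul_add, smul_mul_assoc, mul_smul_comm, mul_assoc]
  rw [dv_ea0 _ rfl, dv_ea0 _ rfl, ← mul_assoc, ← mul_assoc (mu (ea c)) (mu _), mu_comm]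
lemma Y_ea {n : ℕ} (j : Fin n) (c : ℝ) : (YO j : Op n) * mu (ea c) = mu (ea c) * YO j := by
  simp only [YO, sub_mul, mul_sub, smul_mul_assoc, mul_smul_comm, mul_assoc]
  rw [dv_ea0 _ rfl, dv_ea0 _ rfl, ← mul_assoc, ← mul_assoc (mu (ea c)) (mu _), mu_comm]
lemma T_ea {n : ℕ} (c : ℝ) : (TO : Op n) * mu (ea c) = mu (ea c) * TO := dv_ea0 _ rfl c
lemma dvA_X {n : ℕ} (j : Fin n) : dv (eA n) * XO j = XO j * dv (eA n) := by
  simp only [XO, add_mul, mul_add, smul_mul_assoc, mul_smul_comm, mul_assoc]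
  rw [dv_comm (eTS n), ← mul_assoc (dv _) (mu _), dvA_y, dv_comm, mul_assoc]
lemma dvA_Y {n : ℕ} (j : Fin n) : dv (eA n) * YO j = YO j * dv (eA n) := by
  simp only [YO, sub_mul, mul_sub, smul_mul_assoc, mul_smul_comm, mul_assoc]
  rw [dv_comm (eTS n), ← mul_assoc (dv _) (mu _), dvA_x, dv_comm, mul_assoc]
lemma X_A {n : ℕ} (j : Fin n) : (XO j : Op n) * AO = AO * XO j := by
  rw [AO, ← mul_assoc, X_ea, mul_assoc, ← dvA_X, mul_assoc]
lemma Y_A {n : ℕ} (j : Fin n) : (YO j : Op n) * AO = AO * YO j := by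
  rw [AO, ← mul_assoc, Y_ea, mul_assoc, ← dvA_Y, mul_assoc]
lemma T_A {n : ℕ} : (TO : Op n) * AO = AO * TO := by
  rw [AO, ← mul_assoc, T_ea, mul_assoc, TO, dv_comm, mul_assoc]
lemma X_M {n : ℕ} (j : Fin n) : (XO j : Op n) * MA = MA * XO j := X_ea j 1
lemma Y_M {n : ℕ} (j : Fin n) : (YO j : Op n) * MA = MA * YO j := Y_ea j 1
lemma T_M {n : ℕ} : (TO : Op n) * MA = MA * TO := T_ea 1
lemma A_ea {n : ℕ} (c : ℝ) : (AO (ea c) : Sm n) = (c : ℂ) • ea (c - 1) := by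
  rw [AO, Module.End.mul_apply, dv_ea, mu_ap, mul_smul_comm, ea_mul]
  simp [eA]; congr 2; ring
lemma A_M {n : ℕ} : (AO : Op n) * MA = MA * AO + 1 := by
  rw [MA, isDer_A.comm_mu, A_ea]; simp [ea_zero, mu_one]
lemma X_ea' {n : ℕ} (j : Fin n) (c : ℝ) : (XO j (ea c) : Sm n) = 0 := by
  simp [XO, Module.End.mul_apply, dv_ea, eXS, eTS]
lemma Y_ea' {n : ℕ} (j : Fin n) (c : ℝ) : (YO j (ea c) : Sm n) = 0 := by
  simp [YO, Module.End.mul_apply, dv_ea, eYS, eTS]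
lemma T_ea' {n : ℕ} (c : ℝ) : (TO (ea c) : Sm n) = 0 := by
  simp [TO, dv_ea, eTS]

/-! ### Part 2 : weights -/

instance instHaarC (n : ℕ) : (volume : Measure (Fin n → ℂ)).IsAddHaarMeasure := by infer_instance
instance instHaarHn (n : ℕ) : (volume : Measure (Hn n)).IsAddHaarMeasure := by
  rw [Measure.volume_eq_prod]; infer_instance
instance instHaarSg (n : ℕ) : (volume : Measure (Sg n)).IsAddHaarMeasure := by
  rw [Measure.volume_eq_prod]; infer_instance

lemma int_exp_abs {e : ℝ} (he : 0 < e) : Integrable (fun s : ℝ => Real.exp (-e * |s|)) := by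
  rw [← integrableOn_univ, ← Iic_union_Ioi (a := (0 : ℝ)), integrableOn_union]
  constructor
  · refine (integrableOn_exp_mul_Iic he 0).congr_fun (fun s hs => ?_) measurableSet_Iic
    simp only [mem_Iic] at hs; simp only; rw [abs_of_nonpos hs]; congr 1; ring
  · refine (integrableOn_exp_mul_Ioi (neg_lt_zero.2 he) 0).congr_fun (fun s hs => ?_) measurableSet_Ioi
    simp only [mem_Ioi] at hs; simp only; rw [abs_of_pos hs]

/-- `|ζ|²` -/
def NN {n : ℕ} (p : Sg n) : ℝ := ∑ j, ((p.1.1 j).re ^ 2 + (p.1.1 j).im ^ 2)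
/-- `ρ_r` -/
def rh {n : ℕ} (r : ℝ) (p : Sg n) : ℝ := 1 + r ^ 2 * (NN p ^ 2 + p.1.2 ^ 2 + Real.exp p.2 ^ 2)

lemma NN_nonneg {n : ℕ} (p : Sg n) : 0 ≤ NN p := Finset.sum_nonneg (fun j _ => by positivity)
lemma rh_ge {n : ℕ} (r : ℝ) (p : Sg n) : 1 ≤ rh r p := by
  have := NN_nonneg p
  unfold rh; nlinarith [mul_nonneg (sq_nonneg r) (by positivity : 0 ≤ NN p ^ 2 + p.1.2 ^ 2 + Real.exp p.2 ^ 2)]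
lemma rh_pos {n : ℕ} (r : ℝ) (p : Sg n) : 0 < rh r p := lt_of_lt_of_le one_pos (rh_ge r p)

lemma NN_ge {n : ℕ} (p : Sg n) (j : Fin n) : (p.1.1 j).re ^ 2 + (p.1.1 j).im ^ 2 ≤ NN p :=
  Finset.single_le_sum (f := fun j => (p.1.1 j).re ^ 2 + (p.1.1 j).im ^ 2)
    (fun j _ => by positivity) (Finset.mem_univ j)

lemma cont_NN {n : ℕ} : Continuous (NN : Sg n → ℝ) := by unfold NN; fun_prop
lemma cont_rh {n : ℕ} (r : ℝ) : Continuous (rh r : Sg n → ℝ) := by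
  have := cont_NN (n := n); unfold rh; fun_prop

lemma rh_mono {n : ℕ} {r s : ℝ} (hr : 0 ≤ r) (h : r ≤ s) (p : Sg n) : rh r p ≤ rh s p := by
  unfold rh; gcongr
lemma rh_scale {n : ℕ} {r : ℝ} (hr : 0 ≤ r) (h : r ≤ 1) (p : Sg n) : r ^ 2 * rh 1 p ≤ rh r p := by
  unfold rh
  have : r ^ 2 ≤ 1 := by nlinarith
  nlinarith

lemma norm_x_le {n : ℕ} (p : Sg n) : (1 + ‖p.1‖) ^ 2 ≤ 4 * rh 1 p := by
  have h : ‖p.1‖ ^ 2 ≤ NN p + p.1.2 ^ 2 := by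
    have h1 : ‖p.1.1‖ ^ 2 ≤ NN p := by
      have : ‖p.1.1‖ ≤ Real.sqrt (NN p) := by
        rw [pi_norm_le_iff_of_nonneg (Real.sqrt_nonneg _)]
        intro j
        apply Real.le_sqrt_of_sq_le
        rw [← Complex.normSq_eq_norm_sq, Complex.normSq_apply]
        nlinarith [NN_ge p j]
      calc ‖p.1.1‖ ^ 2 ≤ Real.sqrt (NN p) ^ 2 := by gcongr
        _ = NN p := Real.sq_sqrt (NN_nonneg p)
    have h2 : ‖p.1.2‖ ^ 2 = p.1.2 ^ 2 := by simp
    rw [Prod.norm_def]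
    rcases max_choice ‖p.1.1‖ ‖p.1.2‖ with h3 | h3 <;> rw [h3]
    · nlinarith [sq_nonneg p.1.2]
    · nlinarith [NN_nonneg p]
  unfold rh
  nlinarith [sq_nonneg (‖p.1‖ - 1), sq_nonneg (NN p - 1), Real.exp_pos p.2]

/-- growth class -/
def Wt {n : ℕ} (e L : ℝ) (f : Sg n → ℝ) : Prop :=
  ∃ C, 0 ≤ C ∧ ∀ p, |f p| ≤ C * (Real.exp (e * p.2) * rh 1 p ^ L)

lemma Wt.mul {n : ℕ} {e L e' L' : ℝ} {f g : Sg n → ℝ} (hf : Wt e L f) (hg : Wt e' L' g) :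
    Wt (e + e') (L + L') (fun p => f p * g p) := by
  obtain ⟨C, hC, h⟩ := hf
  obtain ⟨D, hD, k⟩ := hg
  refine ⟨C * D, by positivity, fun p => ?_⟩
  rw [abs_mul]
  calc |f p| * |g p| ≤ (C * (Real.exp (e * p.2) * rh 1 p ^ L)) * (D * (Real.exp (e' * p.2) * rh 1 p ^ L')) := by
        have := h p; have := k p; gcongr
        exact le_trans (abs_nonneg _) (h p)
    _ = _ := by
        rw [Real.rpow_add (rh_pos 1 p), add_mul, Real.exp_add]; ring
lemma Wt.add {n : ℕ} {e L : ℝ} {f g : Sg n → ℝ} (hf : Wt e L f) (hg : Wt e L g) :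
    Wt e L (fun p => f p + g p) := by
  obtain ⟨C, hC, h⟩ := hf
  obtain ⟨D, hD, k⟩ := hg
  refine ⟨C + D, by positivity, fun p => ?_⟩
  rw [add_mul]
  exact (abs_add_le _ _).trans (add_le_add (h p) (k p))
lemma Wt.mono {n : ℕ} {e L : ℝ} {f g : Sg n → ℝ} (hf : Wt e L f) (h : ∀ p, |g p| ≤ |f p|) :
    Wt e L g := by
  obtain ⟨C, hC, k⟩ := hf
  exact ⟨C, hC, fun p => (h p).trans (k p)⟩
lemma Wt.const_mul {n : ℕ} {e L : ℝ} {f : Sg n → ℝ} (hf : Wt e L f) (c : ℝ) :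
    Wt e L (fun p => c * f p) := by
  obtain ⟨C, hC, h⟩ := hf
  refine ⟨|c| * C, by positivity, fun p => ?_⟩
  rw [abs_mul, mul_assoc]; exact mul_le_mul_of_nonneg_left (h p) (abs_nonneg _)
lemma Wt.mono_L {n : ℕ} {e L L' : ℝ} {f : Sg n → ℝ} (hf : Wt e L f) (h : L ≤ L') : Wt e L' f := by
  obtain ⟨C, hC, k⟩ := hf
  refine ⟨C, hC, fun p => (k p).trans ?_⟩
  have := Real.rpow_le_rpow_of_exponent_le (rh_ge 1 p) h
  gcongr
/-- lowering the exponent of `a` costs `ρ` -/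
lemma Wt.lower {n : ℕ} {e e' L : ℝ} {f : Sg n → ℝ} (hf : Wt e L f) (h : e' ≤ e) :
    Wt e' (L + (e - e')) f := by
  obtain ⟨C, hC, k⟩ := hf
  refine ⟨C, hC, fun p => (k p).trans ?_⟩
  have h1 : Real.exp p.2 ≤ rh 1 p := by
    unfold rh; nlinarith [sq_nonneg (Real.exp p.2 - 1), NN_nonneg p, sq_nonneg (NN p), sq_nonneg p.1.2,
      Real.exp_pos p.2]
  have h2 : Real.exp (e * p.2) ≤ Real.exp (e' * p.2) * rh 1 p ^ (e - e') := by
    calc Real.exp (e * p.2) = Real.exp (e' * p.2) * Real.exp p.2 ^ (e - e') := by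
          rw [← Real.exp_mul, ← Real.exp_add]; congr 1; ring
      _ ≤ _ := by
          have := Real.rpow_le_rpow (Real.exp_pos _).le h1 (sub_nonneg.2 h)
          gcongr
  rw [Real.rpow_add (rh_pos 1 p)]
  have hp : 0 ≤ rh 1 p ^ L := Real.rpow_nonneg (rh_pos 1 p).le _
  calc C * (Real.exp (e * p.2) * rh 1 p ^ L) ≤ C * ((Real.exp (e' * p.2) * rh 1 p ^ (e - e')) * rh 1 p ^ L) := by gcongr
    _ = _ := by ring

lemma Wt.integrable {n : ℕ} {e L : ℝ} {f : Sg n → ℝ} (hf : Wt e L f) (he : 0 < e)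
    (hL : L ≤ -(n + 1 + e)) (hc : Continuous f) : Integrable f := by
  obtain ⟨C, hC, k⟩ := hf
  have hdim : (Module.finrank ℝ (Hn n) : ℝ) < 2 * (n + 1 : ℝ) := by
    have : Module.finrank ℝ (Hn n) = n * 2 + 1 := by
      simp [Module.finrank_pi_fintype]
    rw [this]; push_cast; linarith
  have i1 : Integrable (fun x : Hn n => (1 + ‖x‖) ^ (-(2 * (n + 1 : ℝ)))) := integrable_one_add_norm hdim
  have i2 : Integrable (fun s : ℝ => Real.exp (-e * |s|)) := int_exp_abs he
  have i3 := (i1.mul_prod i2).const_mul (C * 4 ^ (n + 1 : ℝ))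
  refine Integrable.mono' i3 hc.aestronglyMeasurable (Eventually.of_forall fun p => ?_)
  rw [Real.norm_eq_abs]
  refine (k p).trans ?_
  rw [mul_assoc C]
  refine mul_le_mul_of_nonneg_left ?_ hC
  have h0 : rh 1 p ^ L ≤ rh 1 p ^ (-(n + 1 : ℝ)) * rh 1 p ^ (-e) := by
    rw [← Real.rpow_add (rh_pos 1 p)]
    exact Real.rpow_le_rpow_of_exponent_le (rh_ge 1 p) (by linarith)
  have h1 : rh 1 p ^ (-(n + 1 : ℝ)) ≤ 4 ^ (n + 1 : ℝ) * (1 + ‖p.1‖) ^ (-(2 * (n + 1 : ℝ))) := by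
    have a1 : (1 + ‖p.1‖) ^ 2 / 4 ≤ rh 1 p := by linarith [norm_x_le p]
    have a0 : 0 < (1 + ‖p.1‖) := by positivity
    have := Real.rpow_le_rpow_of_nonpos (by positivity) a1 (by linarith [(Nat.cast_nonneg n : (0:ℝ) ≤ n)] : -(n + 1 : ℝ) ≤ 0)
    refine this.trans (le_of_eq ?_)
    rw [Real.div_rpow (by positivity) (by norm_num), ← Real.rpow_natCast, ← Real.rpow_mul a0.le,
      Real.rpow_neg (by norm_num : (0:ℝ) ≤ 4), div_inv_eq_mul, mul_comm]
    congr 2; push_cast; ring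
  have h2 : Real.exp (e * p.2) * rh 1 p ^ (-e) ≤ Real.exp (-e * |p.2|) := by
    have hr : 0 ≤ rh 1 p ^ (-e) := Real.rpow_nonneg (rh_pos 1 p).le _
    rcases le_total p.2 0 with hs | hs
    · rw [abs_of_nonpos hs]
      have : rh 1 p ^ (-e) ≤ 1 := Real.rpow_le_one_of_one_le_of_nonpos (rh_ge 1 p) (by linarith)
      calc Real.exp (e * p.2) * rh 1 p ^ (-e) ≤ Real.exp (e * p.2) * 1 := by gcongr
        _ = _ := by rw [mul_one]; congr 1; ring
    · rw [abs_of_nonneg hs]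
      have h3 : Real.exp p.2 ^ 2 ≤ rh 1 p := by
        unfold rh; nlinarith [NN_nonneg p, sq_nonneg (NN p), sq_nonneg p.1.2]
      have := Real.rpow_le_rpow_of_nonpos (by positivity) h3 (by linarith : -e ≤ 0)
      calc Real.exp (e * p.2) * rh 1 p ^ (-e) ≤ Real.exp (e * p.2) * (Real.exp p.2 ^ 2) ^ (-e) := by gcongr
        _ = _ := by
          rw [← Real.rpow_natCast, ← Real.exp_mul, ← Real.exp_mul, ← Real.exp_add]; congr 1
          push_cast; ring
  calc Real.exp (e * p.2) * rh 1 p ^ L ≤ Real.exp (e * p.2) * (rh 1 p ^ (-(n + 1 : ℝ)) * rh 1 p ^ (-e)) := by gcongr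
    _ = rh 1 p ^ (-(n + 1 : ℝ)) * (Real.exp (e * p.2) * rh 1 p ^ (-e)) := by ring
    _ ≤ (4 ^ (n + 1 : ℝ) * (1 + ‖p.1‖) ^ (-(2 * (n + 1 : ℝ)))) * Real.exp (-e * |p.2|) := by
        gcongr
        exact mul_nonneg (Real.exp_pos _).le (Real.rpow_nonneg (rh_pos 1 p).le _)
    _ = _ := by ring

/-- norm growth class for smooth functions -/
def WS {n : ℕ} (e L : ℝ) (f : Sm n) : Prop := Wt e L (fun p => ‖f p‖)
/-- `∂_s = a ∂_a` -/
def SO {n : ℕ} : Op n := dv (eA n)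
lemma isDer_S {n : ℕ} : IsDer (SO : Op n) := isDer_dv _
lemma SO_eq {n : ℕ} : (SO : Op n) = MA * AO := by
  rw [MA, AO, ← mul_assoc, ← mu_mul, ea_mul]; simp [ea_zero, mu_one, SO]

lemma WS.mul {n : ℕ} {e L e' L' : ℝ} {f g : Sm n} (hf : WS e L f) (hg : WS e' L' g) :
    WS (e + e') (L + L') (f * g) := by
  refine (Wt.mul hf hg).mono (fun p => ?_)
  simp
lemma WS.add {n : ℕ} {e L : ℝ} {f g : Sm n} (hf : WS e L f) (hg : WS e L g) : WS e L (f + g) := by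
  refine (Wt.add hf hg).mono (fun p => ?_)
  rw [abs_of_nonneg (norm_nonneg _), abs_of_nonneg (by positivity)]
  exact norm_add_le _ _
lemma WS.smul {n : ℕ} {e L : ℝ} {f : Sm n} (hf : WS e L f) (c : ℂ) : WS e L (c • f) := by
  refine (Wt.const_mul hf ‖c‖).mono (fun p => ?_)
  simp
lemma WS.mono_L {n : ℕ} {e L L' : ℝ} {f : Sm n} (hf : WS e L f) (h : L ≤ L') : WS e L' f := Wt.mono_L hf h
lemma WS.integrable {n : ℕ} {e L : ℝ} {f : Sm n} (hf : WS e L f) (he : 0 < e)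
    (hL : L ≤ -(n + 1 + e)) : Integrable (Sm.fn f) := by
  have := Wt.integrable hf he hL (f.cont.norm)
  exact (integrable_norm_iff f.cont.aestronglyMeasurable).1 this

/-- first order class -/
structure W1 {n : ℕ} (e L : ℝ) (f : Sm n) : Prop where
  z : WS e L f
  x : ∀ j, WS e L (XO j f)
  y : ∀ j, WS e L (YO j f)
  t : WS e L (TO f)
  s : WS e L (SO f)

lemma WS.der_mul {n : ℕ} {e L e' L' : ℝ} {f g : Sm n} {D : Op n} (hD : IsDer D)
    (hf : WS e L f) (hf' : WS e L (D f)) (hg : WS e' L' g) (hg' : WS e' L' (D g)) :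
    WS (e + e') (L + L') (D (f * g)) := by
  rw [hD]; exact (hf'.mul hg).add (hf.mul hg')
lemma W1.mul {n : ℕ} {e L e' L' : ℝ} {f g : Sm n} (hf : W1 e L f) (hg : W1 e' L' g) :
    W1 (e + e') (L + L') (f * g) :=
  ⟨hf.z.mul hg.z, fun j => WS.der_mul (isDer_X j) hf.z (hf.x j) hg.z (hg.x j),
    fun j => WS.der_mul (isDer_Y j) hf.z (hf.y j) hg.z (hg.y j),
    WS.der_mul isDer_T hf.z hf.t hg.z hg.t, WS.der_mul isDer_S hf.z hf.s hg.z hg.s⟩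
lemma W1.smul {n : ℕ} {e L : ℝ} {f : Sm n} (hf : W1 e L f) (c : ℂ) : W1 e L (c • f) :=
  ⟨hf.z.smul c, fun j => by rw [map_smul]; exact (hf.x j).smul c,
    fun j => by rw [map_smul]; exact (hf.y j).smul c,
    by rw [map_smul]; exact hf.t.smul c, by rw [map_smul]; exact hf.s.smul c⟩
lemma W1.add {n : ℕ} {e L : ℝ} {f g : Sm n} (hf : W1 e L f) (hg : W1 e L g) : W1 e L (f + g) :=
  ⟨hf.z.add hg.z, fun j => by rw [map_add]; exact (hf.x j).add (hg.x j),
    fun j => by rw [map_add]; exact (hf.y j).add (hg.y j),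
    by rw [map_add]; exact hf.t.add hg.t, by rw [map_add]; exact hf.s.add hg.s⟩
lemma WS.zero {n : ℕ} (e L : ℝ) : WS e L (0 : Sm n) := ⟨0, le_rfl, fun p => by simp⟩
lemma WS_ea {n : ℕ} (c : ℝ) : WS c 0 (ea c : Sm n) := ⟨1, zero_le_one, fun p => by
  show |‖Sm.fn (ea c) p‖| ≤ _
  rw [ea_ap, abs_of_nonneg (norm_nonneg _), Complex.norm_real, Real.norm_eq_abs, abs_of_pos (Real.exp_pos _)]; simp⟩
lemma W1_ea {n : ℕ} (c : ℝ) : W1 c 0 (ea c : Sm n) := by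
  refine ⟨WS_ea c, fun j => ?_, fun j => ?_, ?_, ?_⟩
  · rw [X_ea']; exact WS.zero _ _
  · rw [Y_ea']; exact WS.zero _ _
  · rw [T_ea']; exact WS.zero _ _
  · rw [SO, dv_ea]; exact (WS_ea c).smul _

/-- integral over `Sg n` of a directional derivative vanishes -/
lemma int_dv {n : ℕ} (v : Sg n) (f : Sm n) (h0 : Integrable (Sm.fn f)) (h1 : Integrable (Sm.fn (dv v f))) :
    ∫ p, dv v f p = 0 := by
  have h1' : Integrable (fun x => (fderiv ℝ f.fn x) v) := h1
  have := integral_mul_fderiv_eq_neg_fderiv_mul_of_integrable (μ := (volume : Measure (Sg n)))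
    (f := fun _ => (1 : ℂ)) (g := Sm.fn f) (v := v) (by simp) (by simpa using h1') (by simpa using h0)
    (fun x _ => differentiableAt_const _) (fun x _ => f.diff x)
  simp at this
  exact this

lemma WS_xco {n : ℕ} (j : Fin n) : WS 0 1 (xco j : Sm n) := ⟨1, zero_le_one, fun p => by
  show |‖Sm.fn (xco j) p‖| ≤ _
  rw [xco_ap, abs_of_nonneg (norm_nonneg _), Complex.norm_real, Real.norm_eq_abs]
  have := NN_ge p j
  simp
  apply abs_le_of_sq_le_sq _ (rh_pos 1 p).le
  unfold rh; nlinarith [sq_nonneg (p.1.1 j).im, sq_nonneg (NN p - 1), sq_nonneg p.1.2, sq_nonneg (Real.exp p.2), sq_nonneg (NN p ^ 2 + p.1.2 ^ 2 + Real.exp p.2 ^ 2)]⟩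
lemma WS_yco {n : ℕ} (j : Fin n) : WS 0 1 (yco j : Sm n) := ⟨1, zero_le_one, fun p => by
  show |‖Sm.fn (yco j) p‖| ≤ _
  rw [yco_ap, abs_of_nonneg (norm_nonneg _), Complex.norm_real, Real.norm_eq_abs]
  have := NN_ge p j
  simp
  apply abs_le_of_sq_le_sq _ (rh_pos 1 p).le
  unfold rh; nlinarith [sq_nonneg (p.1.1 j).re, sq_nonneg (NN p - 1), sq_nonneg p.1.2, sq_nonneg (Real.exp p.2), sq_nonneg (NN p ^ 2 + p.1.2 ^ 2 + Real.exp p.2 ^ 2)]⟩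

section ibp
variable {n : ℕ} {e L : ℝ} {f : Sm n} (hf : W1 e L f) (he : 0 < e) (hL : L + 1 ≤ -(n + 1 + e))
include hf he hL

lemma W1.int_S : ∫ p, SO f p = 0 :=
  int_dv _ _ (hf.z.integrable he (by linarith)) (hf.s.integrable he (by linarith))
lemma W1.int_T : ∫ p, TO f p = 0 :=
  int_dv _ _ (hf.z.integrable he (by linarith)) (hf.t.integrable he (by linarith))
lemma W1.int_X (j : Fin n) : ∫ p, XO j f p = 0 := by
  have hyf : WS e (L + 1) (yco j * f) := by
    have := (WS_yco j).mul hf.z; rw [zero_add, add_comm] at this; exact this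
  have hyTf : WS e (L + 1) (yco j * TO f) := by
    have := (WS_yco j).mul hf.t; rw [zero_add, add_comm] at this; exact this
  have e1 : dv (eTS n) (yco j * f) = yco j * TO f := by
    rw [dv_mul, dv_yco']; simp [eTS, eT, TO]
  have i1 : ∫ p, (yco j * TO f) p = 0 := by
    rw [← e1]; apply int_dv _ _ (hyf.integrable he hL); rw [e1]; exact hyTf.integrable he hL
  have e2 : dv (eXS n j) f = XO j f + (-2 : ℂ) • (yco j * TO f) := by
    simp only [XO, TO, LinearMap.add_apply, LinearMap.smul_apply, Module.End.mul_apply, mu_ap]; module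
  have w2 : WS e (L + 1) (dv (eXS n j) f) := by
    rw [e2]; exact ((hf.x j).mono_L (by linarith)).add (hyTf.smul _)
  have i2 := int_dv (eXS n j) f (hf.z.integrable he (by linarith)) (w2.integrable he hL)
  have e3 : ∀ p, XO j f p = dv (eXS n j) f p + 2 * (yco j * TO f) p := by
    intro p; rw [e2]; simp
  simp_rw [e3]
  rw [integral_add (w2.integrable he hL) ((hyTf.integrable he hL).const_mul 2), i2,
    integral_const_mul, i1]; simp
lemma W1.int_Y (j : Fin n) : ∫ p, YO j f p = 0 := by
  have hyf : WS e (L + 1) (xco j * f) := by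
    have := (WS_xco j).mul hf.z; rw [zero_add, add_comm] at this; exact this
  have hyTf : WS e (L + 1) (xco j * TO f) := by
    have := (WS_xco j).mul hf.t; rw [zero_add, add_comm] at this; exact this
  have e1 : dv (eTS n) (xco j * f) = xco j * TO f := by
    rw [dv_mul, dv_xco']; simp [eTS, eT, TO]
  have i1 : ∫ p, (xco j * TO f) p = 0 := by
    rw [← e1]; apply int_dv _ _ (hyf.integrable he hL); rw [e1]; exact hyTf.integrable he hL
  have e2 : dv (eYS n j) f = YO j f + (2 : ℂ) • (xco j * TO f) := by
    simp only [YO, TO, LinearMap.sub_apply, LinearMap.smul_apply, Module.End.mul_apply, mu_ap]; module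
  have w2 : WS e (L + 1) (dv (eYS n j) f) := by
    rw [e2]; exact ((hf.y j).mono_L (by linarith)).add (hyTf.smul _)
  have i2 := int_dv (eYS n j) f (hf.z.integrable he (by linarith)) (w2.integrable he hL)
  have e3 : ∀ p, YO j f p = dv (eYS n j) f p + (-2) * (xco j * TO f) p := by
    intro p; rw [e2]; simp
  simp_rw [e3]
  rw [integral_add (w2.integrable he hL) ((hyTf.integrable he hL).const_mul (-2)), i2,
    integral_const_mul, i1]; simp
end ibp

/-! ### Part 3 : cut-off weights, good functions -/

/-- complex conjugation -/
def cj {n : ℕ} (f : Sm n) : Sm n := Sm.mk (fun p => (starRingEnd ℂ) (f p))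
  (Complex.conjCLE.contDiff.comp f.cd)
lemma cj_ap {n : ℕ} (f : Sm n) (p : Sg n) : cj f p = (starRingEnd ℂ) (f p) := rfl
lemma dv_cj {n : ℕ} (v : Sg n) (f : Sm n) : dv v (cj f) = cj (dv v f) := by
  apply Sm.ext; intro p
  rw [dv_ap, cj_ap, dv_ap]
  have h : HasFDerivAt (cj f).fn ((Complex.conjCLE : ℂ →L[ℝ] ℂ).comp (fderiv ℝ f.fn p)) p :=
    (Complex.conjCLE : ℂ →L[ℝ] ℂ).hasFDerivAt.comp p (f.diff p).hasFDerivAt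
  rw [h.fderiv]; rfl
lemma cj_X {n : ℕ} (j : Fin n) (f : Sm n) : XO j (cj f) = cj (XO j f) := by
  apply Sm.ext; intro p
  simp [XO, Module.End.mul_apply, dv_cj, cj_ap, yco_ap, map_add, map_mul]
  exact Or.inl (map_ofNat _ 2).symm
lemma cj_Y {n : ℕ} (j : Fin n) (f : Sm n) : YO j (cj f) = cj (YO j f) := by
  apply Sm.ext; intro p
  simp [YO, Module.End.mul_apply, dv_cj, cj_ap, xco_ap, map_sub, map_mul]
  exact Or.inl (map_ofNat _ 2).symm
lemma cj_T {n : ℕ} (f : Sm n) : TO (cj f) = cj (TO f) := dv_cj _ f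
lemma cj_S {n : ℕ} (f : Sm n) : SO (cj f) = cj (SO f) := dv_cj _ f
lemma cj_A {n : ℕ} (f : Sm n) : AO (cj f) = cj (AO f) := by
  apply Sm.ext; intro p
  simp only [AO, Module.End.mul_apply, dv_cj, mu_ap, Sm.mul_ap, cj_ap, ea_ap, map_mul, Complex.conj_ofReal]
lemma WS.cj {n : ℕ} {e L : ℝ} {f : Sm n} (hf : WS e L f) : WS e L (cj f) := by
  refine Wt.mono hf (fun p => ?_)
  simp [cj_ap]
lemma W1.cj {n : ℕ} {e L : ℝ} {f : Sm n} (hf : W1 e L f) : W1 e L (cj f) :=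
  ⟨hf.z.cj, fun j => by rw [cj_X]; exact (hf.x j).cj, fun j => by rw [cj_Y]; exact (hf.y j).cj,
    by rw [cj_T]; exact hf.t.cj, by rw [cj_S]; exact hf.s.cj⟩

/-- `ρ_r` as smooth function -/
def rhS {n : ℕ} (r : ℝ) : Sm n :=
  1 + ((r ^ 2 : ℝ) : ℂ) • ((∑ j, (xco j ^ 2 + yco j ^ 2)) ^ 2 + tco ^ 2 + ea 2)
@[simp] lemma Sm.pow_ap {n : ℕ} (f : Sm n) (k : ℕ) (p : Sg n) : (f ^ k) p = f p ^ k := by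
  induction k with
  | zero => simp
  | succ k ih => rw [pow_succ, pow_succ, Sm.mul_ap, ih]
lemma rhS_ap {n : ℕ} (r : ℝ) (p : Sg n) : rhS r p = (rh r p : ℂ) := by
  simp only [rhS, rh, NN, Sm.add_ap, Sm.one_ap, Sm.smul_ap, Sm.pow_ap, Sm.sum_ap, xco_ap, yco_ap, tco_ap, ea_ap]
  rw [two_mul, Real.exp_add]
  push_cast; ring
/-- `ω` -/
def om {n : ℕ} (r : ℝ) (K : ℕ) (p : Sg n) : ℝ := (rh r p ^ K)⁻¹
lemma om_pos {n : ℕ} (r : ℝ) (K : ℕ) (p : Sg n) : 0 < om r K p := by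
  have := rh_pos r p; unfold om; positivity
lemma om_cd {n : ℕ} (r : ℝ) (K : ℕ) : ContDiff ℝ (⊤ : ℕ∞) (om r K : Sg n → ℝ) := by
  have h1 : ContDiff ℝ (⊤ : ℕ∞) (rh r : Sg n → ℝ) := by
    have := Complex.reCLM.contDiff.comp (rhS (n := n) r).cd
    convert this using 1
    funext p; simp [rhS_ap]
  unfold om
  exact (h1.pow K).inv (fun p => (pow_pos (rh_pos r p) K).ne')
def omS {n : ℕ} (r : ℝ) (K : ℕ) : Sm n := Sm.mk (fun p => (om r K p : ℂ)) (Complex.ofRealCLM.contDiff.comp (om_cd r K))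
lemma omS_ap {n : ℕ} (r : ℝ) (K : ℕ) (p : Sg n) : omS r K p = (om r K p : ℂ) := rfl
lemma om_cont {n : ℕ} (r : ℝ) (K : ℕ) : Continuous (om r K : Sg n → ℝ) := (om_cd r K).continuous

lemma IsDer.one {n : ℕ} {D : Op n} (h : IsDer D) : D 1 = 0 := by
  have := h 1 1; simp at this; exact this
lemma IsDer.pow {n : ℕ} {D : Op n} (h : IsDer D) (f : Sm n) (k : ℕ) :
    D (f ^ k) * f = (k : ℂ) • (f ^ k * D f) := by
  induction k with
  | zero => simp [h.one]
  | succ k ih =>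
    rw [pow_succ, h, add_mul]
    have : D (f ^ k) * f * f = (k : ℂ) • (f ^ k * D f) * f := by rw [ih]
    rw [this]; push_cast; rw [add_smul, one_smul, smul_mul_assoc]; congr 1
    · congr 1; ring
    · ring
lemma IsDer.om {n : ℕ} {D : Op n} (h : IsDer D) (r : ℝ) (K : ℕ) (p : Sg n) :
    ‖D (omS r K) p‖ * rh r p = K * om r K p * ‖D (rhS r) p‖ := by
  have e1 : omS r K * rhS r ^ K = (1 : Sm n) := by
    apply Sm.ext; intro p
    have := (pow_pos (rh_pos r p) K).ne'
    simp only [Sm.mul_ap, Sm.pow_ap, omS_ap, rhS_ap, Sm.one_ap, _root_.om]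
    rw [← Complex.ofReal_pow, ← Complex.ofReal_mul, inv_mul_cancel₀ this]; simp
  have e2 : D (omS r K) * rhS r ^ K + omS r K * D (rhS r ^ K) = 0 := by rw [← h, e1, h.one]
  have e3 : D (omS r K) * rhS r = -((K : ℂ) • (omS r K * D (rhS r))) := by
    have e4 := h.pow (rhS r) K
    have : (D (omS r K) * rhS r + ((K : ℂ) • (omS r K * D (rhS r)))) * rhS r ^ K = 0 := by
      have e5 : (K : ℂ) • (omS r K * D (rhS r)) * rhS r ^ K = omS r K * (D (rhS r ^ K) * rhS r) := by
        rw [e4, smul_mul_assoc, mul_smul_comm]; congr 1; ring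
      rw [add_mul, e5]
      calc _ = (D (omS r K) * rhS r ^ K + omS r K * D (rhS r ^ K)) * rhS r := by ring
        _ = 0 := by rw [e2, zero_mul]
    have e6 : (D (omS r K) * rhS r + ((K : ℂ) • (omS r K * D (rhS r)))) = 0 := by
      calc _ = ((D (omS r K) * rhS r + ((K : ℂ) • (omS r K * D (rhS r)))) * rhS r ^ K) * omS r K := by
            rw [mul_assoc, mul_comm (rhS r ^ K), e1, mul_one]
        _ = 0 := by rw [this, zero_mul]
    exact eq_neg_of_add_eq_zero_left e6
  have e7 := congrArg (fun f : Sm n => ‖f p‖) e3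
  simp only [Sm.mul_ap, Sm.neg_ap, Sm.smul_ap, norm_neg, norm_mul, omS_ap, rhS_ap, Complex.norm_real,
    Real.norm_eq_abs, abs_of_pos (rh_pos r p), abs_of_pos (om_pos r K p), Complex.norm_natCast] at e7
  rw [e7]; ring

lemma IsDer.sq {n : ℕ} {D : Op n} (h : IsDer D) (f : Sm n) : D (f ^ 2) = (2 : ℂ) • (f * D f) := by
  rw [pow_two, h, two_smul]; ring
lemma IsDer.rho {n : ℕ} {D : Op n} (h : IsDer D) (r : ℝ) : D (rhS r) = 
    ((r ^ 2 : ℝ) : ℂ) • ((2 : ℂ) • ((∑ j, (xco j ^ 2 + yco j ^ 2)) * 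
      ∑ j, ((2 : ℂ) • (xco j * D (xco j)) + (2 : ℂ) • (yco j * D (yco j)))) + (2 : ℂ) • (tco * D tco) + D (ea 2)) := by
  unfold rhS
  rw [map_add, h.one, zero_add, map_smul, map_add, map_add, h.sq, h.sq, map_sum]
  simp only [map_add, h.sq]

lemma X_rho {n : ℕ} (r : ℝ) (j : Fin n) (p : Sg n) : XO j (rhS r) p =
    ((r ^ 2 * (4 * NN p * (p.1.1 j).re + 4 * p.1.2 * (p.1.1 j).im) : ℝ) : ℂ) := by
  rw [(isDer_X j).rho, X_ea']
  have hx : ∀ i, XO j (xco i) p = if i = j then 1 else 0 := by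
    intro i
    simp only [XO, LinearMap.add_apply, LinearMap.smul_apply, Module.End.mul_apply, mu_ap, Sm.add_ap, Sm.smul_ap, Sm.mul_ap, dv_xco]
    simp [eXS, eX, eTS, eT]; split_ifs <;> simp
  have hy : ∀ i, XO j (yco i) p = 0 := by
    intro i
    simp only [XO, LinearMap.add_apply, LinearMap.smul_apply, Module.End.mul_apply, mu_ap, Sm.add_ap, Sm.smul_ap, Sm.mul_ap, dv_yco]
    simp [eXS, eX, eTS, eT]; split_ifs <;> simp
  have ht : XO j tco p = 2 * ((p.1.1 j).im : ℂ) := by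
    simp only [XO, LinearMap.add_apply, LinearMap.smul_apply, Module.End.mul_apply, mu_ap, Sm.add_ap, Sm.smul_ap, Sm.mul_ap, dv_tco, yco_ap]
    simp [eXS, eX, eTS, eT]
  simp only [Sm.smul_ap, Sm.add_ap, Sm.mul_ap, Sm.sum_ap, Sm.pow_ap, hx, hy, ht, xco_ap, yco_ap, tco_ap, Sm.zero_ap, NN]
  simp
  left; ring
lemma Y_rho {n : ℕ} (r : ℝ) (j : Fin n) (p : Sg n) : YO j (rhS r) p =
    ((r ^ 2 * (4 * NN p * (p.1.1 j).im - 4 * p.1.2 * (p.1.1 j).re) : ℝ) : ℂ) := by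
  rw [(isDer_Y j).rho, Y_ea']
  have hx : ∀ i, YO j (yco i) p = if i = j then 1 else 0 := by
    intro i
    simp only [YO, LinearMap.sub_apply, LinearMap.smul_apply, Module.End.mul_apply, mu_ap, Sm.sub_ap, Sm.smul_ap, Sm.mul_ap, dv_yco]
    simp [eYS, eY, eTS, eT]; split_ifs <;> simp
  have hy : ∀ i, YO j (xco i) p = 0 := by
    intro i
    simp only [YO, LinearMap.sub_apply, LinearMap.smul_apply, Module.End.mul_apply, mu_ap, Sm.sub_ap, Sm.smul_ap, Sm.mul_ap, dv_xco]
    simp [eYS, eY, eTS, eT]; split_ifs <;> simp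
  have ht : YO j tco p = - 2 * ((p.1.1 j).re : ℂ) := by
    simp only [YO, LinearMap.sub_apply, LinearMap.smul_apply, Module.End.mul_apply, mu_ap, Sm.sub_ap, Sm.smul_ap, Sm.mul_ap, dv_tco, xco_ap]
    simp [eYS, eY, eTS, eT]
  simp only [Sm.smul_ap, Sm.add_ap, Sm.mul_ap, Sm.sum_ap, Sm.pow_ap, hx, hy, ht, xco_ap, yco_ap, tco_ap, Sm.zero_ap, NN]
  simp
  left; ring
lemma T_rho {n : ℕ} (r : ℝ) (p : Sg n) : TO (rhS r) p = ((r ^ 2 * (2 * p.1.2) : ℝ) : ℂ) := by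
  rw [isDer_T.rho, T_ea']
  simp only [Sm.smul_ap, Sm.add_ap, Sm.mul_ap, Sm.sum_ap, Sm.pow_ap, TO, dv_xco, dv_yco, dv_tco, xco_ap, yco_ap, tco_ap, Sm.zero_ap]
  simp [eTS, eT]
lemma S_rho {n : ℕ} (r : ℝ) (p : Sg n) : SO (rhS r) p = ((r ^ 2 * (2 * Real.exp p.2 ^ 2) : ℝ) : ℂ) := by
  rw [isDer_S.rho, SO, dv_ea]
  simp only [Sm.smul_ap, Sm.add_ap, Sm.mul_ap, Sm.sum_ap, Sm.pow_ap, dv_xco, dv_yco, dv_tco, xco_ap, yco_ap, tco_ap, Sm.zero_ap, ea_ap]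
  simp [eA]; rw [← Complex.exp_nat_mul]; simp
lemma A_rho {n : ℕ} (r : ℝ) (p : Sg n) : AO (rhS r) p = ((r ^ 2 * (2 * Real.exp p.2) : ℝ) : ℂ) := by
  have : AO (rhS r) p = ea (-1) p * SO (rhS r) p := rfl
  rw [this, S_rho, ea_ap, ← Complex.ofReal_mul]; congr 1
  have : Real.exp (-1 * p.2) * Real.exp p.2 = 1 := by rw [← Real.exp_add]; simp
  linear_combination (r ^ 2 * 2 * Real.exp p.2) * this

section bds
variable {n : ℕ} {r : ℝ} (hr : 0 < r) (K : ℕ) (p : Sg n)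
include hr

lemma rh_facts : r * NN p ≤ rh r p ∧ r ^ 2 * (NN p ^ 2 + p.1.2 ^ 2) ≤ rh r p ∧ r * Real.exp p.2 ≤ rh r p
    ∧ r ^ 2 * Real.exp p.2 ^ 2 ≤ rh r p ∧ 2 * (r * |p.1.2|) ≤ rh r p ∧ 2 * (r * Real.exp p.2) ≤ rh r p := by
  have h1 := sq_nonneg (r * NN p)
  have h2 := sq_nonneg (r * p.1.2)
  have h3 := sq_nonneg (r * Real.exp p.2)
  unfold rh
  refine ⟨?_, ?_, ?_, ?_, ?_, ?_⟩
  · nlinarith [sq_nonneg (r * NN p - 1)]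
  · nlinarith
  · nlinarith [sq_nonneg (r * Real.exp p.2 - 1)]
  · nlinarith
  · nlinarith [sq_nonneg (r * |p.1.2| - 1), sq_abs p.1.2]
  · nlinarith [sq_nonneg (r * Real.exp p.2 - 1)]

lemma om_of_sq {D : Op n} (hD : IsDer D) {m : ℝ} {b : ℝ} (hb : 0 ≤ b) (h : b * ‖D (rhS r) p‖ ^ 2 ≤ m * rh r p ^ 2) :
    b * ‖D (omS r K) p‖ ^ 2 ≤ (K ^ 2 * m) * om r K p ^ 2 := by
  have e := hD.om r K p
  have hp := rh_pos r p
  have : (b * ‖D (omS r K) p‖ ^ 2) * rh r p ^ 2 ≤ ((K ^ 2 * m) * om r K p ^ 2) * rh r p ^ 2 := by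
    calc (b * ‖D (omS r K) p‖ ^ 2) * rh r p ^ 2 = b * (‖D (omS r K) p‖ * rh r p) ^ 2 := by ring
      _ = (K ^ 2 * om r K p ^ 2) * (b * ‖D (rhS r) p‖ ^ 2) := by rw [e]; ring
      _ ≤ (K ^ 2 * om r K p ^ 2) * (m * rh r p ^ 2) := by gcongr
      _ = _ := by ring
  exact le_of_mul_le_mul_right this (by positivity)
lemma om_of {D : Op n} (hD : IsDer D) {m : ℝ} (h : ‖D (rhS r) p‖ ≤ m * rh r p) :
    ‖D (omS r K) p‖ ≤ (K * m) * om r K p := by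
  have e := hD.om r K p
  have hp := rh_pos r p
  have ho := om_pos r K p
  have : ‖D (omS r K) p‖ * rh r p ≤ ((K * m) * om r K p) * rh r p := by
    rw [e]
    calc _ ≤ (K * om r K p) * (m * rh r p) := by gcongr
      _ = _ := by ring
  exact le_of_mul_le_mul_right this (by positivity)

lemma X_om (j : Fin n) : ‖XO j (omS r K) p‖ ^ 2 ≤ (K ^ 2 * (32 * r)) * om r K p ^ 2 := by
  have := om_of_sq hr K p (isDer_X j) (m := 32 * r) (zero_le_one) ?_
  · simpa using this
  rw [one_mul, X_rho, Complex.norm_real, Real.norm_eq_abs, sq_abs]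
  obtain ⟨h1, h2, -⟩ := rh_facts hr p
  have h3 := NN_ge p j
  have h0 := NN_nonneg p
  have hp := rh_pos r p
  calc (r ^ 2 * (4 * NN p * (p.1.1 j).re + 4 * p.1.2 * (p.1.1 j).im)) ^ 2 
      ≤ 32 * r ^ 4 * ((NN p ^ 2 + p.1.2 ^ 2) * ((p.1.1 j).re ^ 2 + (p.1.1 j).im ^ 2)) := by
        have : 0 ≤ r ^ 4 := by positivity
        have : (4 * NN p * (p.1.1 j).re + 4 * p.1.2 * (p.1.1 j).im) ^ 2 ≤ 32 * ((NN p ^ 2 + p.1.2 ^ 2) * ((p.1.1 j).re ^ 2 + (p.1.1 j).im ^ 2)) := by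
          nlinarith [sq_nonneg (NN p * (p.1.1 j).im - p.1.2 * (p.1.1 j).re), sq_nonneg (NN p * (p.1.1 j).re + p.1.2 * (p.1.1 j).im)]
        nlinarith
    _ ≤ 32 * r ^ 4 * ((NN p ^ 2 + p.1.2 ^ 2) * NN p) := by gcongr
    _ = 32 * r * ((r ^ 2 * (NN p ^ 2 + p.1.2 ^ 2)) * (r * NN p)) := by ring
    _ ≤ 32 * r * (rh r p * rh r p) := by gcongr
    _ = _ := by ring
lemma Y_om (j : Fin n) : ‖YO j (omS r K) p‖ ^ 2 ≤ (K ^ 2 * (32 * r)) * om r K p ^ 2 := by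
  have := om_of_sq hr K p (isDer_Y j) (m := 32 * r) (zero_le_one) ?_
  · simpa using this
  rw [one_mul, Y_rho, Complex.norm_real, Real.norm_eq_abs, sq_abs]
  obtain ⟨h1, h2, -⟩ := rh_facts hr p
  have h3 := NN_ge p j
  have h0 := NN_nonneg p
  have hp := rh_pos r p
  calc (r ^ 2 * (4 * NN p * (p.1.1 j).im - 4 * p.1.2 * (p.1.1 j).re)) ^ 2 
      ≤ 32 * r ^ 4 * ((NN p ^ 2 + p.1.2 ^ 2) * ((p.1.1 j).re ^ 2 + (p.1.1 j).im ^ 2)) := by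
        have : 0 ≤ r ^ 4 := by positivity
        have : (4 * NN p * (p.1.1 j).im - 4 * p.1.2 * (p.1.1 j).re) ^ 2 ≤ 32 * ((NN p ^ 2 + p.1.2 ^ 2) * ((p.1.1 j).re ^ 2 + (p.1.1 j).im ^ 2)) := by
          nlinarith [sq_nonneg (NN p * (p.1.1 j).re + p.1.2 * (p.1.1 j).im), sq_nonneg (NN p * (p.1.1 j).im - p.1.2 * (p.1.1 j).re)]
        nlinarith
    _ ≤ 32 * r ^ 4 * ((NN p ^ 2 + p.1.2 ^ 2) * NN p) := by gcongr
    _ = 32 * r * ((r ^ 2 * (NN p ^ 2 + p.1.2 ^ 2)) * (r * NN p)) := by ring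
    _ ≤ 32 * r * (rh r p * rh r p) := by gcongr
    _ = _ := by ring
lemma T_om2 : Real.exp p.2 * ‖TO (omS r K) p‖ ^ 2 ≤ (K ^ 2 * (32 * r)) * om r K p ^ 2 := by
  apply om_of_sq hr K p isDer_T (m := 32 * r) (Real.exp_pos _).le
  rw [T_rho, Complex.norm_real, Real.norm_eq_abs, sq_abs]
  obtain ⟨h1, h2, h3, -⟩ := rh_facts hr p
  have hp := rh_pos r p
  have he := Real.exp_pos p.2
  have h4 : r ^ 2 * p.1.2 ^ 2 ≤ rh r p := le_trans (by nlinarith [mul_nonneg (sq_nonneg r) (sq_nonneg (NN p))]) h2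
  calc Real.exp p.2 * (r ^ 2 * (2 * p.1.2)) ^ 2 = 4 * r * ((r * Real.exp p.2) * (r ^ 2 * p.1.2 ^ 2)) := by ring
    _ ≤ 4 * r * (rh r p * rh r p) := by gcongr
    _ ≤ _ := by nlinarith [mul_pos hr (mul_pos hp hp)]
lemma A_om2 : Real.exp p.2 * ‖AO (omS r K) p‖ ^ 2 ≤ (K ^ 2 * (32 * r)) * om r K p ^ 2 := by
  apply om_of_sq hr K p isDer_A (m := 32 * r) (Real.exp_pos _).le
  rw [A_rho, Complex.norm_real, Real.norm_eq_abs, sq_abs]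
  obtain ⟨h1, h2, h3, h4, -⟩ := rh_facts hr p
  have hp := rh_pos r p
  have he := Real.exp_pos p.2
  calc Real.exp p.2 * (r ^ 2 * (2 * Real.exp p.2)) ^ 2 = 4 * r * ((r * Real.exp p.2) * (r ^ 2 * Real.exp p.2 ^ 2)) := by ring
    _ ≤ 4 * r * (rh r p * rh r p) := by gcongr
    _ ≤ _ := by nlinarith [mul_pos hr (mul_pos hp hp)]
lemma T_om1 : ‖TO (omS r K) p‖ ≤ (K * r) * om r K p := by
  apply om_of hr K p isDer_T
  rw [T_rho, Complex.norm_real, Real.norm_eq_abs, abs_mul, abs_mul, abs_of_pos (by positivity : 0 < r ^ 2)]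
  obtain ⟨-, -, -, -, h, -⟩ := rh_facts hr p
  simp only [Nat.abs_ofNat]
  nlinarith
lemma A_om1 : ‖AO (omS r K) p‖ ≤ (K * r) * om r K p := by
  apply om_of hr K p isDer_A
  rw [A_rho, Complex.norm_real, Real.norm_eq_abs, abs_of_pos (by positivity)]
  obtain ⟨-, -, -, -, -, h⟩ := rh_facts hr p
  nlinarith
lemma S_om1 : ‖SO (omS r K) p‖ ≤ (K * 2) * om r K p := by
  apply om_of hr K p isDer_S
  rw [S_rho, Complex.norm_real, Real.norm_eq_abs, abs_of_pos (by positivity)]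
  obtain ⟨-, -, -, h, -, -⟩ := rh_facts hr p
  nlinarith
end bds

lemma om_le {n : ℕ} {r : ℝ} (hr : 0 < r) (h1 : r ≤ 1) (K : ℕ) (p : Sg n) :
    om r K p ≤ (r ^ (2 * K))⁻¹ * om 1 K p := by
  unfold om
  rw [← mul_inv, pow_mul, ← mul_pow]
  have := rh_scale hr.le h1 p
  have := rh_pos 1 p
  gcongr
lemma om_ge {n : ℕ} {r : ℝ} (hr : 0 < r) (h1 : r ≤ 1) (K : ℕ) (p : Sg n) : om 1 K p ≤ om r K p := by
  unfold om
  have := rh_mono hr.le h1 p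
  have := rh_pos r p
  gcongr

lemma om1_rpow {n : ℕ} (K : ℕ) (p : Sg n) : om 1 K p = rh 1 p ^ (-(K : ℝ)) := by
  rw [Real.rpow_neg (rh_pos 1 p).le, Real.rpow_natCast]; rfl

lemma WS_om_of {n : ℕ} {r : ℝ} (hr : 0 < r) (h1 : r ≤ 1) (K : ℕ) {f : Sm n} {m : ℝ} (hm : 0 ≤ m)
    (h : ∀ p, ‖f p‖ ≤ m * om r K p) : WS 0 (-K) f := by
  refine ⟨m * (r ^ (2 * K))⁻¹, by positivity, fun p => ?_⟩
  rw [abs_of_nonneg (norm_nonneg _), ← om1_rpow]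
  simp only [zero_mul, Real.exp_zero, one_mul]
  rw [mul_assoc]
  exact (h p).trans (mul_le_mul_of_nonneg_left (om_le hr h1 K p) hm)
lemma norm_of_sq {x m w : ℝ} (hm : 0 ≤ m) (hw : 0 ≤ w) (h : x ^ 2 ≤ m * w ^ 2) : x ≤ Real.sqrt m * w := by
  apply le_of_sq_le_sq _ (by positivity) 
  rw [mul_pow, Real.sq_sqrt hm]; exact h
lemma W1_om {n : ℕ} {r : ℝ} (hr : 0 < r) (h1 : r ≤ 1) (K : ℕ) : W1 0 (-K) (omS r K : Sm n) := by
  refine ⟨?_, fun j => ?_, fun j => ?_, ?_, ?_⟩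
  · apply WS_om_of hr h1 K zero_le_one; intro p
    rw [omS_ap, Complex.norm_real, Real.norm_eq_abs, abs_of_pos (om_pos r K p), one_mul]
  · exact WS_om_of hr h1 K (Real.sqrt_nonneg _) fun p => norm_of_sq (by positivity) (om_pos r K p).le (X_om hr K p j)
  · exact WS_om_of hr h1 K (Real.sqrt_nonneg _) fun p => norm_of_sq (by positivity) (om_pos r K p).le (Y_om hr K p j)
  · exact WS_om_of hr h1 K (by positivity) fun p => T_om1 hr K p
  · exact WS_om_of hr h1 K (by positivity) fun p => S_om1 hr K p

/-- the algebra of invariant operators -/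
def gens (n : ℕ) : Set (Op n) := (range XO) ∪ (range YO) ∪ {TO, AO}
/-- the algebra of invariant operators -/
def DD (n : ℕ) : Subalgebra ℂ (Op n) := Algebra.adjoin ℂ (gens n)
lemma X_mem {n : ℕ} (j : Fin n) : XO j ∈ DD n := Algebra.subset_adjoin (by simp [gens])
lemma Y_mem {n : ℕ} (j : Fin n) : YO j ∈ DD n := Algebra.subset_adjoin (by simp [gens])
lemma T_mem {n : ℕ} : (TO : Op n) ∈ DD n := Algebra.subset_adjoin (by simp [gens])
lemma A_mem {n : ℕ} : (AO : Op n) ∈ DD n := Algebra.subset_adjoin (by simp [gens])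

/-- good functions -/
def Good {n : ℕ} (V : Sm n) : Prop := ∀ P ∈ DD n, ∃ C, 0 ≤ C ∧ ∀ p, ‖P V p‖ ≤ C * (1 + Real.exp (-p.2))
lemma Good.ap {n : ℕ} {V : Sm n} (h : Good V) {P : Op n} (hP : P ∈ DD n) : Good (P V) := by
  intro Q hQ
  exact h (Q * P) (mul_mem hQ hP)
lemma Good.bd {n : ℕ} {V : Sm n} (h : Good V) : ∃ C, 0 ≤ C ∧ ∀ p, ‖V p‖ ≤ C * (1 + Real.exp (-p.2)) := h 1 (one_mem _)
lemma Good.add {n : ℕ} {V W : Sm n} (h : Good V) (k : Good W) : Good (V + W) := by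
  intro P hP
  obtain ⟨C, hC, h⟩ := h P hP
  obtain ⟨D, hD, k⟩ := k P hP
  refine ⟨C + D, by positivity, fun p => ?_⟩
  rw [map_add, Sm.add_ap, add_mul]
  exact (norm_add_le _ _).trans (add_le_add (h p) (k p))
lemma Good.smul {n : ℕ} {V : Sm n} (h : Good V) (c : ℂ) : Good (c • V) := by
  intro P hP
  obtain ⟨C, hC, h⟩ := h P hP
  refine ⟨‖c‖ * C, by positivity, fun p => ?_⟩
  rw [map_smul, Sm.smul_ap, norm_mul, mul_assoc]
  exact mul_le_mul_of_nonneg_left (h p) (norm_nonneg _)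

lemma exp_le_rh {n : ℕ} (p : Sg n) : Real.exp p.2 ≤ rh 1 p := by
  have := (rh_facts one_pos p).2.2.1; simpa using this
lemma WS_of_bd {n : ℕ} {V : Sm n} {C : ℝ} (hC : 0 ≤ C) (h : ∀ p, ‖V p‖ ≤ C * (1 + Real.exp (-p.2))) : WS (-1) 1 V := by
  refine ⟨C * 2, by positivity, fun p => ?_⟩
  rw [abs_of_nonneg (norm_nonneg _), Real.rpow_one, mul_assoc]
  refine (h p).trans (mul_le_mul_of_nonneg_left ?_ hC)
  have h1 := exp_le_rh p
  have h2 := rh_ge 1 p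
  have h3 : Real.exp (-1 * p.2) * Real.exp p.2 = 1 := by rw [← Real.exp_add]; simp
  have h4 := Real.exp_pos (-1 * p.2)
  have h5 : Real.exp (-p.2) = Real.exp (-1 * p.2) := by simp
  rw [h5]
  nlinarith
lemma Good.ws {n : ℕ} {V : Sm n} (h : Good V) : WS (-1) 1 V := by
  obtain ⟨C, hC, h⟩ := h.bd
  exact WS_of_bd hC h
lemma Good.w1 {n : ℕ} {V : Sm n} (h : Good V) : W1 (-1) 1 V := by
  refine ⟨h.ws, fun j => (h.ap (X_mem j)).ws, fun j => (h.ap (Y_mem j)).ws, (h.ap T_mem).ws, ?_⟩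
  rw [SO_eq, Module.End.mul_apply, MA, mu_ap]
  obtain ⟨C, hC, h⟩ := (h.ap A_mem).bd
  refine ⟨C * 2, by positivity, fun p => ?_⟩
  rw [abs_of_nonneg (norm_nonneg _), Real.rpow_one, mul_assoc, Sm.mul_ap, norm_mul, ea_ap, Complex.norm_real,
    Real.norm_eq_abs, abs_of_pos (Real.exp_pos _), one_mul]
  have h1 : Real.exp p.2 ≤ rh 1 p := exp_le_rh p
  have h2 := rh_ge 1 p
  have h3 : Real.exp (-1 * p.2) * Real.exp p.2 = 1 := by rw [← Real.exp_add]; simp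
  have h4 := Real.exp_pos (-1 * p.2)
  have h5 : Real.exp (-p.2) = Real.exp (-1 * p.2) := by simp
  have h6 := (rh_facts one_pos p).2.2.2.1
  have h7 := Real.exp_pos p.2
  calc Real.exp p.2 * ‖AO V p‖ ≤ Real.exp p.2 * (C * (1 + Real.exp (-p.2))) := by gcongr; exact h p
    _ = C * (Real.exp p.2 + 1) := by rw [h5]; linear_combination C * h3
    _ = C * (Real.exp (-1 * p.2) * (Real.exp p.2 ^ 2 + Real.exp p.2)) := by
        linear_combination (-C * (Real.exp p.2 + 1)) * h3
    _ ≤ C * (Real.exp (-1 * p.2) * (rh 1 p + rh 1 p)) := by gcongr; simpa using h6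
    _ = _ := by ring

/-! ### Part 4 : Caccioppoli estimates and the Liouville theorem -/

section cac
variable {n : ℕ}

lemma isDer_lin (j : Fin n) (p q : ℂ) : IsDer (p • XO j + q • YO j) :=
  ((isDer_X j).smul p).add ((isDer_Y j).smul q)

/-- weighted `L²` norm -/
def dB (c r : ℝ) (K : ℕ) (V : Sm n) (p : Sg n) : ℝ := Real.exp (c * p.2) * ‖V p‖ ^ 2 * om r K p
/-- weighted `L²` norm -/
def BB (c r : ℝ) (K : ℕ) (V : Sm n) : ℝ := ∫ p, dB c r K V p

lemma dB_nonneg (c r : ℝ) (K : ℕ) (V : Sm n) (p : Sg n) : 0 ≤ dB c r K V p := by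
  have := om_pos r K p
  unfold dB; positivity
lemma BB_nonneg (c r : ℝ) (K : ℕ) (V : Sm n) : 0 ≤ BB c r K V := integral_nonneg (dB_nonneg c r K V)

/-- the quadratic density -/
def qd (c r : ℝ) (K : ℕ) (V W : Sm n) : Sm n := ea c * V * cj W * omS r K

lemma qd_norm (c r : ℝ) (K : ℕ) (V W : Sm n) (p : Sg n) :
    ‖qd c r K V W p‖ = Real.exp (c * p.2) * (‖V p‖ * ‖W p‖) * om r K p := by
  simp only [qd, Sm.mul_ap, norm_mul, ea_ap, omS_ap, cj_ap, Complex.norm_real, Real.norm_eq_abs, abs_of_pos (om_pos r K p),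
    Real.abs_exp, RCLike.norm_conj]
  ring
lemma qd_self (c r : ℝ) (K : ℕ) (V : Sm n) (p : Sg n) : qd c r K V V p = ((dB c r K V p : ℝ) : ℂ) := by
  simp only [qd, Sm.mul_ap, ea_ap, omS_ap, cj_ap, dB]
  rw [mul_assoc (_ : ℂ) (V p), Complex.mul_conj, Complex.normSq_eq_norm_sq]; push_cast; ring

variable {c r : ℝ} (hc : 2 < c) (hr : 0 < r) (h1 : r ≤ 1) {K : ℕ} (hK : n + c + 5 ≤ K)

lemma qd_w1 (hr : 0 < r) (h1 : r ≤ 1) (K : ℕ) {V W : Sm n} (hV : Good V) (hW : Good W) (c : ℝ) :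
    W1 (c - 2) (2 - K) (qd c r K V W) := by
  have := (((W1_ea c).mul hV.w1).mul hW.w1.cj).mul (W1_om hr h1 K)
  have e1 : c - 2 = c + -1 + -1 + 0 := by ring
  have e2 : (2 - K : ℝ) = 0 + 1 + 1 + -K := by ring
  rw [e1, e2]; exact this

include hc hr h1 hK in
lemma qd_int {V W : Sm n} (hV : Good V) (hW : Good W) : Integrable (Sm.fn (qd c r K V W)) :=
  (qd_w1 hr h1 K hV hW c).z.integrable (by linarith) (by linarith)
include hc hr h1 hK in
lemma qd1_int {V W : Sm n} (hV : Good V) (hW : Good W) : Integrable (Sm.fn (qd (c + 1) r K V W)) :=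
  (qd_w1 hr h1 K hV hW (c + 1)).z.integrable (by linarith) (by linarith)

include hc hr h1 hK in
lemma dB_int {V : Sm n} (hV : Good V) : Integrable (dB c r K V) := by
  refine (qd_int hc hr h1 hK hV hV).norm.congr (Eventually.of_forall fun p => ?_)
  show ‖qd c r K V V p‖ = _
  rw [qd_norm, dB]; ring
include hc hr h1 hK in
lemma dB1_int {V : Sm n} (hV : Good V) : Integrable (dB (c + 1) r K V) := by
  refine (qd1_int hc hr h1 hK hV hV).norm.congr (Eventually.of_forall fun p => ?_)
  show ‖qd (c+1) r K V V p‖ = _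
  rw [qd_norm, dB]; ring

lemma young {b x v w m o : ℝ} (hb : 0 ≤ b) (ho : 0 < o) (h : b * w ^ 2 ≤ m * o ^ 2) :
    b * (x * v * w) ≤ (1 / 2) * (b * x ^ 2 * o) + (1 / 2) * (m * (v ^ 2 * o)) := by
  have h2 : 0 ≤ b * (x * o - v * w) ^ 2 := by positivity
  have h3 : v ^ 2 * (b * w ^ 2) ≤ v ^ 2 * (m * o ^ 2) := by gcongr
  have : (b * (x * v * w)) * o ≤ ((1 / 2) * (b * x ^ 2 * o) + (1 / 2) * (m * (v ^ 2 * o))) * o := by nlinarith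
  exact le_of_mul_le_mul_right this ho

variable {ι : Type} [Fintype ι] (jj : ι → Fin n) (P Q : ι → ℂ)

/-- first order operators -/
def Lam (i : ι) : Op n := P i • XO (jj i) + Q i • YO (jj i)
/-- first order operators -/
def Lamb (i : ι) : Op n := (starRingEnd ℂ) (P i) • XO (jj i) + (starRingEnd ℂ) (Q i) • YO (jj i)
lemma isDer_Lam (i : ι) : IsDer (Lam jj P Q i) := isDer_lin _ _ _
lemma isDer_Lamb (i : ι) : IsDer (Lamb jj P Q i) := isDer_lin _ _ _
lemma Lam_mem (i : ι) : Lam jj P Q i ∈ DD n :=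
  add_mem (Subalgebra.smul_mem _ (X_mem _) _) (Subalgebra.smul_mem _ (Y_mem _) _)
lemma Lamb_mem (i : ι) : Lamb jj P Q i ∈ DD n :=
  add_mem (Subalgebra.smul_mem _ (X_mem _) _) (Subalgebra.smul_mem _ (Y_mem _) _)
lemma cj_smul (a : ℂ) (f : Sm n) : cj (a • f) = (starRingEnd ℂ) a • cj f := by
  apply Sm.ext; intro p; simp [cj_ap]
lemma cj_add (f g : Sm n) : cj (f + g) = cj f + cj g := by
  apply Sm.ext; intro p; simp [cj_ap]
lemma Lamb_cj (i : ι) (V : Sm n) : Lamb jj P Q i (cj V) = cj (Lam jj P Q i V) := by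
  simp only [Lam, Lamb, LinearMap.add_apply, LinearMap.smul_apply, cj_add, cj_smul, cj_X, cj_Y]

/-- the equation -/
def EqV (c : ℝ) (V : Sm n) : Prop :=
  MA (AO (AO V)) + MA (TO (TO V)) + (c : ℂ) • AO V + ∑ i, Lamb jj P Q i (Lam jj P Q i V) = 0

/-- energy density -/
def dE (c r : ℝ) (K : ℕ) (V : Sm n) (p : Sg n) : ℝ :=
  dB (c + 1) r K (AO V) p + dB (c + 1) r K (TO V) p + ∑ i, dB c r K (Lam jj P Q i V) p
/-- total energy -/
def EE (c r : ℝ) (K : ℕ) (V : Sm n) : ℝ := ∫ p, dE jj P Q c r K V p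
/-- constant -/
def kap (K : ℕ) : ℝ := 32 * K ^ 2 * (2 + 2 * ∑ i, (‖P i‖ ^ 2 + ‖Q i‖ ^ 2))
lemma kap_nonneg (K : ℕ) : 0 ≤ kap P Q K := by
  unfold kap
  have : 0 ≤ ∑ i, (‖P i‖ ^ 2 + ‖Q i‖ ^ 2) := Finset.sum_nonneg fun i _ => by positivity
  positivity

include hc hr h1 hK in
lemma dE_int {V : Sm n} (hV : Good V) : Integrable (dE jj P Q c r K V) :=
  ((dB1_int hc hr h1 hK (hV.ap A_mem)).add (dB1_int hc hr h1 hK (hV.ap T_mem))).add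
    (integrable_finsetSum _ fun i _ => dB_int hc hr h1 hK (hV.ap (Lam_mem jj P Q i)))

/-- the divergence -/
def Gd (c r : ℝ) (K : ℕ) (V : Sm n) : Sm n :=
  SO (qd c r K (AO V) V) + TO (qd (c + 1) r K (TO V) V) + ∑ i, Lamb jj P Q i (qd c r K (Lam jj P Q i V) V)

lemma Lamb_ea (i : ι) : Lamb jj P Q i (ea c) = 0 := by
  simp [Lamb, X_ea', Y_ea']
lemma S_ea : SO (ea c : Sm n) = (c : ℂ) • ea c := by rw [SO, dv_ea]; simp [eA]
lemma ea_succ (c : ℝ) : (ea (c + 1) : Sm n) = ea c * ea 1 := (ea_mul c 1).symm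
lemma SO_f (f : Sm n) : SO f = ea 1 * AO f := by rw [SO_eq]; rfl
lemma MA_f (f : Sm n) : MA f = ea 1 * f := rfl

lemma Gd_eq {V : Sm n} (h : EqV jj P Q c V) :
    Gd jj P Q c r K V = qd (c + 1) r K (AO V) (AO V) + qd (c + 1) r K (TO V) (TO V) 
      + ∑ i, qd c r K (Lam jj P Q i V) (Lam jj P Q i V) 
      + ea (c + 1) * AO V * cj V * AO (omS r K) + ea (c + 1) * TO V * cj V * TO (omS r K)
      + ∑ i, ea c * Lam jj P Q i V * cj V * Lamb jj P Q i (omS r K) := by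
  have e1 : SO (qd c r K (AO V) V) = (cj V * omS r K * ea c) * ((c : ℂ) • AO V + MA (AO (AO V)))
      + qd (c + 1) r K (AO V) (AO V) + ea (c + 1) * AO V * cj V * AO (omS r K) := by
    simp only [qd]
    rw [isDer_S, isDer_S, isDer_S, S_ea, SO_f (AO V), SO_f (cj V), SO_f (omS r K), cj_A, MA_f, ea_succ]
    simp only [Algebra.smul_def]
    ring
  have e2 : TO (qd (c + 1) r K (TO V) V) = (cj V * omS r K * ea c) * (MA (TO (TO V)))
      + qd (c + 1) r K (TO V) (TO V) + ea (c + 1) * TO V * cj V * TO (omS r K) := by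
    simp only [qd]
    rw [isDer_T, isDer_T, isDer_T, T_ea', cj_T, MA_f, ea_succ]
    ring
  have e3 : ∀ i, Lamb jj P Q i (qd c r K (Lam jj P Q i V) V) = (cj V * omS r K * ea c) * (Lamb jj P Q i (Lam jj P Q i V))
      + qd c r K (Lam jj P Q i V) (Lam jj P Q i V) + ea c * Lam jj P Q i V * cj V * Lamb jj P Q i (omS r K) := by
    intro i
    simp only [qd]
    rw [isDer_Lamb, isDer_Lamb, isDer_Lamb, Lamb_ea, Lamb_cj]
    ring
  unfold Gd
  rw [e1, e2, Finset.sum_congr rfl (fun i _ => e3 i), Finset.sum_add_distrib, Finset.sum_add_distrib, ← Finset.mul_sum]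
  have h' := h
  unfold EqV at h'
  linear_combination (cj V * omS r K * ea c) * h'

include hc hr h1 hK in
lemma Gd_int {V : Sm n} (hV : Good V) : Integrable (Sm.fn (Gd jj P Q c r K V)) ∧ ∫ p, Gd jj P Q c r K V p = 0 := by
  have w1 := qd_w1 hr h1 K (hV.ap A_mem) hV c
  have w2 := qd_w1 hr h1 K (hV.ap T_mem) hV (c + 1)
  have w3 := fun i => qd_w1 hr h1 K (hV.ap (Lam_mem jj P Q i)) hV c
  have p1 : 0 < c - 2 := by linarith
  have p2 : 0 < c + 1 - 2 := by linarith
  have q1 : (2 - K : ℝ) + 1 ≤ -(n + 1 + (c - 2)) := by linarith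
  have q2 : (2 - K : ℝ) + 1 ≤ -(n + 1 + (c + 1 - 2)) := by linarith
  have i1 : Integrable (Sm.fn (SO (qd c r K (AO V) V))) := w1.s.integrable p1 (by linarith)
  have i2 : Integrable (Sm.fn (TO (qd (c + 1) r K (TO V) V))) := w2.t.integrable p2 (by linarith)
  have i3x : ∀ i, Integrable (Sm.fn (XO (jj i) (qd c r K (Lam jj P Q i V) V))) := fun i => ((w3 i).x _).integrable p1 (by linarith)
  have i3y : ∀ i, Integrable (Sm.fn (YO (jj i) (qd c r K (Lam jj P Q i V) V))) := fun i => ((w3 i).y _).integrable p1 (by linarith)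
  have e3 : ∀ i, Sm.fn (Lamb jj P Q i (qd c r K (Lam jj P Q i V) V)) = fun p =>
      (starRingEnd ℂ) (P i) * XO (jj i) (qd c r K (Lam jj P Q i V) V) p + (starRingEnd ℂ) (Q i) * YO (jj i) (qd c r K (Lam jj P Q i V) V) p := by
    intro i; funext p; simp [Lamb]
  have i3 : ∀ i, Integrable (Sm.fn (Lamb jj P Q i (qd c r K (Lam jj P Q i V) V))) := by
    intro i; rw [e3]; exact ((i3x i).const_mul _).add ((i3y i).const_mul _)
  have z3 : ∀ i, ∫ p, Sm.fn (Lamb jj P Q i (qd c r K (Lam jj P Q i V) V)) p = 0 := by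
    intro i; rw [e3, integral_add ((i3x i).const_mul _) ((i3y i).const_mul _), integral_const_mul, integral_const_mul,
      W1.int_X (w3 i) p1 q1, W1.int_Y (w3 i) p1 q1]; simp
  have eG : Sm.fn (Gd jj P Q c r K V) = fun p => Sm.fn (SO (qd c r K (AO V) V)) p + Sm.fn (TO (qd (c + 1) r K (TO V) V)) p
     + ∑ i, Sm.fn (Lamb jj P Q i (qd c r K (Lam jj P Q i V) V)) p := by
    funext p; simp [Gd]
  have i12 : Integrable (fun p => Sm.fn (SO (qd c r K (AO V) V)) p + Sm.fn (TO (qd (c + 1) r K (TO V) V)) p) := i1.add i2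
  have is := integrable_finsetSum Finset.univ fun i _ => i3 i
  constructor
  · rw [eG]; exact i12.add is
  · simp only [eG]
    rw [integral_add i12 is]
    have : ∫ p, (Sm.fn (SO (qd c r K (AO V) V)) p + Sm.fn (TO (qd (c + 1) r K (TO V) V)) p) = 0 := by
      rw [integral_add i1 i2, W1.int_S w1 p1 q1, W1.int_T w2 p2 q2, add_zero]
    rw [this, integral_finsetSum _ fun i _ => i3 i, zero_add]
    exact Finset.sum_eq_zero fun i _ => z3 i

include hr in
lemma Gd_re {V : Sm n} (h : EqV jj P Q c V) (p : Sg n) :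
    (1 / 2) * dE jj P Q c r K V p - (1 / 2) * (kap P Q K * r * dB c r K V p) ≤ (Gd jj P Q c r K V p).re := by
  rw [Gd_eq jj P Q h]
  simp only [Sm.add_ap, Sm.sum_ap, qd_self, Complex.add_re, Complex.re_sum, Complex.ofReal_re]
  have ho := om_pos r K p
  have hE := Real.exp_pos (c * p.2)
  have hE1 : Real.exp ((c + 1) * p.2) = Real.exp (c * p.2) * Real.exp p.2 := by rw [← Real.exp_add]; congr 1; ring
  have t1 : -((1 / 2) * dB (c + 1) r K (AO V) p + (1 / 2) * (K ^ 2 * (32 * r)) * dB c r K V p) ≤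
      ((ea (c + 1) * AO V * cj V * AO (omS r K) : Sm n) p).re := by
    refine le_trans (neg_le_neg ?_) (neg_le_of_abs_le (Complex.abs_re_le_norm _))
    simp only [Sm.mul_ap, norm_mul, ea_ap, cj_ap, Complex.norm_real, Real.norm_eq_abs, Real.abs_exp, RCLike.norm_conj]
    have := young (x := ‖AO V p‖) (v := ‖V p‖) (Real.exp_pos p.2).le ho (A_om2 hr K p)
    unfold dB; rw [hE1]
    nlinarith
  have t2 : -((1 / 2) * dB (c + 1) r K (TO V) p + (1 / 2) * (K ^ 2 * (32 * r)) * dB c r K V p) ≤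
      ((ea (c + 1) * TO V * cj V * TO (omS r K) : Sm n) p).re := by
    refine le_trans (neg_le_neg ?_) (neg_le_of_abs_le (Complex.abs_re_le_norm _))
    simp only [Sm.mul_ap, norm_mul, ea_ap, cj_ap, Complex.norm_real, Real.norm_eq_abs, Real.abs_exp, RCLike.norm_conj]
    have := young (x := ‖TO V p‖) (v := ‖V p‖) (Real.exp_pos p.2).le ho (T_om2 hr K p)
    unfold dB; rw [hE1]
    nlinarith
  have t3 : ∀ i, -((1 / 2) * dB c r K (Lam jj P Q i V) p + (1 / 2) * ((2 * (‖P i‖ ^ 2 + ‖Q i‖ ^ 2)) * (K ^ 2 * (32 * r))) * dB c r K V p) ≤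
      ((ea c * Lam jj P Q i V * cj V * Lamb jj P Q i (omS r K) : Sm n) p).re := by
    intro i
    refine le_trans (neg_le_neg ?_) (neg_le_of_abs_le (Complex.abs_re_le_norm _))
    simp only [Sm.mul_ap, norm_mul, ea_ap, cj_ap, Complex.norm_real, Real.norm_eq_abs, Real.abs_exp, RCLike.norm_conj]
    have hl : (1:ℝ) * ‖Lamb jj P Q i (omS r K) p‖ ^ 2 ≤ ((2 * (‖P i‖ ^ 2 + ‖Q i‖ ^ 2)) * (K ^ 2 * (32 * r))) * om r K p ^ 2 := by
      have hx := X_om hr K p (jj i)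
      have hy := Y_om hr K p (jj i)
      have : ‖Lamb jj P Q i (omS r K) p‖ ≤ ‖P i‖ * ‖XO (jj i) (omS r K) p‖ + ‖Q i‖ * ‖YO (jj i) (omS r K) p‖ := by
        simp only [Lamb, LinearMap.add_apply, LinearMap.smul_apply, Sm.add_ap, Sm.smul_ap]
        refine (norm_add_le _ _).trans (le_of_eq ?_)
        simp [norm_mul]
      have h5 := mul_le_mul_of_nonneg_left hx (sq_nonneg ‖P i‖)
      have h6 := mul_le_mul_of_nonneg_left hy (sq_nonneg ‖Q i‖)
      have h7 := pow_le_pow_left₀ (norm_nonneg _) this 2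
      nlinarith [sq_nonneg (‖P i‖ * ‖XO (jj i) (omS r K) p‖ - ‖Q i‖ * ‖YO (jj i) (omS r K) p‖)]
    have := young (x := ‖Lam jj P Q i V p‖) (v := ‖V p‖) zero_le_one ho hl
    unfold dB
    have := mul_le_mul_of_nonneg_left this hE.le
    refine le_trans (le_of_eq ?_) (this.trans (le_of_eq ?_)) <;> ring
  have t3s := Finset.sum_le_sum fun i (_ : i ∈ Finset.univ) => t3 i
  rw [Finset.sum_neg_distrib, Finset.sum_add_distrib, ← Finset.mul_sum, ← Finset.sum_mul, ← Finset.mul_sum, ← Finset.sum_mul,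
    ← Finset.mul_sum] at t3s
  unfold dE kap
  refine le_trans (le_of_eq ?_) (add_le_add (add_le_add (add_le_add (le_refl (_ + _ + _)) t1) t2) t3s)
  ring

include hc hr h1 hK in
/-- Caccioppoli -/
lemma cac1 {V : Sm n} (hV : Good V) (h : EqV jj P Q c V) : EE jj P Q c r K V ≤ kap P Q K * r * BB c r K V := by
  obtain ⟨hi, h0⟩ := Gd_int hc hr h1 hK jj P Q hV
  have hre : ∫ p, (Gd jj P Q c r K V p).re = 0 := by
    have := integral_re (f := Sm.fn (Gd jj P Q c r K V)) hi
    rw [h0] at this; simpa using this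
  have j1 := (dE_int hc hr h1 hK jj P Q hV).const_mul (1/2)
  have j2 := ((dB_int hc hr h1 hK hV).const_mul (kap P Q K * r)).const_mul (1/2)
  have := integral_mono (j1.sub j2) hi.re (fun p => Gd_re hr jj P Q h p)
  have e : ∫ p, RCLike.re (Sm.fn (Gd jj P Q c r K V) p) = 0 := hre
  rw [e] at this
  simp only [Pi.sub_apply] at this
  rw [integral_sub j1 j2, integral_const_mul, integral_const_mul, integral_const_mul] at this
  unfold EE BB; linarith
end cac

/-! ### Part 5 : vanishing of `T V` -/

section hardy
variable {n : ℕ}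
variable {c r : ℝ} (hc : 2 < c) (hr : 0 < r) (h1 : r ≤ 1) {K : ℕ} (hK : n + c + 5 ≤ K)
variable {ι : Type} [Fintype ι] (jj : ι → Fin n) (P Q : ι → ℂ)

lemma T_Lam (i : ι) : TO * Lam jj P Q i = Lam jj P Q i * TO := by
  simp only [Lam, mul_add, add_mul, mul_smul_comm, smul_mul_assoc, X_T, Y_T]
lemma T_Lamb (i : ι) : TO * Lamb jj P Q i = Lamb jj P Q i * TO := by
  simp only [Lamb, mul_add, add_mul, mul_smul_comm, smul_mul_assoc, X_T, Y_T]
lemma ap_comm {A B : Op n} (h : A * B = B * A) (f : Sm n) : A (B f) = B (A f) := by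
  have := congrArg (fun C : Op n => C f) h
  simpa [Module.End.mul_apply] using this

lemma EqV.T {V : Sm n} (h : EqV jj P Q c V) : EqV jj P Q c (TO V) := by
  have := congrArg TO h
  unfold EqV
  rw [map_zero] at this
  rw [← this]
  simp only [map_add, map_sum, map_smul, ap_comm T_M, ap_comm T_A, ap_comm (T_Lam jj P Q _), ap_comm (T_Lamb jj P Q _)]

lemma dB_succ (V : Sm n) (p : Sg n) : dB (c + 1) r K V p = Real.exp p.2 * dB c r K V p := by
  unfold dB
  have hE1 : Real.exp ((c + 1) * p.2) = Real.exp (c * p.2) * Real.exp p.2 := by rw [← Real.exp_add]; congr 1; ring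
  rw [hE1]; ring

include hc hr h1 hK in
lemma EE_T {V : Sm n} (hV : Good V) : BB (c + 1) r K (TO V) ≤ EE jj P Q c r K V := by
  apply integral_mono (dB1_int hc hr h1 hK (hV.ap T_mem)) (dE_int hc hr h1 hK jj P Q hV)
  intro p
  have := dB_nonneg (c+1) r K (AO V) p
  have : 0 ≤ ∑ i, dB c r K (Lam jj P Q i V) p := Finset.sum_nonneg fun i _ => dB_nonneg _ _ _ _ _
  simp only [dE]; linarith
include hc hr h1 hK in
lemma EE_A {V : Sm n} (hV : Good V) : BB (c + 1) r K (AO V) ≤ EE jj P Q c r K V := by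
  apply integral_mono (dB1_int hc hr h1 hK (hV.ap A_mem)) (dE_int hc hr h1 hK jj P Q hV)
  intro p
  have := dB_nonneg (c+1) r K (TO V) p
  have : 0 ≤ ∑ i, dB c r K (Lam jj P Q i V) p := Finset.sum_nonneg fun i _ => dB_nonneg _ _ _ _ _
  simp only [dE]; linarith
include hc hr h1 hK in
lemma EE_L {V : Sm n} (hV : Good V) (i : ι) : BB c r K (Lam jj P Q i V) ≤ EE jj P Q c r K V := by
  apply integral_mono (dB_int hc hr h1 hK (hV.ap (Lam_mem jj P Q i))) (dE_int hc hr h1 hK jj P Q hV)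
  intro p
  have := dB_nonneg (c+1) r K (TO V) p
  have := dB_nonneg (c+1) r K (AO V) p
  have := Finset.single_le_sum (f := fun i => dB c r K (Lam jj P Q i V) p) (fun i _ => dB_nonneg _ _ _ _ _) (Finset.mem_univ i)
  simp only [dE]; linarith

include hc hr h1 hK in
lemma hardy {W : Sm n} (hW : Good W) {l : ℝ} (hl : 0 < l) :
    c * BB c r K W ≤ l⁻¹ * BB (c + 1) r K (AO W) + (l + K * r) * BB (c + 1) r K W := by
  have w := qd_w1 hr h1 K hW hW c
  have z := W1.int_S w (by linarith) (by linarith)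
  have i0 : Integrable (Sm.fn (SO (qd c r K W W))) := w.s.integrable (by linarith) (by linarith)
  have e : SO (qd c r K W W) = (c : ℂ) • qd c r K W W + qd (c + 1) r K (AO W) W + qd (c + 1) r K W (AO W)
      + ea (c + 1) * W * cj W * AO (omS r K) := by
    simp only [qd]
    rw [isDer_S, isDer_S, isDer_S, S_ea, SO_f W, SO_f (cj W), SO_f (omS r K), cj_A, ea_succ]
    simp only [Algebra.smul_def]
    ring
  have key : ∀ p, c * dB c r K W p - (l⁻¹ * dB (c + 1) r K (AO W) p + (l + K * r) * dB (c + 1) r K W p) ≤ (SO (qd c r K W W) p).re := by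
    intro p
    rw [e]
    simp only [Sm.add_ap, Sm.smul_ap, qd_self, Complex.add_re, ← Complex.ofReal_mul, Complex.ofReal_re]
    have ho := om_pos r K p
    have hE := Real.exp_pos ((c + 1) * p.2)
    have b1 : -(‖qd (c + 1) r K (AO W) W p‖) ≤ (qd (c + 1) r K (AO W) W p).re := neg_le_of_abs_le (Complex.abs_re_le_norm _)
    have b2 : -(‖qd (c + 1) r K W (AO W) p‖) ≤ (qd (c + 1) r K W (AO W) p).re := neg_le_of_abs_le (Complex.abs_re_le_norm _)
    have b3 : -(‖(ea (c + 1) * W * cj W * AO (omS r K) : Sm n) p‖) ≤ ((ea (c + 1) * W * cj W * AO (omS r K) : Sm n) p).re := neg_le_of_abs_le (Complex.abs_re_le_norm _)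
    rw [qd_norm] at b1 b2
    have b4 : ‖(ea (c + 1) * W * cj W * AO (omS r K) : Sm n) p‖ ≤ K * r * dB (c + 1) r K W p := by
      simp only [Sm.mul_ap, norm_mul, ea_ap, cj_ap, Complex.norm_real, Real.norm_eq_abs, Real.abs_exp, RCLike.norm_conj]
      have := A_om1 hr K p
      unfold dB
      calc _ ≤ Real.exp ((c + 1) * p.2) * ‖W p‖ * ‖W p‖ * (K * r * om r K p) := by gcongr
        _ = _ := by ring
    have b5 : 2 * (‖AO W p‖ * ‖W p‖) ≤ l⁻¹ * ‖AO W p‖ ^ 2 + l * ‖W p‖ ^ 2 := by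
      have h : 0 ≤ l⁻¹ * (‖AO W p‖ - l * ‖W p‖) ^ 2 := by positivity
      have : l⁻¹ * (‖AO W p‖ - l * ‖W p‖) ^ 2 = l⁻¹ * ‖AO W p‖ ^ 2 + l * ‖W p‖ ^ 2 - 2 * (‖AO W p‖ * ‖W p‖) := by
        field_simp; ring
      linarith
    have b6 := mul_le_mul_of_nonneg_left b5 (mul_pos hE ho).le
    unfold dB at b4 ⊢
    nlinarith
  have hre : ∫ p, (SO (qd c r K W W) p).re = 0 := by
    have := integral_re (f := Sm.fn (SO (qd c r K W W))) i0
    rw [z] at this; simpa using this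
  have j0 := (dB_int hc hr h1 hK hW).const_mul c
  have j1 := (dB1_int hc hr h1 hK (hW.ap A_mem)).const_mul l⁻¹
  have j2 := (dB1_int hc hr h1 hK hW).const_mul (l + K * r)
  have j12 : Integrable (fun p => l⁻¹ * dB (c + 1) r K (AO W) p + (l + K * r) * dB (c + 1) r K W p) := j1.add j2
  have := integral_mono (j0.sub j12) i0.re key
  have e' : ∫ p, RCLike.re (Sm.fn (SO (qd c r K W W)) p) = 0 := hre
  rw [e'] at this
  simp only [Pi.sub_apply] at this
  rw [integral_sub j0 j12, integral_add j1 j2, integral_const_mul, integral_const_mul, integral_const_mul] at this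
  unfold BB; linarith

/-- constant in the `T` estimate -/
def kT (c : ℝ) (K : ℕ) : ℝ := (2 / c) * (2 * (kap P Q K + 1) ^ 2 / c + K * (kap P Q K + 1))

include hc hr h1 hK in
lemma BB_T {V : Sm n} (hV : Good V) (h : EqV jj P Q c V) : BB c r K (TO V) ≤ kT P Q c K * r ^ 2 * BB c r K V := by
  have hk := kap_nonneg P Q K
  set k := kap P Q K + 1 with hkd
  have hk1 : 0 < k := by linarith
  have c0 : 0 < c := by linarith
  have B0 := BB_nonneg c r K V
  have B1 := BB_nonneg c r K (TO V)
  have e1 : BB (c + 1) r K (TO V) ≤ k * r * BB c r K V := by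
    refine (EE_T hc hr h1 hK jj P Q hV).trans ((cac1 hc hr h1 hK jj P Q hV h).trans ?_)
    gcongr; linarith
  have e2 : BB (c + 1) r K (AO (TO V)) ≤ k * r * BB c r K (TO V) := by
    refine (EE_A hc hr h1 hK jj P Q (hV.ap T_mem)).trans ((cac1 hc hr h1 hK jj P Q (hV.ap T_mem) (h.T jj P Q)).trans ?_)
    gcongr; linarith
  have hl : 0 < 2 * k * r / c := by positivity
  have e3 := hardy hc hr h1 hK (hV.ap T_mem) hl
  have e4 : c * BB c r K (TO V) ≤ (2 * k * r / c)⁻¹ * (k * r * BB c r K (TO V)) + (2 * k * r / c + K * r) * (k * r * BB c r K V) := by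
    refine e3.trans ?_
    gcongr
  have e5 : (2 * k * r / c)⁻¹ * (k * r * BB c r K (TO V)) = c / 2 * BB c r K (TO V) := by field_simp
  rw [e5] at e4
  unfold kT
  rw [← hkd]
  have e6 : BB c r K (TO V) ≤ (2 / c) * ((2 * k * r / c + K * r) * (k * r * BB c r K V)) := by
    rw [div_mul_eq_mul_div, le_div_iff₀ c0]; linarith
  refine e6.trans (le_of_eq ?_)
  field_simp

/-- iterated smallness forces vanishing -/
lemma BB_zero {V : Sm n} (hV : Good V) (hc : 2 < c) (hK : n + c + 5 ≤ K) (h : BB c 1 K V = 0) : V = 0 := by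
  have hi := dB_int (r := 1) hc one_pos le_rfl hK hV
  have hcont : Continuous (dB c 1 K V) := by
    unfold dB
    have := om_cont (n := n) 1 K
    have := V.cont
    fun_prop
  have := (integral_eq_zero_iff_of_nonneg (dB_nonneg c 1 K V) hi).1 h
  have := Continuous.ae_eq_iff_eq volume hcont continuous_const |>.1 this
  apply Sm.ext; intro p
  have hp : dB c 1 K V p = 0 := congrFun this p
  have ho := om_pos 1 K p
  have hE := Real.exp_pos (c * p.2)
  simp only [dB] at hp
  have : ‖V p‖ ^ 2 = 0 := by
    by_contra hne
    have : 0 < ‖V p‖ ^ 2 := lt_of_le_of_ne (by positivity) (Ne.symm hne)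
    have := mul_pos (mul_pos hE this) ho
    linarith
  simpa using this

include hc h1 hK hr in
lemma BB_mono {V : Sm n} (hV : Good V) : BB c 1 K V ≤ BB c r K V := by
  apply integral_mono (dB_int hc one_pos le_rfl hK hV) (dB_int hc hr h1 hK hV)
  intro p
  have := om_ge hr h1 K p
  simp only [dB]; gcongr
include hc h1 hK hr in
lemma BB_scale {V : Sm n} (hV : Good V) : BB c r K V ≤ (r ^ (2 * K))⁻¹ * BB c 1 K V := by
  unfold BB
  rw [← integral_const_mul]
  apply integral_mono (dB_int hc hr h1 hK hV) ((dB_int hc one_pos le_rfl hK hV).const_mul _)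
  intro p
  have := om_le hr h1 K p
  simp only [dB]
  calc _ ≤ Real.exp (c * p.2) * ‖V p‖ ^ 2 * ((r ^ (2 * K))⁻¹ * om 1 K p) := by gcongr
    _ = _ := by ring

include hc hK in
/-- iteration principle -/
lemma iter_zero {D : Op n} (hD : D ∈ DD n) (S : Sm n → Prop) (hS : ∀ V, Good V → S V → S (D V)) {C : ℝ} (hC : 0 ≤ C)
    (hb : ∀ V, Good V → S V → ∀ r, 0 < r → r ≤ 1 → BB c r K (D V) ≤ C * r * BB c r K V) {V : Sm n} (hV : Good V) (hSV : S V) :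
    (D ^ (2 * K + 1)) V = 0 := by
  have all : ∀ N, Good ((D ^ N) V) ∧ S ((D ^ N) V) ∧ ∀ r, 0 < r → r ≤ 1 → BB c r K ((D ^ N) V) ≤ (C * r) ^ N * BB c r K V := by
    intro N
    induction N with
    | zero => exact ⟨by simpa using hV, by simpa using hSV, fun r _ _ => by simp⟩
    | succ N ih =>
      obtain ⟨g, s, b⟩ := ih
      rw [pow_succ', Module.End.mul_apply]
      refine ⟨g.ap hD, hS _ g s, fun r hr h1 => (hb _ g s r hr h1).trans ?_⟩
      rw [pow_succ', mul_assoc (C * r)]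
      exact mul_le_mul_of_nonneg_left (b r hr h1) (by positivity)
  obtain ⟨g, -, b⟩ := all (2 * K + 1)
  apply BB_zero g hc hK
  apply le_antisymm _ (BB_nonneg _ _ _ _)
  set M := C ^ (2 * K + 1) * BB c 1 K V with hM
  have hM0 : 0 ≤ M := mul_nonneg (by positivity) (BB_nonneg _ _ _ _)
  have hle : ∀ r, 0 < r → r ≤ 1 → BB c 1 K ((D ^ (2 * K + 1)) V) ≤ M * r := by
    intro r hr h1
    refine (BB_mono hc hr h1 hK g).trans ((b r hr h1).trans ?_)
    calc (C * r) ^ (2 * K + 1) * BB c r K V ≤ (C * r) ^ (2 * K + 1) * ((r ^ (2 * K))⁻¹ * BB c 1 K V) := by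
          have := BB_scale hc hr h1 hK hV
          gcongr
      _ = M * r := by rw [hM, mul_pow, pow_succ r]; field_simp
  refine le_of_forall_pos_le_add fun ε hε => ?_
  have h3 := hle (min 1 (ε / (M + 1))) (by positivity) (min_le_left _ _)
  have h4 : M * min 1 (ε / (M + 1)) ≤ M * (ε / (M + 1)) := by gcongr; exact min_le_right _ _
  have h5 : M * (ε / (M + 1)) ≤ ε := by
    rw [mul_div_assoc', div_le_iff₀ (by linarith)]; nlinarith
  linarith

/-- along lines -/
lemma line_zero (v : Sg n) {W : Sm n} (hv : v.2 = 0) (hW : Good W) (h : dv v (dv v W) = 0) : dv v W = 0 := by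
  obtain ⟨C, hC, hb⟩ := hW.bd
  apply Sm.ext; intro p
  have d1 : ∀ (f : Sm n) (t : ℝ), HasDerivAt (fun t : ℝ => f (p + t • v)) (dv v f (p + t • v)) t := by
    intro f t
    have h1 : HasDerivAt (fun t : ℝ => p + t • v) v t := by
      have := ((hasDerivAt_id t).smul_const v).const_add p
      simpa using this
    exact (f.diff (p + t • v)).hasFDerivAt.comp_hasDerivAt t h1
  have c1 : ∀ t : ℝ, dv v W (p + t • v) = dv v W p := by
    intro t
    have h2 : ∀ t : ℝ, HasDerivAt (fun t : ℝ => dv v W (p + t • v)) 0 t := by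
      intro t; have := d1 (dv v W) t; rw [h] at this; simpa using this
    have := is_const_of_deriv_eq_zero (fun t => (h2 t).differentiableAt) (fun t => (h2 t).deriv) t 0
    simpa using this
  have c2 : ∀ t : ℝ, W (p + t • v) = W p + t * dv v W p := by
    intro t
    have h2 : ∀ t : ℝ, HasDerivAt (fun t : ℝ => W (p + t • v) - t * dv v W p) 0 t := by
      intro t
      have := (d1 W t).sub ((Complex.ofRealCLM.hasDerivAt (x := t)).mul_const (dv v W p))
      rw [c1] at this
      have e0 : dv v W p - Complex.ofRealCLM 1 * dv v W p = 0 := by simp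
      rw [e0] at this
      exact this
    have := is_const_of_deriv_eq_zero (fun t => (h2 t).differentiableAt) (fun t => (h2 t).deriv) t 0
    simp at this
    linear_combination this
  by_contra hne
  have hpos : 0 < ‖dv v W p‖ := norm_pos_iff.2 hne
  set B := C * (1 + Real.exp (-p.2)) with hB
  have hB0 : 0 ≤ B := by positivity
  have hle : ∀ t : ℝ, 0 ≤ t → t * ‖dv v W p‖ ≤ 2 * B := by
    intro t ht
    have e : (t : ℂ) * dv v W p = W (p + t • v) - W p := by rw [c2]; ring
    have h3 := hb (p + t • v)
    have h4 := hb p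
    rw [Prod.snd_add, Prod.smul_snd, hv, smul_zero, add_zero] at h3
    have := norm_sub_le (W (p + t • v)) (W p)
    rw [← e, norm_mul, Complex.norm_real, Real.norm_eq_abs, abs_of_nonneg ht] at this
    linarith
  have := hle ((2 * B + 1) / ‖dv v W p‖) (by positivity)
  rw [div_mul_cancel₀ _ hpos.ne'] at this
  linarith

lemma line_pow (v : Sg n) {V : Sm n} (hv : v.2 = 0) (hg : ∀ N, Good ((dv v ^ N) V)) (N : ℕ) (h : (dv v ^ (N + 1)) V = 0) :
    dv v V = 0 := by
  induction N with
  | zero => simpa using h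
  | succ N ih =>
    apply ih
    have e : (dv v ^ (N + 1)) V = dv v ((dv v ^ N) V) := by rw [pow_succ', Module.End.mul_apply]
    rw [e]
    apply line_zero v hv (hg N)
    rw [← e, ← Module.End.mul_apply, ← pow_succ', h]

lemma Good.pow {V : Sm n} (hV : Good V) {D : Op n} (hD : D ∈ DD n) (N : ℕ) : Good ((D ^ N) V) := hV.ap (pow_mem hD N)

/-- first step of Liouville -/
lemma T_zero {c : ℝ} (hc : 2 < c) {V : Sm n} (hV : Good V) (h : EqV jj P Q c V) : TO V = 0 := by
  obtain ⟨K, hK⟩ := exists_nat_ge (n + c + 5)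
  have c0 : 0 < c := by linarith
  have hk := kap_nonneg P Q K
  have := iter_zero hc hK T_mem (fun V => EqV jj P Q c V) (fun V _ h => h.T jj P Q) (C := kT P Q c K)
    (by unfold kT; positivity) (fun V hV h r hr h1 => (BB_T hc hr h1 hK jj P Q hV h).trans ?_) hV h
  · exact line_pow (eTS n) (by simp [eTS]) (fun N => hV.pow T_mem N) _ this
  · have := BB_nonneg c r K V
    have : 0 ≤ kT P Q c K := by unfold kT; positivity
    have : r ^ 2 ≤ r := by nlinarith
    gcongr
end hardy

/-! ### Part 6 : range test -/
section rng
variable {n : ℕ}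

/-- weight integral -/
def II (n : ℕ) (e r : ℝ) : ℝ := ∫ p : Sg n, Real.exp (e * p.2) * om r (n + 20) p

lemma eo_norm (e r : ℝ) (K : ℕ) (p : Sg n) : ‖(ea e * omS r K : Sm n) p‖ = Real.exp (e * p.2) * om r K p := by
  simp only [Sm.mul_ap, norm_mul, ea_ap, omS_ap, Complex.norm_real, Real.norm_eq_abs, abs_of_pos (om_pos r K p), Real.abs_exp]
lemma eo_w1 {r : ℝ} (hr : 0 < r) (h1 : r ≤ 1) (e : ℝ) (K : ℕ) : W1 e (-K) (ea e * omS r K : Sm n) := by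
  have := (W1_ea (n := n) e).mul (W1_om hr h1 K)
  simpa using this
lemma II_int {e r : ℝ} (hr : 0 < r) (h1 : r ≤ 1) (he : 0 < e) (he' : e ≤ 4) :
    Integrable (fun p : Sg n => Real.exp (e * p.2) * om r (n + 20) p) := by
  have := ((eo_w1 (n := n) hr h1 e (n + 20)).z.integrable he (by push_cast; linarith)).norm
  refine this.congr (Eventually.of_forall fun p => eo_norm e r _ p)
lemma II_nonneg (e r : ℝ) : 0 ≤ II n e r := integral_nonneg fun p => mul_nonneg (Real.exp_pos _).le (om_pos _ _ _).le
lemma II_pos {e r : ℝ} (hr : 0 < r) (h1 : r ≤ 1) (he : 0 < e) (he' : e ≤ 4) : 0 < II n e r := by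
  unfold II
  rw [integral_pos_iff_support_of_nonneg (fun p => mul_nonneg (Real.exp_pos _).le (om_pos _ _ _).le) (II_int hr h1 he he')]
  have : Function.support (fun p : Sg n => Real.exp (e * p.2) * om r (n + 20) p) = univ := by
    ext p; simp [(om_pos r (n+20) p).ne']
  rw [this]
  simp
lemma II_step {e r : ℝ} (hr : 0 < r) (h1 : r ≤ 1) (he : 0 < e) (he' : e ≤ 3) : 
    e * II n e r ≤ (n + 20) * r * II n (e + 1) r := by
  have w := eo_w1 (n := n) hr h1 e (n + 20)
  have z := W1.int_S w he (by push_cast; linarith)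
  have i0 : Integrable (Sm.fn (SO (ea e * omS r (n + 20) : Sm n))) := w.s.integrable he (by push_cast; linarith)
  have j1 := (II_int (n := n) hr h1 he (by linarith)).const_mul e
  have j2 := (II_int (n := n) hr h1 (by linarith : 0 < e + 1) (by linarith)).const_mul ((n + 20) * r)
  have key : ∀ p, e * (Real.exp (e * p.2) * om r (n + 20) p) - (n + 20) * r * (Real.exp ((e + 1) * p.2) * om r (n + 20) p)
      ≤ (SO (ea e * omS r (n + 20) : Sm n) p).re := by
    intro p
    have : SO (ea e * omS r (n + 20) : Sm n) = (e : ℂ) • (ea e * omS r (n + 20)) + ea (e + 1) * AO (omS r (n + 20)) := by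
      rw [isDer_S, S_ea, SO_f, ea_succ]
      simp only [Algebra.smul_def]; ring
    rw [this]
    simp only [Sm.add_ap, Sm.smul_ap, Complex.add_re]
    have e1 : ((e : ℂ) * (ea e * omS r (n + 20) : Sm n) p).re = e * (Real.exp (e * p.2) * om r (n + 20) p) := by
      simp only [Sm.mul_ap, ea_ap, omS_ap, ← Complex.ofReal_mul, Complex.ofReal_re]
    rw [e1]
    have b3 : -(‖(ea (e + 1) * AO (omS r (n + 20)) : Sm n) p‖) ≤ ((ea (e + 1) * AO (omS r (n + 20)) : Sm n) p).re := neg_le_of_abs_le (Complex.abs_re_le_norm _)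
    have b4 : ‖(ea (e + 1) * AO (omS r (n + 20)) : Sm n) p‖ ≤ (n + 20) * r * (Real.exp ((e + 1) * p.2) * om r (n + 20) p) := by
      simp only [Sm.mul_ap, norm_mul, ea_ap, Complex.norm_real, Real.norm_eq_abs, Real.abs_exp]
      have := A_om1 hr (n + 20) p
      push_cast at this
      calc _ ≤ Real.exp ((e + 1) * p.2) * ((n + 20) * r * om r (n + 20) p) := by gcongr
        _ = _ := by ring
    linarith
  have hre : ∫ p, (SO (ea e * omS r (n + 20) : Sm n) p).re = 0 := by
    have := integral_re (f := Sm.fn (SO (ea e * omS r (n + 20) : Sm n))) i0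
    rw [z] at this; simpa using this
  have := integral_mono (j1.sub j2) i0.re key
  have e' : ∫ p, RCLike.re (Sm.fn (SO (ea e * omS r (n + 20) : Sm n)) p) = 0 := hre
  rw [e'] at this
  simp only [Pi.sub_apply] at this
  rw [integral_sub j1 j2, integral_const_mul, integral_const_mul] at this
  unfold II; linarith

/-- the range condition -/
def Rng (V : Sm n) : Prop := ∃ C, 0 ≤ C ∧ ∀ r, 0 < r → r ≤ 1 →
  ‖∫ p, (ea 4 * V * omS r (n + 20) : Sm n) p‖ ≤ C * Real.sqrt r * II n 4 r

lemma ewf_w1 {W : Sm n} (hW : Good W) {r : ℝ} (hr : 0 < r) (h1 : r ≤ 1) (e : ℝ) :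
    W1 (e - 1) (1 - (n + 20 : ℕ)) (ea e * W * omS r (n + 20)) := by
  have := ((W1_ea e).mul hW.w1).mul (W1_om hr h1 (n + 20))
  have e1 : e - 1 = e + -1 + 0 := by ring
  have e2 : (1 - (n + 20 : ℕ) : ℝ) = 0 + 1 + -(n + 20 : ℕ) := by ring
  rw [e1, e2]; exact this
lemma eVo_int {V : Sm n} (hV : Good V) {r : ℝ} (hr : 0 < r) (h1 : r ≤ 1) : Integrable (Sm.fn (ea 4 * V * omS r (n + 20))) :=
  (ewf_w1 hV hr h1 4).z.integrable (by norm_num) (by push_cast; linarith)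

lemma Rng.add {V W : Sm n} (gV : Good V) (gW : Good W) (hV : Rng V) (hW : Rng W) : Rng (V + W) := by
  obtain ⟨C, hC, h⟩ := hV
  obtain ⟨D, hD, k⟩ := hW
  refine ⟨C + D, by positivity, fun r hr h1 => ?_⟩
  have : ∀ p, (ea 4 * (V + W) * omS r (n + 20) : Sm n) p = (ea 4 * V * omS r (n + 20) : Sm n) p + (ea 4 * W * omS r (n + 20) : Sm n) p := by
    intro p; simp only [Sm.mul_ap, Sm.add_ap]; ring
  simp_rw [this]
  rw [integral_add (eVo_int gV hr h1) (eVo_int gW hr h1)]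
  refine (norm_add_le _ _).trans ?_
  have := h r hr h1
  have := k r hr h1
  linarith
lemma Rng.smul {V : Sm n} (hV : Rng V) (c : ℂ) : Rng (c • V) := by
  obtain ⟨C, hC, h⟩ := hV
  refine ⟨‖c‖ * C, by positivity, fun r hr h1 => ?_⟩
  have : ∀ p, (ea 4 * (c • V) * omS r (n + 20) : Sm n) p = c * (ea 4 * V * omS r (n + 20) : Sm n) p := by
    intro p; simp only [Sm.mul_ap, Sm.smul_ap]; ring
  simp_rw [this]
  rw [integral_const_mul, norm_mul]
  have h3 := mul_le_mul_of_nonneg_left (h r hr h1) (norm_nonneg c)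
  refine h3.trans (le_of_eq (by ring))

lemma int_bd {W : Sm n} {C : ℝ} (hC : 0 ≤ C) (hW : ∀ p, ‖W p‖ ≤ C * (1 + Real.exp (-p.2))) {r m e : ℝ} (hr : 0 < r) (h1 : r ≤ 1)
    (he : 1 < e) (he' : e ≤ 4) (hm : 0 ≤ m) (f : Sm n) (hf : ∀ p, ‖f p‖ ≤ m * om r (n + 20) p) :
    ‖∫ p, (ea e * W * f : Sm n) p‖ ≤ C * m * (II n e r + II n (e - 1) r) := by
  have j1 := II_int (n := n) hr h1 (by linarith : 0 < e) (by linarith)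
  have j2 := II_int (n := n) hr h1 (by linarith : 0 < e - 1) (by linarith)
  have j := (j1.add j2).const_mul (C * m)
  refine (norm_integral_le_of_norm_le j (Eventually.of_forall fun p => ?_)).trans (le_of_eq ?_)
  · simp only [Sm.mul_ap, norm_mul, ea_ap, Complex.norm_real, Real.norm_eq_abs, Real.abs_exp]
    have ho := om_pos r (n + 20) p
    have e1 : Real.exp ((e - 1) * p.2) = Real.exp (e * p.2) * Real.exp (-p.2) := by rw [← Real.exp_add]; congr 1; ring
    have := hW p
    have := hf p
    calc _ ≤ Real.exp (e * p.2) * (C * (1 + Real.exp (-p.2))) * (m * om r (n + 20) p) := by gcongr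
      _ = _ := by simp only [Pi.add_apply]; rw [e1]; ring
  · simp only [Pi.add_apply]
    rw [integral_const_mul, integral_add j1 j2]; rfl

lemma II3 {r : ℝ} (hr : 0 < r) (h1 : r ≤ 1) : II n 3 r ≤ (n + 20) * r * II n 4 r := by
  have := II_step (n := n) (e := 3) hr h1 (by norm_num) (by norm_num)
  norm_num at this
  linarith [II_nonneg (n := n) 3 r]
lemma II2 {r : ℝ} (hr : 0 < r) (h1 : r ≤ 1) : II n 2 r ≤ (n + 20) * r * II n 3 r := by
  have := II_step (n := n) (e := 2) hr h1 (by norm_num) (by norm_num)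
  norm_num at this
  linarith [II_nonneg (n := n) 2 r]

lemma r_le_sqrt {r : ℝ} (hr : 0 < r) (h1 : r ≤ 1) : r ≤ Real.sqrt r := by
  apply Real.le_sqrt_of_sq_le; nlinarith

lemma rng_of {D : Op n} (hD : IsDer D) (hmem : D ∈ DD n) (hea : D (ea 4) = 0) {m : ℝ} (hm : 0 ≤ m)
    (hom : ∀ r, 0 < r → r ≤ 1 → ∀ p, ‖D (omS r (n + 20)) p‖ ≤ m * Real.sqrt r * om r (n + 20) p)
    (hhi : ∀ f : Sm n, W1 3 (1 - (n + 20 : ℕ)) f → Integrable (Sm.fn (D f)) ∧ ∫ p, D f p = 0) {W : Sm n} (hW : Good W) : Rng (D W) := by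
  obtain ⟨C, hC, hb⟩ := hW.bd
  refine ⟨C * m * (n + 21), by positivity, fun r hr h1 => ?_⟩
  have w := ewf_w1 hW hr h1 4
  norm_num at w
  have h := hhi _ (by convert w using 2; push_cast; ring)
  have e : D (ea 4 * W * omS r (n + 20)) = ea 4 * D W * omS r (n + 20) + ea 4 * W * D (omS r (n + 20)) := by
    rw [hD, hD, hea]; ring
  have i1 := eVo_int (hW.ap hmem) hr h1
  have e2 : ∀ p, (ea 4 * W * D (omS r (n + 20)) : Sm n) p = D (ea 4 * W * omS r (n + 20)) p - (ea 4 * D W * omS r (n + 20) : Sm n) p := by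
    intro p; rw [e]; simp
  have z : ∫ p, (ea 4 * D W * omS r (n + 20) : Sm n) p = - ∫ p, (ea 4 * W * D (omS r (n + 20)) : Sm n) p := by
    simp_rw [e2]
    rw [integral_sub h.1 i1, h.2]; simp
  rw [z, norm_neg]
  refine (int_bd hC hb hr h1 (by norm_num) le_rfl (by positivity) _ (hom r hr h1)).trans ?_
  norm_num
  have := II3 (n := n) hr h1
  have h4 := II_nonneg (n := n) 4 r
  have : (n + 20) * r * II n 4 r ≤ (n + 20) * 1 * II n 4 r := by gcongr
  calc C * (m * Real.sqrt r) * (II n 4 r + II n 3 r) ≤ C * (m * Real.sqrt r) * (II n 4 r + (n + 20) * 1 * II n 4 r) := by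
        gcongr; linarith
    _ = _ := by ring

lemma sqrt_bd {m r x w : ℝ} (hr : 0 ≤ r) (hw : 0 ≤ w) (hm : 0 ≤ m) (h : x ^ 2 ≤ (m ^ 2 * (32 * r)) * w ^ 2) : x ≤ (m * 6) * Real.sqrt r * w := by
  apply le_of_sq_le_sq _ (by positivity)
  rw [mul_pow, mul_pow, Real.sq_sqrt hr]
  refine h.trans ?_
  have : 0 ≤ m ^ 2 * r * w ^ 2 := by positivity
  nlinarith

lemma Rng_X {W : Sm n} (hW : Good W) (j : Fin n) : Rng (XO j W) := by
  refine rng_of (isDer_X j) (X_mem j) (X_ea' j 4) (m := (n + 20 : ℕ) * 6) (by positivity) (fun r hr h1 p => ?_) (fun f hf => ?_) hW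
  · exact sqrt_bd hr.le (om_pos _ _ _).le (by positivity) (X_om hr (n + 20) p j)
  · exact ⟨(hf.x j).integrable (by norm_num) (by push_cast; linarith), W1.int_X hf (by norm_num) (by push_cast; linarith) j⟩
lemma Rng_Y {W : Sm n} (hW : Good W) (j : Fin n) : Rng (YO j W) := by
  refine rng_of (isDer_Y j) (Y_mem j) (Y_ea' j 4) (m := (n + 20 : ℕ) * 6) (by positivity) (fun r hr h1 p => ?_) (fun f hf => ?_) hW
  · exact sqrt_bd hr.le (om_pos _ _ _).le (by positivity) (Y_om hr (n + 20) p j)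
  · exact ⟨(hf.y j).integrable (by norm_num) (by push_cast; linarith), W1.int_Y hf (by norm_num) (by push_cast; linarith) j⟩
lemma Rng_T {W : Sm n} (hW : Good W) : Rng (TO W) := by
  refine rng_of isDer_T T_mem (T_ea' 4) (m := (n + 20 : ℕ)) (by positivity) (fun r hr h1 p => ?_) (fun f hf => ?_) hW
  · refine (T_om1 hr (n + 20) p).trans ?_
    have := r_le_sqrt hr h1
    have := om_pos r (n + 20) p
    gcongr
  · exact ⟨hf.t.integrable (by norm_num) (by push_cast; linarith), W1.int_T hf (by norm_num) (by push_cast; linarith)⟩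
lemma Rng_A {W : Sm n} (hW : Good W) : Rng (AO W) := by
  obtain ⟨C, hC, hb⟩ := hW.bd
  set k : ℝ := n + 20 with hk
  have hk0 : 0 ≤ k := by positivity
  refine ⟨C * (3 * (k + k * k) + k * (1 + k)), by positivity, fun r hr h1 => ?_⟩
  have w := ewf_w1 hW hr h1 3
  have z := W1.int_S w (by norm_num) (by push_cast; linarith)
  have i0 : Integrable (Sm.fn (SO (ea 3 * W * omS r (n + 20)))) := w.s.integrable (by norm_num) (by push_cast; linarith)
  have i1 := eVo_int (hW.ap A_mem) hr h1
  have i2 : Integrable (Sm.fn (ea 3 * W * omS r (n + 20))) := w.z.integrable (by norm_num) (by push_cast; linarith)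
  have e : SO (ea 3 * W * omS r (n + 20)) = (3:ℂ) • (ea 3 * W * omS r (n + 20)) + ea 4 * AO W * omS r (n + 20)
      + ea 4 * W * AO (omS r (n + 20)) := by
    have e4 : (ea 4 : Sm n) = ea 3 * ea 1 := by rw [ea_mul]; norm_num
    rw [isDer_S, isDer_S, S_ea, SO_f W, SO_f (omS r (n + 20)), e4]
    simp only [Algebra.smul_def]
    push_cast
    ring
  have e2 : ∀ p, (ea 4 * W * AO (omS r (n + 20)) : Sm n) p = SO (ea 3 * W * omS r (n + 20)) p - (ea 4 * AO W * omS r (n + 20) : Sm n) p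
     - 3 * (ea 3 * W * omS r (n + 20) : Sm n) p := by
    intro p; rw [e]; simp only [Sm.add_ap, Sm.smul_ap]; ring
  have zz : ∫ p, (ea 4 * AO W * omS r (n + 20) : Sm n) p = - (∫ p, (ea 4 * W * AO (omS r (n + 20)) : Sm n) p)
      - 3 * ∫ p, (ea 3 * W * omS r (n + 20) : Sm n) p := by
    simp_rw [e2]
    have i01 : Integrable (fun p => Sm.fn (SO (ea 3 * W * omS r (n + 20))) p - Sm.fn (ea 4 * AO W * omS r (n + 20)) p) := i0.sub i1
    rw [integral_sub i01 (i2.const_mul 3), integral_sub i0 i1, z, integral_const_mul]; simp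
  rw [zz]
  have n1 := int_bd (e := 4) hC hb hr h1 (by norm_num) le_rfl (by positivity) _ (fun p => A_om1 hr (n + 20) p)
  have n2 := int_bd (e := 3) hC hb hr h1 (by norm_num) (by norm_num) zero_le_one (omS r (n + 20)) (fun p => by
    rw [omS_ap, Complex.norm_real, Real.norm_eq_abs, abs_of_pos (om_pos r _ p), one_mul])
  have hs := r_le_sqrt hr h1
  have a3 := II3 (n := n) hr h1
  have a2 := II2 (n := n) hr h1
  norm_num at n1 n2
  rw [← hk] at n1 a3 a2
  have h4 := II_nonneg (n := n) 4 r
  have h3 := II_nonneg (n := n) 3 r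
  have h2 := II_nonneg (n := n) 2 r
  have b3 : II n 3 r ≤ k * (r * II n 4 r) := by linarith
  have b3' : II n 3 r ≤ k * II n 4 r := b3.trans (by nlinarith [mul_nonneg hk0 h4])
  have b2 : II n 2 r ≤ k * k * (r * II n 4 r) := by
    refine a2.trans ?_
    calc k * r * II n 3 r ≤ k * r * (k * II n 4 r) := by gcongr
      _ = _ := by ring
  calc ‖-(∫ p, (ea 4 * W * AO (omS r (n + 20)) : Sm n) p) - 3 * ∫ p, (ea 3 * W * omS r (n + 20) : Sm n) p‖
      ≤ C * (k * r) * (II n 4 r + II n 3 r) + 3 * (C * (II n 3 r + II n 2 r)) := by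
        refine (norm_sub_le _ _).trans ?_
        rw [norm_neg, norm_mul]
        have : ‖(3:ℂ)‖ = 3 := by simp
        rw [this]
        exact add_le_add n1 (mul_le_mul_of_nonneg_left n2 (by norm_num))
    _ ≤ C * (k * r) * (II n 4 r + k * II n 4 r) + 3 * (C * (k * (r * II n 4 r) + k * k * (r * II n 4 r))) := by gcongr
    _ = C * (3 * (k + k * k) + k * (1 + k)) * r * II n 4 r := by ring
    _ ≤ _ := by gcongr

lemma Rng_const {V : Sm n} {v : ℂ} (hv : ∀ p, V p = v) (h : Rng V) : V = 0 := by
  obtain ⟨C, hC, h⟩ := h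
  have h2 : ∀ r, 0 < r → r ≤ 1 → ‖v‖ ≤ C * Real.sqrt r := by
    intro r hr h1
    have k := h r hr h1
    have e : ∀ p : Sg n, (ea 4 * V * omS r (n + 20) : Sm n) p = v * ((Real.exp (4 * p.2) * om r (n + 20) p : ℝ) : ℂ) := by
      intro p; simp only [Sm.mul_ap, hv, ea_ap, omS_ap]; push_cast; ring
    simp_rw [e] at k
    rw [integral_const_mul, integral_complex_ofReal, norm_mul, Complex.norm_real, Real.norm_eq_abs] at k
    have hp := II_pos (n := n) hr h1 (by norm_num : (0:ℝ) < 4) le_rfl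
    change ‖v‖ * |II n 4 r| ≤ _ at k
    rw [abs_of_pos hp] at k
    exact le_of_mul_le_mul_right k hp
  have : ‖v‖ ≤ 0 := by
    have t : Tendsto (fun r => C * Real.sqrt r) (𝓝[>] 0) (𝓝 (C * Real.sqrt 0)) :=
      ((Real.continuous_sqrt.tendsto 0).const_mul C).mono_left nhdsWithin_le_nhds
    rw [Real.sqrt_zero, mul_zero] at t
    refine ge_of_tendsto t ?_
    filter_upwards [Ioo_mem_nhdsGT one_pos] with r hr
    exact h2 r hr.1 hr.2.le
  apply Sm.ext; intro p
  rw [hv]; simpa using this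
end rng

/-! ### Part 7 : Liouville theorem -/
section liou
variable {n : ℕ}

/-- sum of squares -/
def SQ (n : ℕ) : Op n := ∑ j, (XO j * XO j + YO j * YO j)
lemma SQ_ap (V : Sm n) : SQ n V = ∑ j, (XO j (XO j V) + YO j (YO j V)) := by
  simp [SQ, Module.End.mul_apply]
lemma SQ_mem : SQ n ∈ DD n := sum_mem fun j _ => add_mem (mul_mem (X_mem j) (X_mem j)) (mul_mem (Y_mem j) (Y_mem j))

/-- indices for the sublaplacian -/
def sj (n : ℕ) : Fin n ⊕ Fin n → Fin n := Sum.elim id id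
/-- coefficients -/
def sP (n : ℕ) (g : ℝ) : Fin n ⊕ Fin n → ℂ := Sum.elim (fun _ => ((Real.sqrt g / 2 : ℝ) : ℂ)) (fun _ => 0)
/-- coefficients -/
def sQ (n : ℕ) (g : ℝ) : Fin n ⊕ Fin n → ℂ := Sum.elim (fun _ => 0) (fun _ => ((Real.sqrt g / 2 : ℝ) : ℂ))

lemma EqV_std {g : ℝ} (hg : 0 ≤ g) (c : ℝ) (V : Sm n) : EqV (sj n) (sP n g) (sQ n g) c V ↔
    MA (AO (AO V)) + MA (TO (TO V)) + (c : ℂ) • AO V + ((g / 4 : ℝ) : ℂ) • SQ n V = 0 := by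
  unfold EqV
  have : ∑ i, Lamb (sj n) (sP n g) (sQ n g) i (Lam (sj n) (sP n g) (sQ n g) i V) = ((g / 4 : ℝ) : ℂ) • SQ n V := by
    rw [Fintype.sum_sum_type, SQ_ap, Finset.sum_add_distrib, smul_add, Finset.smul_sum, Finset.smul_sum]
    have hh : ((Real.sqrt g / 2 : ℝ) : ℂ) * ((Real.sqrt g / 2 : ℝ) : ℂ) = ((g / 4 : ℝ) : ℂ) := by
      rw [← Complex.ofReal_mul]; congr 1
      have := Real.mul_self_sqrt hg
      linear_combination this / 4
    congr 1
    · apply Finset.sum_congr rfl; intro j _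
      simp only [Lam, Lamb, sj, sP, sQ, Sum.elim_inl, LinearMap.add_apply, LinearMap.smul_apply, map_smul, map_zero, zero_smul, add_zero, id, Complex.conj_ofReal, smul_smul, hh]
    · apply Finset.sum_congr rfl; intro j _
      simp only [Lam, Lamb, sj, sP, sQ, Sum.elim_inr, LinearMap.add_apply, LinearMap.smul_apply, map_smul, map_zero, zero_smul, zero_add, id, Complex.conj_ofReal, smul_smul, hh]
  rw [this]

lemma XY_ap (i j : Fin n) {V : Sm n} (hT : TO V = 0) : XO i (YO j V) = YO j (XO i V) := by
  have := congrArg (fun C : Op n => C V) (X_Y i j)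
  simp only [Module.End.mul_apply, LinearMap.sub_apply] at this
  rw [this]
  split_ifs <;> simp [hT]
lemma T_ap_X {V : Sm n} (hT : TO V = 0) (j : Fin n) : TO (XO j V) = 0 := by
  rw [← ap_comm (X_T j), hT, map_zero]
lemma T_ap_Y {V : Sm n} (hT : TO V = 0) (j : Fin n) : TO (YO j V) = 0 := by
  rw [← ap_comm (Y_T j), hT, map_zero]

lemma SQ_X {V : Sm n} (hT : TO V = 0) (i : Fin n) : XO i (SQ n V) = SQ n (XO i V) := by
  rw [SQ_ap, SQ_ap, map_sum]
  apply Finset.sum_congr rfl; intro j _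
  rw [map_add, ap_comm (X_X i j), ap_comm (X_X i j), XY_ap i j (T_ap_Y hT j), XY_ap i j hT]
lemma SQ_Y {V : Sm n} (hT : TO V = 0) (i : Fin n) : YO i (SQ n V) = SQ n (YO i V) := by
  rw [SQ_ap, SQ_ap, map_sum]
  apply Finset.sum_congr rfl; intro j _
  rw [map_add, ap_comm (Y_Y i j), ap_comm (Y_Y i j), ← XY_ap j i (T_ap_X hT j), ← XY_ap j i hT]

/-- invariant set for the second step -/
def S2 (g c : ℝ) (V : Sm n) : Prop := TO V = 0 ∧ MA (AO (AO V)) + (c : ℂ) • AO V + ((g / 4 : ℝ) : ℂ) • SQ n V = 0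
lemma S2.X {g c : ℝ} {V : Sm n} (h : S2 g c V) (j : Fin n) : S2 g c (XO j V) := by
  refine ⟨T_ap_X h.1 j, ?_⟩
  have := congrArg (XO j) h.2
  rw [map_zero] at this
  rw [← this]
  simp only [map_add, map_smul, ap_comm (X_M j), ap_comm (X_A j), SQ_X h.1]
lemma S2.Y {g c : ℝ} {V : Sm n} (h : S2 g c V) (j : Fin n) : S2 g c (YO j V) := by
  refine ⟨T_ap_Y h.1 j, ?_⟩
  have := congrArg (YO j) h.2
  rw [map_zero] at this
  rw [← this]
  simp only [map_add, map_smul, ap_comm (Y_M j), ap_comm (Y_A j), SQ_Y h.1]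
lemma S2.eq {g c : ℝ} (hg : 0 ≤ g) {V : Sm n} (h : S2 g c V) : EqV (sj n) (sP n g) (sQ n g) c V := by
  rw [EqV_std hg, h.1]
  have := h.2
  simpa using this

lemma BB_smul (a : ℂ) (c r : ℝ) (K : ℕ) (V : Sm n) : BB c r K (a • V) = ‖a‖ ^ 2 * BB c r K V := by
  unfold BB
  rw [← integral_const_mul]
  congr 1; funext p
  simp only [dB, Sm.smul_ap, norm_mul]; ring

lemma BB_XY {g c : ℝ} (hg : 0 < g) (hc : 2 < c) {K : ℕ} (hK : n + c + 5 ≤ K) {V : Sm n} (hV : Good V) (h : S2 g c V)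
    {r : ℝ} (hr : 0 < r) (h1 : r ≤ 1) (j : Fin n) :
    BB c r K (XO j V) ≤ ((4 / g) * kap (sP n g) (sQ n g) K) * r * BB c r K V ∧
    BB c r K (YO j V) ≤ ((4 / g) * kap (sP n g) (sQ n g) K) * r * BB c r K V := by
  have hn : ‖((Real.sqrt g / 2 : ℝ) : ℂ)‖ ^ 2 = g / 4 := by
    rw [Complex.norm_real, Real.norm_eq_abs, sq_abs, div_pow, Real.sq_sqrt hg.le]; norm_num
  have e := cac1 hc hr h1 hK (sj n) (sP n g) (sQ n g) hV (h.eq hg.le)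
  have ex : Lam (sj n) (sP n g) (sQ n g) (Sum.inl j) V = ((Real.sqrt g / 2 : ℝ) : ℂ) • XO j V := by
    simp [Lam, sj, sP, sQ]
  have ey : Lam (sj n) (sP n g) (sQ n g) (Sum.inr j) V = ((Real.sqrt g / 2 : ℝ) : ℂ) • YO j V := by
    simp [Lam, sj, sP, sQ]
  have f1 := (EE_L hc hr h1 hK (sj n) (sP n g) (sQ n g) hV (Sum.inl j)).trans e
  have f2 := (EE_L hc hr h1 hK (sj n) (sP n g) (sQ n g) hV (Sum.inr j)).trans e
  rw [ex, BB_smul, hn] at f1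
  rw [ey, BB_smul, hn] at f2
  have tr : ∀ x y : ℝ, g / 4 * x ≤ y → x ≤ 4 / g * y := by
    intro x y hxy
    rw [div_mul_eq_mul_div, le_div_iff₀ hg]; linarith
  constructor
  · refine (tr _ _ f1).trans (le_of_eq (by ring))
  · refine (tr _ _ f2).trans (le_of_eq (by ring))

lemma X_dv {V : Sm n} (hT : TO V = 0) (j : Fin n) : XO j V = dv (eXS n j) V := by
  have : dv (eTS n) V = 0 := hT
  simp [XO, Module.End.mul_apply, this]
lemma Y_dv {V : Sm n} (hT : TO V = 0) (j : Fin n) : YO j V = dv (eYS n j) V := by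
  have : dv (eTS n) V = 0 := hT
  simp [YO, Module.End.mul_apply, this]
lemma X_pow {V : Sm n} (hT : TO V = 0) (j : Fin n) (N : ℕ) : (XO j ^ N) V = (dv (eXS n j) ^ N) V ∧ TO ((XO j ^ N) V) = 0 := by
  induction N with
  | zero => simpa using hT
  | succ N ih =>
    rw [pow_succ', pow_succ', Module.End.mul_apply, Module.End.mul_apply]
    exact ⟨by rw [X_dv ih.2, ih.1], T_ap_X ih.2 j⟩
lemma Y_pow {V : Sm n} (hT : TO V = 0) (j : Fin n) (N : ℕ) : (YO j ^ N) V = (dv (eYS n j) ^ N) V ∧ TO ((YO j ^ N) V) = 0 := by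
  induction N with
  | zero => simpa using hT
  | succ N ih =>
    rw [pow_succ', pow_succ', Module.End.mul_apply, Module.End.mul_apply]
    exact ⟨by rw [Y_dv ih.2, ih.1], T_ap_Y ih.2 j⟩

lemma XY_zero {g c : ℝ} (hg : 0 < g) (hc : 2 < c) {V : Sm n} (hV : Good V) (h : S2 g c V) (j : Fin n) :
    dv (eXS n j) V = 0 ∧ dv (eYS n j) V = 0 := by
  obtain ⟨K, hK⟩ := exists_nat_ge (n + c + 5)
  have hk := kap_nonneg (sP n g) (sQ n g) K
  constructor
  · have := iter_zero hc hK (X_mem j) (fun V => S2 g c V) (fun V _ h => h.X j) (C := (4 / g) * kap (sP n g) (sQ n g) K)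
      (by positivity) (fun V hV h r hr h1 => (BB_XY hg hc hK hV h hr h1 j).1) hV h
    rw [(X_pow h.1 j _).1] at this
    exact line_pow (eXS n j) (by simp [eXS]) (fun N => by rw [← (X_pow h.1 j N).1]; exact hV.pow (X_mem j) N) _ this
  · have := iter_zero hc hK (Y_mem j) (fun V => S2 g c V) (fun V _ h => h.Y j) (C := (4 / g) * kap (sP n g) (sQ n g) K)
      (by positivity) (fun V hV h r hr h1 => (BB_XY hg hc hK hV h hr h1 j).2) hV h
    rw [(Y_pow h.1 j _).1] at this
    exact line_pow (eYS n j) (by simp [eYS]) (fun N => by rw [← (Y_pow h.1 j N).1]; exact hV.pow (Y_mem j) N) _ this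

/-- a function with all derivatives zero is constant -/
lemma const_of_dv {f : Sm n} (hx : ∀ j, dv (eXS n j) f = 0) (hy : ∀ j, dv (eYS n j) f = 0) (ht : dv (eTS n) f = 0)
    (ha : dv (eA n) f = 0) (p q : Sg n) : f p = f q := by
  refine is_const_of_fderiv_eq_zero (𝕜 := ℝ) (fun p => f.diff p) (fun p => ?_) p q
  have z : ∀ v, dv v f = 0 → fderiv ℝ f.fn p v = 0 := fun v hv => by
    have := dv_ap v f p; rw [hv] at this; simpa using this.symm
  refine ContinuousLinearMap.ext fun v => ?_
  have : v = ∑ j, ((v.1.1 j).re • eXS n j + (v.1.1 j).im • eYS n j) + v.1.2 • eTS n + v.2 • eA n := by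
    have e1 : ∀ k, (∑ j, ((v.1.1 j).re • eXS n j + (v.1.1 j).im • eYS n j)).1.1 k = v.1.1 k := by
      intro k
      simp only [Prod.fst_sum, Finset.sum_apply]
      rw [Finset.sum_eq_single k]
      · simp [eXS, eYS, eX, eY]
      · intro j _ hj; simp [eXS, eYS, eX, eY, Pi.single_apply, hj.symm]
      · simp
    have e2 : (∑ j, ((v.1.1 j).re • eXS n j + (v.1.1 j).im • eYS n j)).1.2 = 0 := by
      simp [Prod.fst_sum, Prod.snd_sum, eXS, eYS, eX, eY]
    have e3 : (∑ j, ((v.1.1 j).re • eXS n j + (v.1.1 j).im • eYS n j)).2 = 0 := by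
      simp [Prod.snd_sum, eXS, eYS]
    refine Prod.ext (Prod.ext (funext fun k => ?_) ?_) ?_
    · simp [e1, eTS, eT, eA]
    · simp [e2, eTS, eT, eA]
    · simp [e3, eTS, eT, eA]
  rw [this]
  simp only [map_add, map_sum, map_smul, z _ (hx _), z _ (hy _), z _ ht, z _ ha]
  simp

lemma dvA_dv (v : Sg n) (hv : v.2 = 0) {V : Sm n} (h : dv v V = 0) (c : ℝ) : dv v (ea c * AO V) = 0 := by
  have e : dv v (AO V) = 0 := by
    rw [AO, Module.End.mul_apply, ← Module.End.mul_apply, dv_ea0 v hv, Module.End.mul_apply, ap_comm (dv_comm v (eA n)), h]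
    simp
  rw [dv_mul, e, dv_ea, hv]; simp

/-- **Liouville** -/
theorem liouville2 {g c : ℝ} (hg : 0 < g) (hc : 2 < c) {V : Sm n} (hV : Good V) (h : S2 g c V) (hR : Rng V) : V = 0 := by
  have hx : ∀ j, dv (eXS n j) V = 0 := fun j => (XY_zero hg hc hV h j).1
  have hy : ∀ j, dv (eYS n j) V = 0 := fun j => (XY_zero hg hc hV h j).2
  have ht : dv (eTS n) V = 0 := h.1
  have hSQ : SQ n V = 0 := by
    rw [SQ_ap]
    apply Finset.sum_eq_zero; intro j _
    rw [X_dv h.1, hx, Y_dv h.1, hy]; simp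
  have e := h.2
  rw [hSQ, smul_zero, add_zero] at e
  have hA : dv (eA n) (ea c * AO V) = 0 := by
    change SO _ = 0
    rw [isDer_S, S_ea, SO_f (AO V)]
    rw [MA_f] at e
    simp only [Algebra.smul_def] at e ⊢
    linear_combination ea c * e
  have hconst := const_of_dv (f := ea c * AO V) (fun j => dvA_dv _ (by simp [eXS]) (hx j) c) (fun j => dvA_dv _ (by simp [eYS]) (hy j) c)
    (dvA_dv _ (by simp [eTS]) ht c) hA
  have hAV : AO V = 0 := by
    obtain ⟨C, hC, hb⟩ := (hV.ap A_mem).bd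
    apply Sm.ext; intro p
    have hp : ∀ s : ℝ, s ≤ 0 → ‖(ea c * AO V : Sm n) p‖ ≤ 2 * C * Real.exp s := by
      intro s hs
      rw [hconst p (p.1, s), Sm.mul_ap, norm_mul, ea_ap, Complex.norm_real, Real.norm_eq_abs, Real.abs_exp]
      have := hb (p.1, s)
      simp only at this ⊢
      have e1 : (1:ℝ) ≤ Real.exp (-s) := Real.one_le_exp (by linarith)
      calc Real.exp (c * s) * ‖AO V (p.1, s)‖ ≤ Real.exp (2 * s) * (C * (1 + Real.exp (-s))) := by
            exact mul_le_mul (Real.exp_le_exp.2 (by nlinarith)) this (norm_nonneg _) (Real.exp_pos _).le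
        _ ≤ Real.exp (2 * s) * (C * (Real.exp (-s) + Real.exp (-s))) := by gcongr
        _ = 2 * C * (Real.exp (2 * s) * Real.exp (-s)) := by ring
        _ = _ := by rw [← Real.exp_add]; congr 2; ring
    have h0 : ‖(ea c * AO V : Sm n) p‖ ≤ 0 := by
      have t : Tendsto (fun s => 2 * C * Real.exp s) atBot (𝓝 (2 * C * 0)) := Real.tendsto_exp_atBot.const_mul _
      rw [mul_zero] at t
      refine ge_of_tendsto t ?_
      filter_upwards [eventually_le_atBot 0] with s hs
      exact hp s hs
    have : (ea c * AO V : Sm n) p = 0 := norm_le_zero_iff.1 h0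
    rw [Sm.mul_ap, ea_ap] at this
    rcases mul_eq_zero.1 this with h | h
    · exact absurd (Complex.ofReal_eq_zero.1 h) (Real.exp_pos _).ne'
    · simpa using h
  have ha : dv (eA n) V = 0 := by
    change SO V = 0
    rw [SO_f, hAV, mul_zero]
  exact Rng_const (v := V 0) (fun p => const_of_dv hx hy ht ha p 0) hR
end liou

/-! ### Part 8 : algebraic consequences -/
section algc
variable {n : ℕ}

/-- `Z̄` for `e = 1`, `Z` for `e = -1` -/
def Zs (e : ℝ) (j : Fin n) : Op n := (1/2 : ℂ) • (XO j + ((e : ℂ) * Complex.I) • YO j)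
/-- `D̄` for `e = 1`, `D` for `e = -1` -/
def Ds (e : ℝ) : Op n := (1/2 : ℂ) • (TO - ((e : ℂ) * Complex.I) • AO)
/-- Laplacian -/
def De : Op n := AO * AO + TO * TO
/-- `∑ Zs (-e) Zs e` -/
def LL (e : ℝ) : Op n := ∑ j, Zs (-e) j * Zs e j

lemma Zs_mem (e : ℝ) (j : Fin n) : Zs e j ∈ DD n :=
  Subalgebra.smul_mem _ (add_mem (X_mem j) (Subalgebra.smul_mem _ (Y_mem j) _)) _
lemma Ds_mem (e : ℝ) : (Ds e : Op n) ∈ DD n :=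
  Subalgebra.smul_mem _ (sub_mem T_mem (Subalgebra.smul_mem _ A_mem _)) _
lemma De_mem : (De : Op n) ∈ DD n := add_mem (mul_mem A_mem A_mem) (mul_mem T_mem T_mem)

lemma cXT (j : Fin n) : Commute (XO j : Op n) TO := X_T j
lemma cYT (j : Fin n) : Commute (YO j : Op n) TO := Y_T j
lemma cXA (j : Fin n) : Commute (XO j : Op n) AO := X_A j
lemma cYA (j : Fin n) : Commute (YO j : Op n) AO := Y_A j
lemma cTA : Commute (TO : Op n) AO := T_A
lemma cZT (e : ℝ) (j : Fin n) : Commute (Zs e j : Op n) TO := ((cXT j).add_left ((cYT j).smul_left _)).smul_left _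
lemma cZA (e : ℝ) (j : Fin n) : Commute (Zs e j : Op n) AO := ((cXA j).add_left ((cYA j).smul_left _)).smul_left _
lemma cZD (e d : ℝ) (j : Fin n) : Commute (Zs e j : Op n) (Ds d) := ((cZT e j).sub_right ((cZA e j).smul_right _)).smul_right _
lemma cDT (e : ℝ) : Commute (Ds e : Op n) TO := ((Commute.refl _).sub_left (cTA.symm.smul_left _)).smul_left _
lemma cDA (e : ℝ) : Commute (Ds e : Op n) AO := (cTA.sub_left ((Commute.refl _).smul_left _)).smul_left _
lemma cDD (e d : ℝ) : Commute (Ds e : Op n) (Ds d) := ((cDT e).sub_right ((cDA e).smul_right _)).smul_right _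
lemma cDeT : Commute (De : Op n) TO := by
  unfold De
  exact Commute.add_left (Commute.mul_left cTA.symm cTA.symm) (Commute.mul_left (Commute.refl TO) (Commute.refl TO))
lemma cDeA : Commute (De : Op n) AO := ((Commute.refl _).mul_left (Commute.refl _)).add_left (cTA.mul_left cTA)
lemma cXDe (j : Fin n) : Commute (XO j : Op n) De := ((cXA j).mul_right (cXA j)).add_right ((cXT j).mul_right (cXT j))
lemma cYDe (j : Fin n) : Commute (YO j : Op n) De := ((cYA j).mul_right (cYA j)).add_right ((cYT j).mul_right (cYT j))
lemma cZDe (e : ℝ) (j : Fin n) : Commute (Zs e j : Op n) De := ((cXDe j).add_left ((cYDe j).smul_left _)).smul_left _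
lemma cDDe (e : ℝ) : Commute (Ds e : Op n) De := (cDeT.symm.sub_left (cDeA.symm.smul_left _)).smul_left _
lemma cSDe : Commute (SQ n) De := Commute.sum_left _ _ _ fun j _ => ((cXDe j).mul_left (cXDe j)).add_left ((cYDe j).mul_left (cYDe j))
lemma cST : Commute (SQ n) TO := Commute.sum_left _ _ _ fun j _ => ((cXT j).mul_left (cXT j)).add_left ((cYT j).mul_left (cYT j))
lemma cSA : Commute (SQ n) AO := Commute.sum_left _ _ _ fun j _ => ((cXA j).mul_left (cXA j)).add_left ((cYA j).mul_left (cYA j))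
lemma cLD (e d : ℝ) : Commute (LL e : Op n) (Ds d) := Commute.sum_left _ _ _ fun j _ => (cZD _ _ j).mul_left (cZD _ _ j)

lemma DsD (e : ℝ) (he : e * e = 1) : (Ds (-e) : Op n) * Ds e = (1/4 : ℂ) • De := by
  have h2 : ((e:ℂ)) ^ 2 = 1 := by rw [sq]; exact_mod_cast he
  simp only [Ds, De, smul_mul_assoc, mul_smul_comm, sub_mul, mul_sub, smul_sub, smul_smul, cTA.eq, smul_add]
  push_cast
  match_scalars <;> ring_nf <;> norm_num [h2]

lemma Z_comm (e : ℝ) (i j : Fin n) : (Zs e i : Op n) * Zs e j = Zs e j * Zs e i := by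
  have h1 := X_Y i j
  have h2 := X_Y j i
  simp only [Zs, smul_mul_assoc, mul_smul_comm, add_mul, mul_add, smul_add, smul_smul, h1, h2, X_X i j, Y_Y i j]
  by_cases h : i = j
  · subst h; simp only [if_true]
  · simp only [h, Ne.symm h, if_false, sub_zero]; module

lemma Zb_Z (e : ℝ) (he : e * e = 1) (i j : Fin n) : (Zs (-e) i : Op n) * Zs e j = Zs e j * Zs (-e) i +
    (if i = j then (-2 * Complex.I * e) • (TO : Op n) else 0) := by
  have h1 := X_Y i j
  have h2 := X_Y j i
  simp only [Zs, smul_mul_assoc, mul_smul_comm, add_mul, mul_add, smul_add, smul_smul, h1, h2, X_X i j, Y_Y i j]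
  by_cases h : i = j
  · subst h; simp only [if_true]; push_cast; module
  · simp only [h, Ne.symm h, if_false, sub_zero]; push_cast; module

lemma LL_eq (e : ℝ) (he : e * e = 1) : (LL e : Op n) = (1/4 : ℂ) • SQ n - (Complex.I * e * n) • TO := by
  have h2 : ((e:ℂ)) ^ 2 = 1 := by rw [sq]; exact_mod_cast he
  have : ∀ j : Fin n, (Zs (-e) j : Op n) * Zs e j = (1/4 : ℂ) • (XO j * XO j + YO j * YO j) - (Complex.I * e) • TO := by
    intro j
    have h1 := X_Y j j
    rw [if_pos rfl] at h1
    simp only [Zs, smul_mul_assoc, mul_smul_comm, add_mul, mul_add, smul_add, smul_smul, h1]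
    push_cast
    match_scalars <;> ring_nf <;> norm_num [h2]
  rw [LL, Finset.sum_congr rfl fun j _ => this j, Finset.sum_sub_distrib, ← Finset.smul_sum, SQ]
  simp only [Finset.sum_const, Finset.card_univ, Fintype.card_fin]
  module

lemma LL_Z (e : ℝ) (he : e * e = 1) (k : Fin n) : (LL e : Op n) * Zs e k = Zs e k * LL e + (-2 * Complex.I * e) • (TO * Zs e k) := by
  have : ∀ j : Fin n, (Zs (-e) j * Zs e j : Op n) * Zs e k = Zs e k * (Zs (-e) j * Zs e j) + (if j = k then (-2 * Complex.I * e) • (TO * Zs e k : Op n) else 0) := by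
    intro j
    rw [mul_assoc, Z_comm e j k, ← mul_assoc, Zb_Z e he, add_mul, mul_assoc]
    congr 1
    split_ifs with h
    · rw [h, smul_mul_assoc]
    · simp
  rw [LL, Finset.sum_mul, Finset.sum_congr rfl fun j _ => this j, Finset.sum_add_distrib, ← Finset.mul_sum]
  simp

lemma Rng_Z (e : ℝ) {W : Sm n} (hW : Good W) (j : Fin n) : Rng (Zs e j W) :=
  Rng.smul (Rng.add (hW.ap (X_mem j)) ((hW.ap (Y_mem j)).smul _) (Rng_X hW j) ((Rng_Y hW j).smul _)) _
lemma Rng_D (e : ℝ) {W : Sm n} (hW : Good W) : Rng (Ds e W) := by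
  have : Ds e W = (1/2 : ℂ) • (TO W + (-((e : ℂ) * Complex.I)) • AO W) := by
    simp [Ds, sub_eq_add_neg]
  rw [this]
  exact Rng.smul (Rng.add (hW.ap T_mem) ((hW.ap A_mem).smul _) (Rng_T hW) ((Rng_A hW).smul _)) _
lemma Rng_De {W : Sm n} (hW : Good W) : Rng (De W) :=
  Rng.add ((hW.ap A_mem).ap A_mem) ((hW.ap T_mem).ap T_mem) (Rng_A (hW.ap A_mem)) (Rng_T (hW.ap T_mem))

lemma De_ap (V : Sm n) : De V = AO (AO V) + TO (TO V) := rfl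

lemma liou_std {g c : ℝ} (hg : 0 < g) (hc : 2 < c) {V : Sm n} (hV : Good V) (hR : Rng V)
    (h : MA (De V) + (c : ℂ) • AO V + ((g / 4 : ℝ) : ℂ) • SQ n V = 0) : V = 0 := by
  have h1 : EqV (sj n) (sP n g) (sQ n g) c V := by
    rw [EqV_std hg.le, ← map_add]; exact h
  have hT := T_zero _ _ _ hc hV h1
  refine liouville2 hg hc hV ⟨hT, ?_⟩ hR
  rw [De_ap, hT] at h
  simpa using h

lemma liou_Z (e : ℝ) (he : e * e = 1) {b : ℝ} (hb : 0 < b) {V : Sm n} (hV : Good V) (hR : Rng V)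
    (h1 : De V = 0) (h2 : LL e V = -(b : ℂ) • AO V) : V = 0 := by
  set g := 3 / b with hg
  have hg0 : 0 < g := by positivity
  have hgb : g * b = 3 := by rw [hg]; field_simp
  have hs : ((Real.sqrt g : ℝ) : ℂ) * (Real.sqrt g : ℝ) = g := by
    rw [← Complex.ofReal_mul, Real.mul_self_sqrt hg0.le]
  have hL : ∀ j : Fin n, Lamb (fun j : Fin n => j) (fun _ => (Real.sqrt g / 2 : ℂ)) (fun _ => (Real.sqrt g / 2 * (e * Complex.I) : ℂ)) j
     (Lam (fun j : Fin n => j) (fun _ => (Real.sqrt g / 2 : ℂ)) (fun _ => (Real.sqrt g / 2 * (e * Complex.I) : ℂ)) j V) = (g : ℂ) • (Zs (-e) j (Zs e j V)) := by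
    intro j
    have a1 : Lam (fun j : Fin n => j) (fun _ => (Real.sqrt g / 2 : ℂ)) (fun _ => (Real.sqrt g / 2 * (e * Complex.I) : ℂ)) j = ((Real.sqrt g : ℝ) : ℂ) • Zs e j := by
      simp only [Lam, Zs]; module
    have a2 : Lamb (fun j : Fin n => j) (fun _ => (Real.sqrt g / 2 : ℂ)) (fun _ => (Real.sqrt g / 2 * (e * Complex.I) : ℂ)) j = ((Real.sqrt g : ℝ) : ℂ) • Zs (-e) j := by
      simp only [Lamb, Zs, map_mul, map_div₀, Complex.conj_ofReal, Complex.conj_I, map_ofNat]; push_cast; module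
    rw [a1, a2, LinearMap.smul_apply, LinearMap.smul_apply, map_smul, smul_smul, hs]
  have hE : EqV (fun j : Fin n => j) (fun _ => (Real.sqrt g / 2 : ℂ)) (fun _ => (Real.sqrt g / 2 * (e * Complex.I) : ℂ)) 3 V := by
    unfold EqV
    rw [Finset.sum_congr rfl fun j _ => hL j, ← Finset.smul_sum, ← map_add, ← De_ap, h1]
    have : ∑ j, Zs (-e) j (Zs e j V) = LL e V := by simp [LL]
    rw [this, h2, ← hgb]; push_cast
    rw [map_zero]; module
  have hT := T_zero _ _ _ (by norm_num) hV hE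
  refine liouville2 hg0 (c := 3) (by norm_num) hV ⟨hT, ?_⟩ hR
  have h3 := h1
  rw [De_ap, hT, map_zero, add_zero] at h3
  rw [h3, map_zero, ← hgb]
  have h4 := h2
  rw [LL_eq e he, LinearMap.sub_apply, LinearMap.smul_apply, LinearMap.smul_apply, hT, smul_zero, sub_zero] at h4
  have : ((g / 4 : ℝ) : ℂ) • SQ n V = (g : ℂ) • ((1/4 : ℂ) • SQ n V) := by push_cast; module
  rw [this, h4]; push_cast; module
end algc

/-! ### Part 9 : pluriharmonicity of good solutions -/
section algd
variable {n : ℕ}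

lemma De_MA (W : Sm n) : De (MA W) = MA (De W) + (2 : ℂ) • AO W := by
  have hA : ∀ V : Sm n, AO (MA V) = MA (AO V) + V := by
    intro V
    have := congrArg (fun C : Op n => C V) (A_M (n := n))
    simpa [Module.End.mul_apply] using this
  rw [De_ap, De_ap, hA, map_add, hA, ap_comm T_M, ap_comm T_M, map_add]
  module

/-- the basic equation -/
def EqD (α c : ℝ) (V : Sm n) : Prop := MA (De V) + (c : ℂ) • AO V + ((α / 4 : ℝ) : ℂ) • SQ n V = 0

lemma EqD.step {α c : ℝ} {V : Sm n} (h : EqD α c V) : EqD α (c + 2) (De V) := by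
  have := congrArg De h
  rw [map_zero] at this
  unfold EqD
  rw [← this, map_add, map_add, map_smul, map_smul, De_MA, ap_comm cDeA.eq, ap_comm cSDe.eq]
  push_cast; module

lemma EqD.pow {α c : ℝ} {V : Sm n} (h : EqD α c V) (i : ℕ) : EqD α (c + 2 * i) ((De ^ i) V) := by
  induction i with
  | zero => simpa using h
  | succ i ih =>
    rw [pow_succ', Module.End.mul_apply]
    convert ih.step using 1; push_cast; ring

lemma DsDs_zero (e : ℝ) (he : e * e = 1) {V : Sm n} (h : De V = 0) : Ds (-e) (Ds e V) = 0 := by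
  rw [← Module.End.mul_apply, DsD e he, LinearMap.smul_apply, h, smul_zero]

lemma Ds_ap (e : ℝ) (V : Sm n) : Ds e V = (1/2 : ℂ) • (TO V - ((e : ℂ) * Complex.I) • AO V) := rfl

lemma T_of_Ds (e : ℝ) {V : Sm n} (h : Ds (-e) V = 0) : TO V = (-(e : ℂ) * Complex.I) • AO V := by
  rw [Ds_ap] at h
  have h' := congrArg (fun W : Sm n => (2 : ℂ) • W) h
  simp only [smul_smul, smul_zero] at h'
  norm_num at h'
  rw [neg_mul, neg_smul]; exact eq_neg_of_add_eq_zero_left h'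

lemma TA_of_Ds {V : Sm n} (h : Ds 1 V = 0) (h' : Ds (-1) V = 0) : TO V = 0 ∧ AO V = 0 := by
  have a := T_of_Ds 1 h'
  have b := T_of_Ds (-1) (by simpa using h)
  have c : AO V = 0 := by
    rw [a] at b
    have b' : (2 * Complex.I) • AO V = 0 := by
      have := sub_eq_zero.2 b.symm
      rw [← this]; push_cast; module
    rcases smul_eq_zero.1 b' with h | h
    · simp at h
    · exact h
  exact ⟨by rw [a, c, smul_zero], c⟩

lemma LL_of {α i e : ℝ} (he : e * e = 1) (hα : 0 < α) {E : Sm n} (h : EqD α (i - α * n) E) (h0 : De E = 0) :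
    LL e E = -((i / α : ℝ) : ℂ) • AO E - (2 * Complex.I * e * n) • Ds (-e) E := by
  have h2 : ((e:ℂ)) ^ 2 = 1 := by rw [sq]; exact_mod_cast he
  have hα' : (α : ℂ) ≠ 0 := by exact_mod_cast hα.ne'
  unfold EqD at h
  rw [h0, map_zero, zero_add] at h
  have h3 : (1/4 : ℂ) • SQ n E = (n - i / α : ℂ) • AO E := by
    have : (1/4 : ℂ) • SQ n E = (1 / α : ℂ) • (((α / 4 : ℝ) : ℂ) • SQ n E) := by
      rw [smul_smul]; congr 1; push_cast; field_simp
    rw [this, eq_neg_of_add_eq_zero_right h, ← smul_neg, smul_neg, smul_neg, smul_smul, ← neg_smul]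
    congr 1; push_cast; field_simp; ring
  rw [LL_eq e he, LinearMap.sub_apply, LinearMap.smul_apply, LinearMap.smul_apply, h3, Ds_ap]
  push_cast
  match_scalars <;> ring_nf <;> norm_num [h2] <;> ring

lemma LL_Ds {α i e : ℝ} (he : e * e = 1) (hα : 0 < α) {E : Sm n} (h : EqD α (i - α * n) E) (h0 : De E = 0) :
    LL e (Ds e E) = -((i / α : ℝ) : ℂ) • AO (Ds e E) := by
  rw [ap_comm (cLD e e).eq, LL_of he hα h h0, map_sub, map_smul, map_smul, ap_comm (cDD e (-e)).eq, DsDs_zero e he h0,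
    ap_comm (cDA e).eq]
  simp

lemma De_comm {P : Op n} (h : Commute P De) {V : Sm n} (h0 : De V = 0) : De (P V) = 0 := by
  rw [← ap_comm h.eq, h0, map_zero]

lemma Ds_E {α i e : ℝ} (he : e * e = 1) (hα : 0 < α) (hi : 0 < i) {E : Sm n} (hE : Good E) (h : EqD α (i - α * n) E) (h0 : De E = 0) :
    Ds e E = 0 :=
  liou_Z e he (b := i / α) (by positivity) (hE.ap (Ds_mem e)) (Rng_D e hE) (De_comm (cDDe e) h0) (LL_Ds he hα h h0)

lemma E_zero {α i : ℝ} (hα : 0 < α) (hi : 0 < i) {E : Sm n} (hE : Good E) (hR : Rng E) (h : EqD α (i - α * n) E) (h0 : De E = 0) :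
    E = 0 := by
  obtain ⟨hT, hA⟩ := TA_of_Ds (Ds_E (e := 1) (by norm_num) hα hi hE h h0) (Ds_E (e := -1) (by norm_num) hα hi hE h h0)
  have h' := h
  unfold EqD at h'
  rw [h0, hA] at h'
  refine liou_std hα (c := 3) (by norm_num) hE hR ?_
  rw [h0, hA]; simpa using h'

lemma De_u {α : ℝ} (hα : 0 < α) {u : Sm n} (hu : Good u) (h : EqD α (-(α * n)) u) : De u = 0 := by
  have hg : ∀ i, Good ((De ^ i) u) := fun i => hu.ap (pow_mem De_mem i)
  have hR : ∀ i, 1 ≤ i → Rng ((De ^ i) u) := by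
    intro i hi
    obtain ⟨i, rfl⟩ := Nat.exists_eq_add_of_le' hi
    rw [pow_succ', Module.End.mul_apply]
    exact Rng_De (hg i)
  have he : ∀ i : ℕ, EqD α (2 * i - α * n) ((De ^ i) u) := by
    intro i
    convert h.pow i using 1; ring
  obtain ⟨J, hJ⟩ := exists_nat_gt (α * n + 3)
  have hz : (De ^ J) u = 0 := by
    have : 0 ≤ α * n := by positivity
    have J1 : 1 ≤ J := by
      have : (1:ℝ) ≤ J := by linarith
      exact_mod_cast this
    exact liou_std hα (by linarith) (hg J) (hR J J1) (he J)
  have step : ∀ i, 1 ≤ i → (De ^ (i + 1)) u = 0 → (De ^ i) u = 0 := by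
    intro i hi h0
    rw [pow_succ', Module.End.mul_apply] at h0
    have : (0:ℝ) < i := by exact_mod_cast hi
    exact E_zero hα (i := 2 * i) (by positivity) (hg i) (hR i hi) (he i) h0
  have all : ∀ J, (De ^ (J + 1)) u = 0 → (De ^ 1) u = 0 := by
    intro J
    induction J with
    | zero => simp
    | succ J ih => intro h; exact ih (step _ (by omega) h)
  have := all J (by rw [pow_succ', Module.End.mul_apply, hz, map_zero])
  simpa using this

lemma ZD_u {α e : ℝ} (he : e * e = 1) (hα : 0 < α) {u : Sm n} (hu : Good u) (h : EqD α (-(α * n)) u) (h0 : De u = 0) (k : Fin n) :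
    Zs e k (Ds e u) = 0 := by
  have h2 : ((e:ℂ)) ^ 2 = 1 := by rw [sq]; exact_mod_cast he
  have h1 : LL e (Ds e u) = 0 := by
    have := LL_Ds (i := 0) (e := e) he hα (by simpa using h) h0
    simpa using this
  refine liou_Z e he (b := 2) (by norm_num) ((hu.ap (Ds_mem e)).ap (Zs_mem e k)) (Rng_Z e (hu.ap (Ds_mem e)) k)
    (De_comm (cZDe e k) (De_comm (cDDe e) h0)) ?_
  have hD : Ds (-e) (Zs e k (Ds e u)) = 0 := by
    rw [← ap_comm (cZD e (-e) k).eq, DsDs_zero e he h0, map_zero]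
  have := congrArg (fun C : Op n => C (Ds e u)) (LL_Z e he k)
  simp only [Module.End.mul_apply, LinearMap.add_apply, LinearMap.smul_apply] at this
  rw [this, h1, map_zero, zero_add, T_of_Ds e hD, smul_smul]
  congr 1
  push_cast
  ring_nf; norm_num [h2]

lemma SQ_Zs (e : ℝ) (he : e * e = 1) (k : Fin n) (V : Sm n) : (1/4 : ℂ) • SQ n (Zs e k V) = Zs e k ((1/4 : ℂ) • SQ n V) + (-2 * Complex.I * e) • TO (Zs e k V) := by
  have a := congrArg (fun C : Op n => C V) (LL_Z e he k)
  simp only [Module.End.mul_apply, LinearMap.add_apply, LinearMap.smul_apply, LL_eq e he, LinearMap.sub_apply, map_sub, map_smul,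
    ap_comm (cZT e k).eq] at a
  rw [map_smul]
  linear_combination (exp := 1) a

lemma q_u {α : ℝ} (hα : 0 < α) {u : Sm n} (hu : Good u) (h : EqD α (-(α * n)) u) (j k : Fin n) :
    Zs (-1) k (Zs 1 j u) + (if j = k then 2 * Complex.I else 0) • Ds (-1) u = 0 := by
  have h0 := De_u hα hu h
  have e1 : (1:ℝ) * 1 = 1 := by norm_num
  have e2 : (-1:ℝ) * (-1) = 1 := by norm_num
  have hz1 := ZD_u e2 hα hu h h0
  have hz2 := ZD_u e1 hα hu h h0
  set q := Zs (-1) k (Zs 1 j u) + (if j = k then 2 * Complex.I else 0) • Ds (-1) u with hq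
  have dd1 : Ds 1 (Ds (-1) u) = 0 := by simpa using DsDs_zero (-1) e2 h0
  have d1 : Ds 1 q = 0 := by
    rw [hq, map_add, map_smul, dd1, ← ap_comm (cZD _ _ k).eq, ← ap_comm (cZD _ _ j).eq, hz2]
    simp
  have d2 : Ds (-1) q = 0 := by
    have b := congrArg (fun C : Op n => C (Ds (-1) u)) (Zb_Z (-1) e2 j k)
    simp only [Module.End.mul_apply, LinearMap.add_apply, neg_neg, hz1, map_zero] at b
    have t : TO (Ds (-1) u) = Ds (-1) (Ds (-1) u) := by
      have : TO (Ds (-1) u) = Ds (-1) (Ds (-1) u) + Ds 1 (Ds (-1) u) := by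
        simp only [Ds_ap (-1) (Ds (-1) u), Ds_ap 1 (Ds (-1) u)]; push_cast; module
      rw [this, dd1, add_zero]
    rw [hq, map_add, map_smul, ← ap_comm (cZD _ _ k).eq, ← ap_comm (cZD _ _ j).eq, b]
    by_cases hjk : j = k
    · simp only [hjk, if_true, LinearMap.smul_apply, t]; push_cast; module
    · simp [hjk]
  obtain ⟨hT, hA⟩ := TA_of_Ds d1 d2
  have gq : Good q := ((hu.ap (Zs_mem 1 j)).ap (Zs_mem _ k)).add ((hu.ap (Ds_mem _)).smul _)
  have rq : Rng q := Rng.add ((hu.ap (Zs_mem 1 j)).ap (Zs_mem _ k)) ((hu.ap (Ds_mem _)).smul _) (Rng_Z _ (hu.ap (Zs_mem 1 j)) k)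
    ((Rng_D _ hu).smul _)
  refine liou_std (g := 1) one_pos (c := 3) (by norm_num) gq rq ?_
  have hs : (1/4 : ℂ) • SQ n u = (n : ℂ) • AO u := by
    have h9 := h
    unfold EqD at h9
    rw [h0, map_zero, zero_add] at h9
    have hα' : (α : ℂ) ≠ 0 := by exact_mod_cast hα.ne'
    have : (1/4 : ℂ) • SQ n u = (1 / α : ℂ) • (((α / 4 : ℝ) : ℂ) • SQ n u) := by
      rw [smul_smul]; congr 1; push_cast; field_simp
    rw [this, eq_neg_of_add_eq_zero_right h9, ← neg_smul, smul_smul]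
    congr 1; push_cast; field_simp
  have hs2 : (1/4 : ℂ) • SQ n q = (n : ℂ) • AO q := by
    have c1 : (1/4 : ℂ) • SQ n (Zs (-1) k (Zs 1 j u)) = (n : ℂ) • AO (Zs (-1) k (Zs 1 j u)) := by
      rw [SQ_Zs (-1) e2, SQ_Zs 1 e1, hs, map_smul, map_add, map_smul, map_smul, ap_comm (cZA _ _).eq, ap_comm (cZA _ _).eq,
        ap_comm (cZT _ k).eq]
      push_cast; module
    have c2 : (1/4 : ℂ) • SQ n (Ds (-1) u) = (n : ℂ) • AO (Ds (-1) u) := by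
      have : Commute (SQ n) (Ds (-1)) := (cST.sub_right (cSA.smul_right _)).smul_right _
      rw [ap_comm this.eq, ← map_smul, hs, map_smul, ap_comm (cDA _).eq]
    rw [hq, map_add, map_add, smul_add, smul_add, c1, map_smul, map_smul, smul_comm, c2, smul_comm]
  have h3 : De q = 0 := by rw [De_ap, hT, hA]; simp
  rw [h3, hA, map_zero, smul_zero, add_zero, zero_add]
  have : ((1 / 4 : ℝ) : ℂ) = (1/4 : ℂ) := by push_cast; rfl
  rw [this, hs2, hA, smul_zero]
end algd

/-! ### Part 10 : smoothing -/
section smoo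
variable {n : ℕ}

lemma param_int {K : Sg n × Hn n → ℂ} (hK : ContDiff ℝ (⊤ : ℕ∞) K)
    (hs : ∀ r : ℝ, ∃ R : ℝ, ∀ (p : Sg n) (w : Hn n), ‖p‖ < r → R < ‖w‖ → K (p, w) = 0) :
    ContDiff ℝ (⊤ : ℕ∞) (fun p => ∫ w, K (p, w)) := by
  rw [contDiff_iff_contDiffAt]
  intro p
  obtain ⟨R, hR⟩ := hs (‖p‖ + 1)
  have hk : IsCompact (Metric.closedBall (0 : Hn n) R) := isCompact_closedBall _ _
  have hp : p ∈ Metric.ball (0 : Sg n) (‖p‖ + 1) := by simp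
  have h := contDiffOn_convolution_right_with_param (μ := (volume : Measure (Hn n))) (f := fun _ : Hn n => (1 : ℂ)) (n := (⊤ : ℕ∞)) (ContinuousLinearMap.mul ℝ ℂ)
    (g := fun (p : Sg n) (w : Hn n) => K (p, -w)) (s := Metric.ball (0 : Sg n) (‖p‖ + 1)) Metric.isOpen_ball hk
    (fun p w hp hw => hR p (-w) (by simpa using hp) (by simpa using hw)) (locallyIntegrable_const _)
    (ContDiff.contDiffOn (by
      change ContDiff ℝ _ (fun q : Sg n × Hn n => K (q.1, -q.2))
      exact hK.comp (by fun_prop)))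
  have h2 : ContDiffOn ℝ (⊤ : ℕ∞) (fun p : Sg n => ∫ w, K (p, w)) (Metric.ball (0 : Sg n) (‖p‖ + 1)) := by
    have h3 := h.comp (g := _) (f := fun p : Sg n => (p, (0 : Hn n))) (s := Metric.ball (0 : Sg n) (‖p‖ + 1)) (by fun_prop)
      (fun q hq => ⟨hq, mem_univ _⟩)
    refine h3.congr fun q hq => ?_
    simp [convolution]
  exact h2.contDiffAt (Metric.isOpen_ball.mem_nhds hp)

lemma supp_int {f : Hn n → ℂ} (hf : Continuous f) {R : ℝ} (h : ∀ w, R < ‖w‖ → f w = 0) : Integrable f := by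
  apply hf.integrable_of_hasCompactSupport
  apply HasCompactSupport.intro (isCompact_closedBall (0 : Hn n) R)
  intro w hw
  exact h w (by simpa using hw)

lemma param_fderiv {K : Sg n × Hn n → ℂ} (hK : ContDiff ℝ (⊤ : ℕ∞) K)
    (hs : ∀ r : ℝ, ∃ R : ℝ, ∀ (p : Sg n) (w : Hn n), ‖p‖ < r → R < ‖w‖ → K (p, w) = 0) (p v : Sg n) :
    fderiv ℝ (fun p => ∫ w, K (p, w)) p v = ∫ w, fderiv ℝ (fun q => K (q, w)) p v := by
  obtain ⟨R, hR⟩ := hs (‖p‖ + 1)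
  have hp : Metric.ball (0 : Sg n) (‖p‖ + 1) ∈ 𝓝 p := Metric.isOpen_ball.mem_nhds (by simp)
  have hd : ∀ q w, HasFDerivAt (fun q => K (q, w)) ((fderiv ℝ K (q, w)).comp (ContinuousLinearMap.inl ℝ (Sg n) (Hn n))) q := by
    intro q w
    have h1 : HasFDerivAt K (fderiv ℝ K (q, w)) (q, w) := (hK.differentiable (by simp) _).hasFDerivAt
    exact h1.comp q (hasFDerivAt_prodMk_left q w)
  have hz : ∀ q w, ‖q‖ < ‖p‖ + 1 → R < ‖w‖ → (fderiv ℝ K (q, w)).comp (ContinuousLinearMap.inl ℝ (Sg n) (Hn n)) = 0 := by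
    intro q w hq hw
    rw [← (hd q w).fderiv]
    have : (fun q => K (q, w)) =ᶠ[𝓝 q] fun _ => 0 := by
      filter_upwards [Metric.isOpen_ball.mem_nhds (by simpa using hq : q ∈ Metric.ball (0 : Sg n) (‖p‖ + 1))] with q' hq'
      exact hR _ _ (by simpa using hq') hw
    rw [this.fderiv_eq]; simp
  have hc : Continuous (fun z : Sg n × Hn n => (fderiv ℝ K z).comp (ContinuousLinearMap.inl ℝ (Sg n) (Hn n))) :=
    (hK.continuous_fderiv (by simp)).clm_comp continuous_const
  obtain ⟨B, hB⟩ := ((isCompact_closedBall (0 : Sg n) (‖p‖ + 1)).prod (isCompact_closedBall (0 : Hn n) R)).exists_bound_of_continuousOn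
    (f := fun z : Sg n × Hn n => (fderiv ℝ K z).comp (ContinuousLinearMap.inl ℝ (Sg n) (Hn n))) hc.continuousOn
  have key := hasFDerivAt_integral_of_dominated_of_fderiv_le (𝕜 := ℝ) (μ := (volume : Measure (Hn n))) (F := fun p w => K (p, w)) (x₀ := p)
    (F' := fun q w => (fderiv ℝ K (q, w)).comp (ContinuousLinearMap.inl ℝ (Sg n) (Hn n)))
    (bound := (Metric.closedBall (0 : Hn n) R).indicator fun _ => B) hp
    (Eventually.of_forall fun q => (hK.continuous.comp (by fun_prop)).aestronglyMeasurable)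
    (supp_int (hK.continuous.comp (by fun_prop)) (fun w hw => hR p w (by simp) hw))
    (hc.comp (by fun_prop : Continuous fun w : Hn n => (p, w))).aestronglyMeasurable
    (Eventually.of_forall fun w q hq => by
      by_cases hw : w ∈ Metric.closedBall (0 : Hn n) R
      · rw [indicator_of_mem hw]
        exact hB (q, w) ⟨Metric.ball_subset_closedBall hq, hw⟩
      · rw [indicator_of_notMem hw, hz q w (by simpa using hq) (by simpa using hw)]; simp)
    ((integrable_indicator_iff measurableSet_closedBall).2 (by
      apply integrableOn_const (by exact measure_closedBall_lt_top.ne)))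
    (Eventually.of_forall fun w q _ => hd q w)
  rw [key.fderiv, ContinuousLinearMap.integral_apply]
  · congr 1; funext w
    rw [(hd p w).fderiv]
  · refine Continuous.integrable_of_hasCompactSupport (hc.comp (by fun_prop : Continuous fun w : Hn n => (p, w))) ?_
    apply HasCompactSupport.intro (isCompact_closedBall (0 : Hn n) R)
    intro w hw
    exact hz p w (by simp) (by simpa using hw)

/-- symplectic form -/
def qf (x w : Fin n → ℂ) : ℝ := ∑ j, ((x j).im * (w j).re - (x j).re * (w j).im)
/-- `x⁻¹ w` -/
def gm (x w : Hn n) : Hn n := (w.1 - x.1, w.2 - x.2 - 2 * qf x.1 w.1)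

lemma qf_cd : ContDiff ℝ (⊤ : ℕ∞) (fun z : (Fin n → ℂ) × (Fin n → ℂ) => qf z.1 z.2) := by
  unfold qf
  have hr : ContDiff ℝ (⊤ : ℕ∞) Complex.re := Complex.reCLM.contDiff
  have hi : ContDiff ℝ (⊤ : ℕ∞) Complex.im := Complex.imCLM.contDiff
  refine ContDiff.sum fun j _ => ?_
  have a1 : ContDiff ℝ (⊤ : ℕ∞) (fun z : (Fin n → ℂ) × (Fin n → ℂ) => z.1 j) := by fun_prop
  have a2 : ContDiff ℝ (⊤ : ℕ∞) (fun z : (Fin n → ℂ) × (Fin n → ℂ) => z.2 j) := by fun_prop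
  exact ((hi.comp a1).mul (hr.comp a2)).sub ((hr.comp a1).mul (hi.comp a2))

lemma gm_cd : ContDiff ℝ (⊤ : ℕ∞) (fun z : Hn n × Hn n => gm z.1 z.2) := by
  unfold gm
  have := qf_cd (n := n).comp (g := _) (f := fun z : Hn n × Hn n => (z.1.1, z.2.1)) (by fun_prop)
  have h2 : ContDiff ℝ (⊤ : ℕ∞) (fun z : Hn n × Hn n => qf z.1.1 z.2.1) := this
  fun_prop

lemma qf_self (x : Fin n → ℂ) : qf x x = 0 := by
  unfold qf; apply Finset.sum_eq_zero; intro j _; ring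
lemma qf_sub (x w v : Fin n → ℂ) : qf x (w - v) = qf x w - qf x v := by
  unfold qf; rw [← Finset.sum_sub_distrib]; apply Finset.sum_congr rfl; intro j _; simp; ring
lemma qf_add (x w v : Fin n → ℂ) : qf x (w + v) = qf x w + qf x v := by
  unfold qf; rw [← Finset.sum_add_distrib]; apply Finset.sum_congr rfl; intro j _; simp; ring
lemma qf_add_left (x w v : Fin n → ℂ) : qf (w + v) x = qf w x + qf v x := by
  unfold qf; rw [← Finset.sum_add_distrib]; apply Finset.sum_congr rfl; intro j _; simp; ring
lemma qf_smul (x w : Fin n → ℂ) (c : ℝ) : qf x (c • w) = c * qf x w := by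
  unfold qf; rw [Finset.mul_sum]; apply Finset.sum_congr rfl; intro j _; simp; ring
lemma qf_smul_left (x w : Fin n → ℂ) (c : ℝ) : qf (c • w) x = c * qf w x := by
  unfold qf; rw [Finset.mul_sum]; apply Finset.sum_congr rfl; intro j _; simp; ring
lemma qf_bd (x w : Fin n → ℂ) : |qf x w| ≤ 2 * n * (‖x‖ * ‖w‖) := by
  unfold qf
  refine (Finset.abs_sum_le_sum_abs _ _).trans ?_
  have : ∀ j ∈ (Finset.univ : Finset (Fin n)), |(x j).im * (w j).re - (x j).re * (w j).im| ≤ 2 * (‖x‖ * ‖w‖) := by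
    intro j _
    have h1 := (Complex.abs_re_le_norm (x j)).trans (norm_le_pi_norm x j)
    have h2 := (Complex.abs_im_le_norm (x j)).trans (norm_le_pi_norm x j)
    have h3 := (Complex.abs_re_le_norm (w j)).trans (norm_le_pi_norm w j)
    have h4 := (Complex.abs_im_le_norm (w j)).trans (norm_le_pi_norm w j)
    refine (abs_sub _ _).trans ?_
    rw [abs_mul, abs_mul]
    have a := mul_le_mul h2 h3 (abs_nonneg _) (norm_nonneg _)
    have b := mul_le_mul h1 h4 (abs_nonneg _) (norm_nonneg _)
    linarith
  refine (Finset.sum_le_sum this).trans (le_of_eq ?_)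
  simp; ring

/-- `w` is controlled by `x` and `x⁻¹ w` -/
lemma gm_norm {x w : Hn n} {r R : ℝ} (hx : ‖x‖ < r) (hg : ‖gm x w‖ ≤ R) : ‖w‖ ≤ r + R + 4 * n * (r * R) := by
  have hr : 0 < r := (norm_nonneg _).trans_lt hx
  have hR : 0 ≤ R := (norm_nonneg _).trans hg
  have g1 : ‖w.1 - x.1‖ ≤ R := (norm_fst_le (gm x w)).trans hg
  have g2 : |w.2 - x.2 - 2 * qf x.1 w.1| ≤ R := (norm_snd_le (gm x w)).trans hg
  have x1 : ‖x.1‖ ≤ r := (norm_fst_le x).trans hx.le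
  have x2 : |x.2| ≤ r := (norm_snd_le x).trans hx.le
  have e : qf x.1 w.1 = qf x.1 (w.1 - x.1) := by rw [qf_sub, qf_self, sub_zero]
  have q : |qf x.1 w.1| ≤ 2 * n * (r * R) := by
    rw [e]; refine (qf_bd _ _).trans ?_
    gcongr
  have n0 : 0 ≤ 4 * n * (r * R) := by positivity
  rw [Prod.norm_def]
  refine max_le ?_ ?_
  · have : ‖w.1‖ ≤ ‖w.1 - x.1‖ + ‖x.1‖ := by simpa using norm_add_le (w.1 - x.1) x.1
    linarith
  · rw [Real.norm_eq_abs]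
    rw [abs_le] at *
    constructor <;> linarith [g2.1, g2.2, x2.1, x2.2, q.1, q.2]

lemma gm_mp (x : Hn n) : MeasurePreserving (gm x) := by
  have h1 : MeasurePreserving (fun w : Fin n → ℂ => w - x.1) := measurePreserving_sub_right volume x.1
  have h := MeasurePreserving.skew_product (μa := (volume : Measure (Fin n → ℂ))) (μb := (volume : Measure (Fin n → ℂ)))
    (μc := (volume : Measure ℝ)) (μd := (volume : Measure ℝ)) h1
    (g := fun w t => t - x.2 - 2 * qf x.1 w) (by
      have : Continuous (fun w : Fin n → ℂ => qf x.1 w) := (qf_cd.continuous).comp (by fun_prop : Continuous fun w : Fin n → ℂ => (x.1, w))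
      apply Continuous.measurable
      simp only [Function.uncurry_def]
      fun_prop)
    (Eventually.of_forall fun w => by
      have := (measurePreserving_sub_right (volume : Measure ℝ) (x.2 + 2 * qf x.1 w)).map_eq
      simpa [sub_sub] using this)
  exact h
end smoo

/-! ### Part 11 : the smoothing operator -/
section smoo2
variable {n : ℕ}

/-- compact support in the group variable -/
def CSx (φ : Sm n) : Prop := ∃ R, ∀ p : Sg n, R < ‖p.1‖ → φ p = 0

lemma CSx.dv {φ : Sm n} (h : CSx φ) (v : Sg n) : CSx (dv v φ) := by
  obtain ⟨R, h⟩ := h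
  refine ⟨R, fun p hp => ?_⟩
  rw [dv_ap]
  have ho : IsOpen {p : Sg n | R < ‖p.1‖} := isOpen_lt continuous_const (by fun_prop)
  have : φ.fn =ᶠ[𝓝 p] fun _ => 0 := by
    filter_upwards [ho.mem_nhds hp] with q hq using h q hq
  rw [this.fderiv_eq]; simp
lemma CSx.mu {φ : Sm n} (h : CSx φ) (g : Sm n) : CSx (mu g φ) := by
  obtain ⟨R, h⟩ := h
  exact ⟨R, fun p hp => by simp [h p hp]⟩
lemma CSx.add {φ ψ : Sm n} (h : CSx φ) (k : CSx ψ) : CSx (φ + ψ) := by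
  obtain ⟨R, h⟩ := h
  obtain ⟨R', k⟩ := k
  refine ⟨max R R', fun p hp => ?_⟩
  simp [h p ((le_max_left _ _).trans_lt hp), k p ((le_max_right _ _).trans_lt hp)]
lemma CSx.smul {φ : Sm n} (h : CSx φ) (c : ℂ) : CSx (c • φ) := by
  obtain ⟨R, h⟩ := h
  exact ⟨R, fun p hp => by simp [h p hp]⟩
lemma CSx.zero : CSx (0 : Sm n) := ⟨0, fun p _ => by simp⟩
lemma CSx.sum {ι : Type*} {s : Finset ι} {f : ι → Sm n} (h : ∀ i ∈ s, CSx (f i)) : CSx (∑ i ∈ s, f i) := by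
  classical
  induction s using Finset.induction_on with
  | empty => simpa using CSx.zero
  | insert a s ha ih =>
    rw [Finset.sum_insert ha]
    exact (h a (by simp)).add (ih fun i hi => h i (by simp [hi]))

/-- right invariant fields -/
def XR (j : Fin n) : Op n := dv (eXS n j) - (2 : ℂ) • (mu (yco j) * dv (eTS n))
/-- right invariant fields -/
def YR (j : Fin n) : Op n := dv (eYS n j) + (2 : ℂ) • (mu (xco j) * dv (eTS n))

lemma CSx.XR {φ : Sm n} (h : CSx φ) (j : Fin n) : CSx (XR j φ) := by
  have : _root_.XR j φ = _root_.dv (eXS n j) φ + (-2 : ℂ) • (_root_.mu (yco j) (_root_.dv (eTS n) φ)) := by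
    simp [_root_.XR, Module.End.mul_apply, sub_eq_add_neg]
  rw [this]
  exact (h.dv _).add (((h.dv _).mu _).smul _)
lemma CSx.YR {φ : Sm n} (h : CSx φ) (j : Fin n) : CSx (YR j φ) := (h.dv _).add (((h.dv _).mu _).smul _)
lemma CSx.XO {φ : Sm n} (h : CSx φ) (j : Fin n) : CSx (XO j φ) := (h.dv _).add (((h.dv _).mu _).smul _)
lemma CSx.YO {φ : Sm n} (h : CSx φ) (j : Fin n) : CSx (YO j φ) := by
  have : _root_.YO j φ = _root_.dv (eYS n j) φ + (-2 : ℂ) • (_root_.mu (xco j) (_root_.dv (eTS n) φ)) := by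
    simp [_root_.YO, Module.End.mul_apply, sub_eq_add_neg]
  rw [this]
  exact (h.dv _).add (((h.dv _).mu _).smul _)
lemma CSx.TO {φ : Sm n} (h : CSx φ) : CSx (TO φ) := h.dv _
lemma CSx.SQ {φ : Sm n} (h : CSx φ) : CSx (SQ n φ) := by
  rw [SQ_ap]
  exact CSx.sum fun j _ => ((h.XO j).XO j).add ((h.YO j).YO j)

/-- the kernel -/
def Kf (V φ : Sm n) (z : Sg n × Hn n) : ℂ := V (z.2, z.1.2) * φ (gm z.1.1 z.2, z.1.2)

lemma Kf_cd (V φ : Sm n) : ContDiff ℝ (⊤ : ℕ∞) (Kf V φ) := by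
  unfold Kf
  refine (V.cd.comp (by fun_prop)).mul (φ.cd.comp ?_)
  exact (gm_cd.comp (g := _) (f := fun z : Sg n × Hn n => (z.1.1, z.2)) (by fun_prop)).prodMk (by fun_prop)

lemma Kf_supp (V : Sm n) {φ : Sm n} (h : CSx φ) (r : ℝ) : ∃ R : ℝ, ∀ (p : Sg n) (w : Hn n), ‖p‖ < r → R < ‖w‖ → Kf V φ (p, w) = 0 := by
  obtain ⟨R, h⟩ := h
  refine ⟨r + R + 4 * n * (r * R), fun p w hp hw => ?_⟩
  have : R < ‖gm p.1 w‖ := by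
    by_contra hc
    exact absurd (gm_norm ((norm_fst_le p).trans_lt hp) (not_lt.1 hc)) (not_le.2 hw)
  simp [Kf, h (gm p.1 w, p.2) this]

/-- smoothing -/
def UU (V φ : Sm n) (h : CSx φ) : Sm n := Sm.mk (fun p => ∫ w, Kf V φ (p, w)) (param_int (Kf_cd V φ) (Kf_supp V h))

lemma UU_ap (V φ : Sm n) (h : CSx φ) (p : Sg n) : UU V φ h p = ∫ w, V (w, p.2) * φ (gm p.1 w, p.2) := rfl

lemma Kf_int (V : Sm n) {φ : Sm n} (h : CSx φ) (p : Sg n) : Integrable (fun w => V (w, p.2) * φ (gm p.1 w, p.2)) := by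
  obtain ⟨R, hR⟩ := Kf_supp V h (‖p‖ + 1)
  exact supp_int (f := fun w => Kf V φ (p, w)) ((Kf_cd V φ).continuous.comp (by fun_prop)) (fun w hw => hR p w (by simp) hw)

lemma UU_add (V φ ψ : Sm n) (h : CSx φ) (k : CSx ψ) (l : CSx (φ + ψ)) : UU V (φ + ψ) l = UU V φ h + UU V ψ k := by
  apply Sm.ext; intro p
  simp only [UU_ap, Sm.add_ap, mul_add]
  exact integral_add (Kf_int V h p) (Kf_int V k p)
lemma UU_smul (V φ : Sm n) (c : ℂ) (h : CSx φ) (l : CSx (c • φ)) : UU V (c • φ) l = c • UU V φ h := by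
  apply Sm.ext; intro p
  simp only [UU_ap, Sm.smul_ap]
  rw [← integral_const_mul]; congr 1; funext w; ring
lemma UU_add_left (V W φ : Sm n) (h : CSx φ) : UU (V + W) φ h = UU V φ h + UU W φ h := by
  apply Sm.ext; intro p
  simp only [UU_ap, Sm.add_ap, add_mul]
  exact integral_add (Kf_int V h p) (Kf_int W h p)
lemma UU_smul_left (V φ : Sm n) (c : ℂ) (h : CSx φ) : UU (c • V) φ h = c • UU V φ h := by
  apply Sm.ext; intro p
  simp only [UU_ap, Sm.smul_ap]
  rw [← integral_const_mul]; congr 1; funext w; ring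
lemma UU_zero_left (φ : Sm n) (h : CSx φ) : UU 0 φ h = 0 := by
  apply Sm.ext; intro p
  simp [UU_ap]
lemma UU_congr {V φ ψ : Sm n} (e : φ = ψ) (h : CSx φ) (k : CSx ψ) : UU V φ h = UU V ψ k := by
  subst e; rfl
lemma UU_sum (V : Sm n) {ι : Type*} (s : Finset ι) (f : ι → Sm n) (h : ∀ i, CSx (f i)) (l : CSx (∑ i ∈ s, f i)) :
    UU V (∑ i ∈ s, f i) l = ∑ i ∈ s, UU V (f i) (h i) := by
  apply Sm.ext; intro p
  simp only [UU_ap, Sm.sum_ap, Finset.mul_sum]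
  exact integral_finset_sum _ fun i _ => Kf_int V (h i) p
lemma UU_sum_left (φ : Sm n) {ι : Type*} (s : Finset ι) (f : ι → Sm n) (h : CSx φ) :
    UU (∑ i ∈ s, f i) φ h = ∑ i ∈ s, UU (f i) φ h := by
  apply Sm.ext; intro p
  simp only [UU_ap, Sm.sum_ap, Finset.sum_mul]
  exact integral_finset_sum _ fun i _ => Kf_int (f i) h p
lemma MA_UU (V φ : Sm n) (h : CSx φ) : MA (UU V φ h) = UU (MA V) φ h := by
  apply Sm.ext; intro p
  simp only [MA, mu_ap, Sm.mul_ap, UU_ap]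
  rw [← integral_const_mul]; congr 1; funext w
  simp only [ea_ap]; ring

lemma line_congr {E E' : Type*} [NormedAddCommGroup E] [NormedSpace ℝ E] [NormedAddCommGroup E'] [NormedSpace ℝ E']
    {f : E → ℂ} {g : E' → ℂ} {p v : E} {p' v' : E'} (hf : DifferentiableAt ℝ f p)
    (hg : DifferentiableAt ℝ g p') (h : ∀ t : ℝ, f (p + t • v) = g (p' + t • v')) : fderiv ℝ f p v = fderiv ℝ g p' v' := by
  rw [← hf.lineDeriv_eq_fderiv, ← hg.lineDeriv_eq_fderiv]
  unfold lineDeriv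
  congr 1; funext t; exact h t

lemma Kf_diff (V φ : Sm n) (p : Sg n) (w : Hn n) : DifferentiableAt ℝ (fun q => Kf V φ (q, w)) p :=
  (((Kf_cd V φ).differentiable (by simp)) (p, w)).comp (f := fun q : Sg n => (q, w)) p (by fun_prop)

lemma dv_UU (V φ : Sm n) (h : CSx φ) (v p : Sg n) : dv v (UU V φ h) p = ∫ w, fderiv ℝ (fun q => Kf V φ (q, w)) p v :=
  param_fderiv (Kf_cd V φ) (Kf_supp V h) p v

lemma fd_Kf (V φ : Sm n) (p : Sg n) (w : Hn n) (v : Hn n) :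
    fderiv ℝ (fun q => Kf V φ (q, w)) p (v, 0) =
      V (w, p.2) * fderiv ℝ φ.fn (gm p.1 w, p.2) ((-v.1, -v.2 - 2 * qf v.1 w.1), 0) := by
  have hg : DifferentiableAt ℝ (fun q => V (w, p.2) * φ q) (gm p.1 w, p.2) := (φ.diff _).const_mul _
  rw [line_congr (Kf_diff V φ p w) hg (v' := ((-v.1, -v.2 - 2 * qf v.1 w.1), 0))]
  · rw [fderiv_const_mul (φ.diff _)]; simp
  · intro t
    have e : gm (p.1 + t • v) w = gm p.1 w + t • (-v.1, -v.2 - 2 * qf v.1 w.1) := by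
      refine Prod.ext ?_ ?_
      · simp only [gm, Prod.fst_add, Prod.smul_mk, Prod.smul_fst, smul_neg]; abel
      · simp only [gm, Prod.fst_add, Prod.snd_add, Prod.smul_mk, Prod.smul_fst, Prod.smul_snd, qf_add_left, qf_smul_left, smul_eq_mul]; ring
    have e2 : ((p + t • ((v, 0) : Sg n))) = (p.1 + t • v, p.2) := by
      refine Prod.ext ?_ ?_ <;> simp
    have e3 : ((gm p.1 w, p.2) : Sg n) + t • ((-v.1, -v.2 - 2 * qf v.1 w.1), 0) = (gm (p.1 + t • v) w, p.2) := by
      rw [e]; refine Prod.ext ?_ ?_ <;> simp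
    rw [e2, e3, Kf]

lemma fd_Kf_A (V φ : Sm n) (p : Sg n) (w : Hn n) :
    fderiv ℝ (fun q => Kf V φ (q, w)) p (eA n) =
      dv (eA n) V (w, p.2) * φ (gm p.1 w, p.2) + V (w, p.2) * dv (eA n) φ (gm p.1 w, p.2) := by
  have e : (fun q => Kf V φ (q, w)) = (fun q => V (w, q.2)) * (fun q => φ (gm q.1 w, q.2)) := rfl
  have c1 : ContDiff ℝ (⊤ : ℕ∞) (fun q : Sg n => V (w, q.2)) := V.cd.comp (by fun_prop)
  have c2 : ContDiff ℝ (⊤ : ℕ∞) (fun q : Sg n => φ (gm q.1 w, q.2)) :=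
    φ.cd.comp ((gm_cd.comp (g := _) (f := fun z : Sg n => (z.1, w)) (by fun_prop)).prodMk (by fun_prop))
  have d1 := (c1.differentiable (by simp)) p
  have d2 := (c2.differentiable (by simp)) p
  rw [e, fderiv_mul d1 d2]
  have e1 : fderiv ℝ (fun q : Sg n => V (w, q.2)) p (eA n) = dv (eA n) V (w, p.2) :=
    line_congr d1 (V.diff _) (fun t => by simp [eA])
  have e2 : fderiv ℝ (fun q : Sg n => φ (gm q.1 w, q.2)) p (eA n) = dv (eA n) φ (gm p.1 w, p.2) :=
    line_congr d2 (φ.diff _) (fun t => by simp [eA])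
  simp only [ContinuousLinearMap.add_apply, ContinuousLinearMap.smul_apply, e1, e2, smul_eq_mul]
  ring

lemma T_UU (V φ : Sm n) (h : CSx φ) : TO (UU V φ h) = (-1 : ℂ) • UU V (TO φ) h.TO := by
  apply Sm.ext; intro p
  change dv (eTS n) (UU V φ h) p = _
  rw [dv_UU, Sm.smul_ap, UU_ap, ← integral_const_mul]
  congr 1; funext w
  rw [eTS, fd_Kf]
  have : (((-(eT n).1, -(eT n).2 - 2 * qf (eT n).1 w.1), 0) : Sg n) = (-1 : ℝ) • (eT n, 0) := by
    simp [eT, qf]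
  rw [this, map_smul]
  change _ = -1 * (V (w, p.2) * fderiv ℝ φ.fn (gm p.1 w, p.2) (eTS n))
  rw [eTS]; simp

lemma X_UU (V φ : Sm n) (h : CSx φ) (j : Fin n) : XO j (UU V φ h) = (-1 : ℂ) • UU V (XR j φ) (h.XR j) := by
  apply Sm.ext; intro p
  have : XO j (UU V φ h) p = dv (eX n j + (2 * (p.1.1 j).im) • eT n, 0) (UU V φ h) p := by
    simp only [XO, LinearMap.add_apply, LinearMap.smul_apply, Module.End.mul_apply, mu_ap, Sm.add_ap, Sm.smul_ap, Sm.mul_ap, yco_ap, dv_ap]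
    have : ((eX n j + (2 * (p.1.1 j).im) • eT n, 0) : Sg n) = eXS n j + (2 * (p.1.1 j).im) • eTS n := by
      simp [eXS, eTS]
    rw [this, map_add, map_smul]
    simp; ring
  rw [this, dv_UU, Sm.smul_ap, UU_ap, ← integral_const_mul]
  congr 1; funext w
  rw [fd_Kf]
  have q1 : qf (eX n j + (2 * (p.1.1 j).im) • eT n).1 w.1 = -(w.1 j).im := by
    simp only [qf]
    rw [Finset.sum_eq_single j]
    · simp [eX, eT]
    · intro b _ hb; simp [eX, eT, hb]
    · simp
  have : (((-(eX n j + (2 * (p.1.1 j).im) • eT n).1, -(eX n j + (2 * (p.1.1 j).im) • eT n).2 - 2 * qf (eX n j + (2 * (p.1.1 j).im) • eT n).1 w.1), 0) : Sg n)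
      = (-1 : ℝ) • (eXS n j - (2 * ((gm p.1 w).1 j).im) • eTS n) := by
    rw [q1]
    refine Prod.ext (Prod.ext ?_ ?_) ?_
    · simp [eXS, eTS, eT]
    · simp [eXS, eTS, eT, eX, gm]; ring
    · simp [eXS, eTS]
  rw [this, map_smul, map_sub, map_smul]
  simp only [XR, LinearMap.sub_apply, LinearMap.smul_apply, Module.End.mul_apply, mu_ap, Sm.sub_ap, Sm.smul_ap, Sm.mul_ap, yco_ap, dv_ap]
  simp; ring

lemma Y_UU (V φ : Sm n) (h : CSx φ) (j : Fin n) : YO j (UU V φ h) = (-1 : ℂ) • UU V (YR j φ) (h.YR j) := by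
  apply Sm.ext; intro p
  have : YO j (UU V φ h) p = dv (eY n j + (-2 * (p.1.1 j).re) • eT n, 0) (UU V φ h) p := by
    simp only [YO, LinearMap.sub_apply, LinearMap.smul_apply, Module.End.mul_apply, mu_ap, Sm.sub_ap, Sm.smul_ap, Sm.mul_ap, xco_ap, dv_ap]
    have : ((eY n j + (-2 * (p.1.1 j).re) • eT n, 0) : Sg n) = eYS n j + (-2 * (p.1.1 j).re) • eTS n := by
      simp [eYS, eTS]
    rw [this, map_add, map_smul]
    simp; ring
  rw [this, dv_UU, Sm.smul_ap, UU_ap, ← integral_const_mul]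
  congr 1; funext w
  rw [fd_Kf]
  have q1 : qf (eY n j + (-2 * (p.1.1 j).re) • eT n).1 w.1 = (w.1 j).re := by
    simp only [qf]
    rw [Finset.sum_eq_single j]
    · simp [eY, eT]
    · intro b _ hb; simp [eY, eT, hb]
    · simp
  have : (((-(eY n j + (-2 * (p.1.1 j).re) • eT n).1, -(eY n j + (-2 * (p.1.1 j).re) • eT n).2 - 2 * qf (eY n j + (-2 * (p.1.1 j).re) • eT n).1 w.1), 0) : Sg n)
      = (-1 : ℝ) • (eYS n j + (2 * ((gm p.1 w).1 j).re) • eTS n) := by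
    rw [q1]
    refine Prod.ext (Prod.ext ?_ ?_) ?_
    · simp [eYS, eTS, eT]
    · simp [eYS, eTS, eT, eY, gm]; ring
    · simp [eYS, eTS]
  rw [this, map_smul, map_add, map_smul]
  simp only [YR, LinearMap.add_apply, LinearMap.smul_apply, Module.End.mul_apply, mu_ap, Sm.add_ap, Sm.smul_ap, Sm.mul_ap, xco_ap, dv_ap]
  simp; ring

lemma A_UU (V φ : Sm n) (h : CSx φ) (h0 : dv (eA n) φ = 0) : AO (UU V φ h) = UU (AO V) φ h := by
  apply Sm.ext; intro p
  rw [AO, Module.End.mul_apply, mu_ap, Sm.mul_ap, dv_UU, UU_ap, ← integral_const_mul]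
  congr 1; funext w
  rw [fd_Kf_A, h0, Module.End.mul_apply, mu_ap, Sm.mul_ap]
  simp only [ea_ap, Sm.zero_ap]; ring
end smoo2

/-! ### Part 12 : integration by parts in the smoothing operator -/
section smoo3
variable {n : ℕ}

lemma ibp_dir (V φ : Sm n) (h : CSx φ) (v : Hn n) (p : Sg n) :
    UU (dv (v, 0) V) φ h p = - UU V (dv (v, 0) φ) (h.dv _) p + 2 * (qf p.1.1 v.1 : ℂ) * UU V (TO φ) h.TO p := by
  have c1 : ContDiff ℝ (⊤ : ℕ∞) (fun w : Hn n => V (w, p.2)) := V.cd.comp (by fun_prop)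
  have c2 : ContDiff ℝ (⊤ : ℕ∞) (fun w : Hn n => φ (gm p.1 w, p.2)) :=
    φ.cd.comp ((gm_cd.comp (g := _) (f := fun w : Hn n => (p.1, w)) (by fun_prop)).prodMk (by fun_prop))
  have d1 : ∀ w, DifferentiableAt ℝ (fun w : Hn n => V (w, p.2)) w := fun w => (c1.differentiable (by simp)) w
  have d2 : ∀ w, DifferentiableAt ℝ (fun w : Hn n => φ (gm p.1 w, p.2)) w := fun w => (c2.differentiable (by simp)) w
  have e1 : ∀ w, fderiv ℝ (fun w : Hn n => V (w, p.2)) w v = dv (v, 0) V (w, p.2) := fun w =>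
    line_congr (d1 w) (V.diff _) (fun t => by simp)
  have e2 : ∀ w, fderiv ℝ (fun w : Hn n => φ (gm p.1 w, p.2)) w v =
      dv (v, 0) φ (gm p.1 w, p.2) - 2 * (qf p.1.1 v.1 : ℂ) * TO φ (gm p.1 w, p.2) := fun w => by
    have e : ∀ t : ℝ, gm p.1 (w + t • v) = gm p.1 w + t • (v.1, v.2 - 2 * qf p.1.1 v.1) := by
      intro t
      refine Prod.ext ?_ ?_
      · simp only [gm, Prod.fst_add, Prod.smul_mk, Prod.smul_fst]; abel
      · simp only [gm, Prod.fst_add, Prod.snd_add, Prod.smul_mk, Prod.smul_fst, Prod.smul_snd, qf_add, qf_smul, smul_eq_mul]; ring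
    rw [line_congr (d2 w) (φ.diff (gm p.1 w, p.2)) (v' := ((v.1, v.2 - 2 * qf p.1.1 v.1), 0)) (fun t => by
      rw [e]; simp)]
    have : (((v.1, v.2 - 2 * qf p.1.1 v.1), 0) : Sg n) = (v, 0) - (2 * qf p.1.1 v.1) • eTS n := by
      refine Prod.ext (Prod.ext ?_ ?_) ?_ <;> simp [eTS, eT]
    rw [this, map_sub, map_smul]
    simp [TO, dv_ap]
  have key := integral_mul_fderiv_eq_neg_fderiv_mul_of_integrable (μ := (volume : Measure (Hn n)))
    (f := fun w : Hn n => V (w, p.2)) (g := fun w : Hn n => φ (gm p.1 w, p.2)) (v := v) ?_ ?_ ?_ (fun w _ => d1 w) (fun w _ => d2 w)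
  · simp only [e1, e2] at key
    have i1 := Kf_int V (h.dv (v, 0)) p
    have i2 := Kf_int V (h.TO) p
    have : ∫ w, V (w, p.2) * (dv (v, 0) φ (gm p.1 w, p.2) - 2 * (qf p.1.1 v.1 : ℂ) * TO φ (gm p.1 w, p.2))
       = UU V (dv (v, 0) φ) (h.dv _) p - 2 * (qf p.1.1 v.1 : ℂ) * UU V (TO φ) h.TO p := by
      rw [UU_ap, UU_ap, ← integral_const_mul, ← integral_sub i1 (i2.const_mul _)]
      congr 1; funext w; ring
    rw [this] at key
    have h3 : UU (dv (v, 0) V) φ h p = ∫ w, dv (v, 0) V (w, p.2) * φ (gm p.1 w, p.2) := rfl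
    rw [h3]
    linear_combination key
  · simp only [e1]; exact Kf_int (dv (v, 0) V) h p
  · simp only [e2]
    have i1 := Kf_int V (h.dv (v, 0)) p
    have i2 := Kf_int V (h.TO) p
    refine (i1.sub (i2.const_mul (2 * (qf p.1.1 v.1 : ℂ)))).congr (Eventually.of_forall fun w => ?_)
    simp only [Pi.sub_apply]; ring
  · exact Kf_int V h p

lemma T_ibp (V φ : Sm n) (h : CSx φ) : UU (TO V) φ h = (-1 : ℂ) • UU V (TO φ) h.TO := by
  apply Sm.ext; intro p
  have := ibp_dir V φ h (eT n) p
  have q : qf p.1.1 (eT n).1 = 0 := by simp [qf, eT]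
  rw [q] at this
  rw [Sm.smul_ap]
  refine Eq.trans this ?_
  simp; rfl

lemma X_ibp (V φ : Sm n) (h : CSx φ) (j : Fin n) : UU (XO j V) φ h = (-1 : ℂ) • UU V (XO j φ) (h.XO j) := by
  apply Sm.ext; intro p
  have h1 := ibp_dir V φ h (eX n j) p
  have q : qf p.1.1 (eX n j).1 = (p.1.1 j).im := by
    simp only [qf]
    rw [Finset.sum_eq_single j]
    · simp [eX]
    · intro b _ hb; simp [eX, hb]
    · simp
  rw [q] at h1
  have h2 := congrArg (fun f : Sm n => f p) (T_ibp V (mu (yco j) φ) (h.mu _))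
  have h3 := congrArg (fun f : Sm n => f p) (T_ibp V φ h)
  have e : TO (mu (yco j) φ) = mu (yco j) (TO φ) := by
    apply Sm.ext; intro q
    simp [TO, mu_ap, dv_mul, dv_yco, eTS, eT]
  rw [UU_congr e _ (h.TO.mu _)] at h2
  have a1 : UU (XO j V) φ h p = UU (dv (eXS n j) V) φ h p + 2 * UU (TO V) (mu (yco j) φ) (h.mu _) p
      + 2 * ((p.1.1 j).im : ℂ) * UU (TO V) φ h p := by
    simp only [UU_ap]
    rw [← integral_const_mul, ← integral_const_mul, ← integral_add, ← integral_add]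
    · congr 1; funext w
      simp only [XO, LinearMap.add_apply, LinearMap.smul_apply, Module.End.mul_apply, mu_ap, Sm.add_ap, Sm.smul_ap, Sm.mul_ap, yco_ap]
      simp [gm, TO]; ring
    · exact (Kf_int _ h p).add ((Kf_int (TO V) (h.mu (yco j)) p).const_mul _)
    · exact (Kf_int _ h p).const_mul _
    · exact Kf_int _ h p
    · exact (Kf_int (TO V) (h.mu (yco j)) p).const_mul _
  have a2 : UU V (XO j φ) (h.XO j) = UU V (dv (eXS n j) φ) (h.dv _) + (2 : ℂ) • UU V (mu (yco j) (TO φ)) (h.TO.mu _) := by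
    rw [← UU_smul _ _ _ _ ((h.TO.mu _).smul _)]
    exact UU_add V _ _ (h.dv _) ((h.TO.mu _).smul _) _
  rw [a1, a2, Sm.smul_ap, Sm.add_ap, Sm.smul_ap]
  simp only [Sm.smul_ap] at h2 h3
  have h1' : UU (dv (eXS n j) V) φ h p = - UU V (dv (eXS n j) φ) (h.dv _) p + 2 * ((p.1.1 j).im : ℂ) * UU V (TO φ) h.TO p := h1
  rw [h1', h2, h3]
  ring

lemma Y_ibp (V φ : Sm n) (h : CSx φ) (j : Fin n) : UU (YO j V) φ h = (-1 : ℂ) • UU V (YO j φ) (h.YO j) := by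
  apply Sm.ext; intro p
  have h1 := ibp_dir V φ h (eY n j) p
  have q : qf p.1.1 (eY n j).1 = -(p.1.1 j).re := by
    simp only [qf]
    rw [Finset.sum_eq_single j]
    · simp [eY]
    · intro b _ hb; simp [eY, hb]
    · simp
  rw [q] at h1
  have h2 := congrArg (fun f : Sm n => f p) (T_ibp V (mu (xco j) φ) (h.mu _))
  have h3 := congrArg (fun f : Sm n => f p) (T_ibp V φ h)
  have e : TO (mu (xco j) φ) = mu (xco j) (TO φ) := by
    apply Sm.ext; intro q
    simp [TO, mu_ap, dv_mul, dv_xco, eTS, eT]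
  rw [UU_congr e _ (h.TO.mu _)] at h2
  have a1 : UU (YO j V) φ h p = UU (dv (eYS n j) V) φ h p + (-2) * UU (TO V) (mu (xco j) φ) (h.mu _) p
      + (-2) * ((p.1.1 j).re : ℂ) * UU (TO V) φ h p := by
    simp only [UU_ap]
    rw [← integral_const_mul, ← integral_const_mul, ← integral_add, ← integral_add]
    · congr 1; funext w
      simp only [YO, LinearMap.sub_apply, LinearMap.smul_apply, Module.End.mul_apply, mu_ap, Sm.sub_ap, Sm.smul_ap, Sm.mul_ap, xco_ap]
      simp [gm, TO]; ring
    · exact (Kf_int _ h p).add ((Kf_int (TO V) (h.mu (xco j)) p).const_mul _)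
    · exact (Kf_int _ h p).const_mul _
    · exact Kf_int _ h p
    · exact (Kf_int (TO V) (h.mu (xco j)) p).const_mul _
  have a2 : UU V (YO j φ) (h.YO j) = UU V (dv (eYS n j) φ) (h.dv _) + (-2 : ℂ) • UU V (mu (xco j) (TO φ)) (h.TO.mu _) := by
    rw [← UU_smul _ _ _ _ ((h.TO.mu _).smul _), ← UU_add V _ _ (h.dv _) ((h.TO.mu _).smul _) ((h.dv _).add ((h.TO.mu _).smul _))]
    apply UU_congr
    simp [YO, TO, Module.End.mul_apply, sub_eq_add_neg]
  rw [a1, a2, Sm.smul_ap, Sm.add_ap, Sm.smul_ap]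
  simp only [Sm.smul_ap] at h2 h3
  have h1' : UU (dv (eYS n j) V) φ h p = - UU V (dv (eYS n j) φ) (h.dv _) p + 2 * ((-(p.1.1 j).re : ℝ) : ℂ) * UU V (TO φ) h.TO p := h1
  rw [h1', h2, h3]
  push_cast
  ring

lemma XX_ibp (V φ : Sm n) (h : CSx φ) (j : Fin n) : UU (XO j (XO j V)) φ h = UU V (XO j (XO j φ)) ((h.XO j).XO j) := by
  rw [X_ibp, X_ibp, smul_smul]; simp
lemma YY_ibp (V φ : Sm n) (h : CSx φ) (j : Fin n) : UU (YO j (YO j V)) φ h = UU V (YO j (YO j φ)) ((h.YO j).YO j) := by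
  rw [Y_ibp, Y_ibp, smul_smul]; simp
lemma TT_ibp (V φ : Sm n) (h : CSx φ) : UU (TO (TO V)) φ h = UU V (TO (TO φ)) h.TO.TO := by
  rw [T_ibp, T_ibp, smul_smul]; simp
lemma SQ_ibp (V φ : Sm n) (h : CSx φ) : UU (SQ n V) φ h = UU V (SQ n φ) h.SQ := by
  rw [SQ_ap, UU_sum_left, UU_congr (SQ_ap φ) h.SQ (CSx.sum fun j _ => ((h.XO j).XO j).add ((h.YO j).YO j)),
    UU_sum V _ _ (fun j => ((h.XO j).XO j).add ((h.YO j).YO j))]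
  refine Finset.sum_congr rfl fun j _ => ?_
  rw [UU_add_left, XX_ibp, YY_ibp, ← UU_add]

/-- right-invariant sum of squares -/
lemma SQ_UU (V φ : Sm n) (h : CSx φ) (e : ∑ j, (XR j (XR j φ) + YR j (YR j φ)) = SQ n φ) :
    SQ n (UU V φ h) = UU V (SQ n φ) h.SQ := by
  rw [UU_congr e.symm h.SQ (CSx.sum fun j _ => ((h.XR j).XR j).add ((h.YR j).YR j)),
    UU_sum V _ _ (fun j => ((h.XR j).XR j).add ((h.YR j).YR j)), SQ_ap]
  refine Finset.sum_congr rfl fun j _ => ?_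
  rw [UU_add V _ _ ((h.XR j).XR j) ((h.YR j).YR j), X_UU, map_smul, X_UU, smul_smul, Y_UU, map_smul, Y_UU, smul_smul]
  simp
end smoo3

/-! ### Part 13 : logarithmic height coordinate -/
section trans
variable {n : ℕ}

/-- smooth on the open half space -/
def SH (G : Sg n → ℂ) : Prop := ContDiffOn ℝ (⊤ : ℕ∞) G {p : Sg n | 0 < p.2}

lemma open_H : IsOpen {p : Sg n | 0 < p.2} := isOpen_lt continuous_const continuous_snd

lemma SH.at {G : Sg n → ℂ} (h : SH G) {p : Sg n} (hp : 0 < p.2) : ContDiffAt ℝ (⊤ : ℕ∞) G p :=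
  ContDiffOn.contDiffAt h (open_H.mem_nhds hp)
lemma SH.dAt {G : Sg n → ℂ} (h : SH G) {p : Sg n} (hp : 0 < p.2) : DifferentiableAt ℝ G p :=
  (h.at hp).differentiableAt (by simp)
lemma SH.dirD {G : Sg n → ℂ} (h : SH G) (v : Sg n) : SH (dirD v G) := by
  have := ContDiffOn.fderiv_of_isOpen (m := (⊤ : ℕ∞)) h open_H (by exact le_of_eq rfl)
  exact this.clm_apply contDiffOn_const
lemma SH.DA {G : Sg n → ℂ} (h : SH G) : SH (DA n G) := h.dirD _
lemma SH.DAi {G : Sg n → ℂ} (h : SH G) (m : ℕ) : SH ((_root_.DA n)^[m] G) := by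
  induction m with
  | zero => exact h
  | succ m ih => rw [Function.iterate_succ_apply']; exact ih.DA
lemma SH.TS {G : Sg n → ℂ} (h : SH G) : SH (TS n G) := h.dirD _
lemma SH.XS {G : Sg n → ℂ} (h : SH G) (j : Fin n) : SH (XS n j G) := by
  have c : ContDiff ℝ (⊤ : ℕ∞) (fun p : Sg n => 2 * ((p.1.1 j).im : ℂ)) :=
    contDiff_const.mul (Complex.ofRealCLM.contDiff.comp (Complex.imCLM.contDiff.comp (by fun_prop)))
  exact ContDiffOn.add (h.dirD _) (c.contDiffOn.mul (h.dirD _))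
lemma SH.YS {G : Sg n → ℂ} (h : SH G) (j : Fin n) : SH (YS n j G) := by
  have c : ContDiff ℝ (⊤ : ℕ∞) (fun p : Sg n => 2 * ((p.1.1 j).re : ℂ)) :=
    contDiff_const.mul (Complex.ofRealCLM.contDiff.comp (Complex.reCLM.contDiff.comp (by fun_prop)))
  exact ContDiffOn.sub (h.dirD _) (c.contDiffOn.mul (h.dirD _))

/-- the coordinate change -/
def EX (p : Sg n) : Sg n := (p.1, Real.exp p.2)
lemma EX_cd : ContDiff ℝ (⊤ : ℕ∞) (EX (n := n)) := contDiff_fst.prodMk (Real.contDiff_exp.comp contDiff_snd)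
lemma EX_pos (p : Sg n) : 0 < (EX p).2 := Real.exp_pos _

/-- transfer -/
def tl (G : Sg n → ℂ) (h : SH G) : Sm n := Sm.mk (fun p => G (EX p)) (by
  rw [contDiff_iff_contDiffAt]; intro p
  exact (h.at (EX_pos p)).comp p EX_cd.contDiffAt)
lemma tl_ap (G : Sg n → ℂ) (h : SH G) (p : Sg n) : tl G h p = G (EX p) := rfl

lemma tl_fd (G : Sg n → ℂ) (h : SH G) (p v : Sg n) : dv v (tl G h) p = dirD (v.1, v.2 * Real.exp p.2) G (EX p) := by
  have hE : HasFDerivAt (EX (n := n)) ((ContinuousLinearMap.fst ℝ (Hn n) ℝ).prod ((Real.exp p.2) • (ContinuousLinearMap.snd ℝ (Hn n) ℝ))) p :=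
    (hasFDerivAt_fst).prodMk ((Real.hasDerivAt_exp p.2).comp_hasFDerivAt p hasFDerivAt_snd)
  have := ((h.dAt (EX_pos p)).hasFDerivAt.comp p hE).fderiv
  rw [dv_ap]
  change fderiv ℝ (G ∘ EX) p v = _
  rw [this]
  simp [dirD, mul_comm]

lemma tl_h (G : Sg n → ℂ) (h : SH G) (v : Hn n) : dv (v, 0) (tl G h) = tl (dirD (v, 0) G) (h.dirD _) := by
  apply Sm.ext; intro p
  rw [tl_fd, tl_ap]; simp
lemma tl_A (G : Sg n → ℂ) (h : SH G) : AO (tl G h) = tl (DA n G) h.DA := by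
  apply Sm.ext; intro p
  rw [AO, Module.End.mul_apply, mu_ap, Sm.mul_ap, tl_fd, tl_ap, ea_ap]
  have : ((eA n).1, (eA n).2 * Real.exp p.2) = (Real.exp p.2) • eA n := by simp [eA]
  rw [this, dirD, map_smul]
  simp only [DA, dirD, Complex.real_smul]
  rw [← mul_assoc, ← Complex.ofReal_mul, ← Real.exp_add]; simp
lemma tl_T (G : Sg n → ℂ) (h : SH G) : TO (tl G h) = tl (TS n G) h.TS := tl_h G h (eT n)
lemma tl_X (G : Sg n → ℂ) (h : SH G) (j : Fin n) : XO j (tl G h) = tl (XS n j G) (h.XS j) := by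
  have e1 := tl_h G h (eX n j)
  have e2 := tl_h G h (eT n)
  apply Sm.ext; intro p
  simp only [XO, LinearMap.add_apply, LinearMap.smul_apply, Module.End.mul_apply, mu_ap, Sm.add_ap, Sm.smul_ap, Sm.mul_ap, yco_ap]
  rw [eXS, eTS, e1, e2]
  simp only [tl_ap, XS, EX, eXS, eTS]; ring
lemma tl_Y (G : Sg n → ℂ) (h : SH G) (j : Fin n) : YO j (tl G h) = tl (YS n j G) (h.YS j) := by
  have e1 := tl_h G h (eY n j)
  have e2 := tl_h G h (eT n)
  apply Sm.ext; intro p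
  simp only [YO, LinearMap.sub_apply, LinearMap.smul_apply, Module.End.mul_apply, mu_ap, Sm.sub_ap, Sm.smul_ap, Sm.mul_ap, xco_ap]
  rw [eYS, eTS, e1, e2]
  simp only [tl_ap, YS, EX, eYS, eTS]; ring

lemma tl_Ai (G : Sg n → ℂ) (h : SH G) (m : ℕ) : (AO ^ m : Op n) (tl G h) = tl ((DA n)^[m] G) (h.DAi m) := by
  induction m with
  | zero => rfl
  | succ m ih =>
    rw [pow_succ', Module.End.mul_apply, ih, tl_A]
    apply Sm.ext; intro p
    simp only [tl_ap, Function.iterate_succ_apply']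

lemma tl_eq {α : ℝ} (G : Sg n → ℂ) (h : SH G) (hG : ∀ p : Sg n, 0 < p.2 → Lalpha n α G p = 0) : EqD α (-(α * n)) (tl G h) := by
  apply Sm.ext; intro p
  have := hG (EX p) (EX_pos p)
  rw [SQ_ap, De_ap, tl_A, tl_A, tl_T, tl_T]
  simp only [tl_X, tl_Y, MA, mu_ap, Sm.add_ap, Sm.smul_ap, Sm.mul_ap, Sm.sum_ap, ea_ap, tl_ap, Sm.zero_ap]
  rw [Lalpha, LS0] at this
  have hp : ((EX p).2 : ℂ) ≠ 0 := by exact_mod_cast (EX_pos p).ne'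
  have e : ((Real.exp (1 * p.2) : ℝ) : ℂ) = ((EX p).2 : ℂ) := by simp [EX]
  rw [e]
  apply mul_left_cancel₀ hp
  rw [mul_zero, ← this]
  push_cast; ring
end trans

/-! ### Part 14 : an ODE estimate -/
section ode

/-- the ODE -/
structure ODE (q : ℝ) (w w1 w2 h : ℝ → ℂ) : Prop where
  d1 : ∀ a, 0 < a → HasDerivAt w (w1 a) a
  d2 : ∀ a, 0 < a → HasDerivAt w1 (w2 a) a
  eq : ∀ a : ℝ, 0 < a → (a : ℂ) * w2 a + (q : ℂ) * w1 a = h a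

lemma ode_loc {q : ℝ} {w w1 w2 h : ℝ → ℂ} (H : ODE q w w1 w2 h) {a l W K : ℝ} (ha : 0 < a) (hl : 0 < l)
    (hla : l * (4 * (|q| + 1)) ≤ a) (hw : ∀ s ∈ Icc a (a + l), ‖w s‖ ≤ W) (hh : ∀ s ∈ Icc a (a + l), ‖h s‖ ≤ K) :
    ‖w1 a‖ ≤ 3 * W / l + 3 * l * K / a := by
  have hc : ContinuousOn (fun s => ‖w1 s‖) (Icc a (a + l)) := fun s hs =>
    ((H.d2 s (ha.trans_le hs.1)).continuousAt.norm).continuousWithinAt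
  obtain ⟨b, hb, hmax⟩ := isCompact_Icc.exists_isMaxOn (nonempty_Icc.2 (by linarith)) hc
  set D := ‖w1 b‖ with hD
  have hm : ∀ s ∈ Icc a (a + l), ‖w1 s‖ ≤ D := fun s hs => hmax hs
  have hal : a ∈ Icc a (a + l) := ⟨le_rfl, by linarith⟩
  have hbl : a + l ∈ Icc a (a + l) := ⟨by linarith, le_rfl⟩
  have hK : 0 ≤ K := (norm_nonneg _).trans (hh a hal)
  have hW : 0 ≤ W := (norm_nonneg _).trans (hw a hal)
  have hD0 : 0 ≤ D := norm_nonneg _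
  have h2 : ∀ s ∈ Icc a (a + l), ‖w2 s‖ ≤ (K + |q| * D) / a := by
    intro s hs
    have hs0 := ha.trans_le hs.1
    rw [le_div_iff₀ ha]
    have e : (s : ℂ) * w2 s = h s - (q : ℂ) * w1 s := by rw [← H.eq s hs0]; ring
    have : s * ‖w2 s‖ ≤ K + |q| * D := by
      calc s * ‖w2 s‖ = ‖(s : ℂ) * w2 s‖ := by rw [norm_mul, Complex.norm_real, Real.norm_of_nonneg hs0.le]
        _ ≤ ‖h s‖ + ‖(q : ℂ) * w1 s‖ := by rw [e]; exact norm_sub_le _ _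
        _ ≤ _ := by
          rw [norm_mul, Complex.norm_real, Real.norm_eq_abs]
          exact add_le_add (hh s hs) (mul_le_mul_of_nonneg_left (hm s hs) (abs_nonneg _))
    calc ‖w2 s‖ * a ≤ ‖w2 s‖ * s := mul_le_mul_of_nonneg_left hs.1 (norm_nonneg _)
      _ ≤ _ := by linarith
  set M := (K + |q| * D) / a with hM
  have hM0 : 0 ≤ M := by positivity
  have h3 : ∀ s ∈ Icc a (a + l), ‖w1 s - w1 b‖ ≤ M * l := by
    intro s hs
    have := (convex_Icc a (a + l)).norm_image_sub_le_of_norm_hasDerivWithin_le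
      (fun x hx => (H.d2 x (ha.trans_le hx.1)).hasDerivWithinAt) h2 hb hs
    refine this.trans (mul_le_mul_of_nonneg_left ?_ hM0)
    rw [Real.norm_eq_abs, abs_le]; constructor <;> linarith [hs.1, hs.2, hb.1, hb.2]
  have h4 := (convex_Icc a (a + l)).norm_image_sub_le_of_norm_hasDerivWithin_le (f := fun s : ℝ => w s - (s : ℂ) * w1 b)
      (f' := fun s => w1 s - w1 b)
      (fun x hx => by
        have d := (H.d1 x (ha.trans_le hx.1)).sub (((hasDerivAt_id x).ofReal_comp).mul_const (w1 b))
        have := d.hasDerivWithinAt (s := Icc a (a + l))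
        simp only [id, Complex.ofReal_one, one_mul] at this
        exact this) h3 hal hbl
  have e5 : (w (a + l) - ((a + l : ℝ) : ℂ) * w1 b - (w a - (a : ℂ) * w1 b)) = (w (a + l) - w a) - (l : ℂ) * w1 b := by
    push_cast; ring
  rw [e5] at h4
  have h6 : l * D ≤ 2 * W + M * l * l := by
    have t : ‖(l : ℂ) * w1 b‖ ≤ ‖w (a + l) - w a‖ + ‖(w (a + l) - w a) - (l : ℂ) * w1 b‖ := by
      have := norm_sub_le (w (a + l) - w a) ((w (a + l) - w a) - (l : ℂ) * w1 b)
      simpa using this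
    rw [norm_mul, Complex.norm_real, Real.norm_of_nonneg hl.le] at t
    have t2 := norm_sub_le (w (a + l)) (w a)
    have e : ‖a + l - a‖ = l := by simp [abs_of_pos hl]
    rw [e] at h4
    linarith [hw _ hal, hw _ hbl]
  have h7 : M * l * l ≤ l * (l * K / a) + l * D / 4 := by
    have e : M * l * l = l * (l * K / a) + l * D * (l * |q| / a) := by rw [hM]; field_simp
    have : l * |q| / a ≤ 1 / 4 := by
      rw [div_le_iff₀ ha]; nlinarith [abs_nonneg q]
    rw [e]
    nlinarith [mul_le_mul_of_nonneg_left this (mul_nonneg hl.le hD0)]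
  have h8 : D ≤ 3 * W / l + 3 * l * K / a := by
    have e : 3 * W / l + 3 * l * K / a = (3 * W + 3 * l * (l * K / a)) / l := by field_simp
    rw [e, le_div_iff₀ hl]
    have : 0 ≤ l * (l * K / a) := by positivity
    nlinarith
  exact (hm a hal).trans h8

/-- weight -/
def gw (d a : ℝ) : ℝ := 1 + a ^ (-d)
lemma gw_pos {d a : ℝ} (ha : 0 < a) : 0 < gw d a := by unfold gw; have := Real.rpow_pos_of_pos ha (-d); linarith
lemma gw_anti {d a b : ℝ} (hd : 0 ≤ d) (ha : 0 < a) (hab : a ≤ b) : gw d b ≤ gw d a := by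
  unfold gw
  have := Real.rpow_le_rpow_of_nonpos ha hab (z := -d) (by linarith)
  linarith
lemma one_le_rp {d a : ℝ} (hd : 0 ≤ d) (ha : 0 < a) (h1 : a ≤ 1) : 1 ≤ a ^ (-d) :=
  Real.one_le_rpow_of_pos_of_le_one_of_nonpos ha h1 (by linarith)

lemma ode_psi {q d C : ℝ} {w w1 w2 h : ℝ → ℂ} (H : ODE q w w1 w2 h) (hr : q - d ≠ 0)
    (hh : ∀ a, 0 < a → a ≤ 1 → ‖h a‖ ≤ C * a ^ (-d)) {a b : ℝ} (ha : 0 < a) (hab : a ≤ b) (hb : b ≤ 1) :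
    ‖((b ^ q : ℝ) : ℂ) * w1 b - ((a ^ q : ℝ) : ℂ) * w1 a‖ ≤ C * (b ^ (q - d) - a ^ (q - d)) / (q - d) := by
  have D : ∀ x, 0 < x → HasDerivAt (fun x : ℝ => ((x ^ q : ℝ) : ℂ) * w1 x - ((a ^ q : ℝ) : ℂ) * w1 a) (((x ^ (q - 1) : ℝ) : ℂ) * h x) x := by
    intro x hx
    have d1 := ((Real.hasDerivAt_rpow_const (p := q) (Or.inl hx.ne')).ofReal_comp.mul (H.d2 x hx)).sub_const (((a ^ q : ℝ) : ℂ) * w1 a)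
    refine d1.congr_deriv ?_
    rw [← H.eq x hx]
    have : x ^ q = x ^ (q - 1) * x := by
      rw [← Real.rpow_add_one hx.ne']; congr 1; ring
    rw [this]; push_cast; ring
  have B : ∀ x, 0 < x → HasDerivAt (fun x : ℝ => C * (x ^ (q - d) - a ^ (q - d)) / (q - d)) (C * x ^ (q - d - 1)) x := by
    intro x hx
    have := (((Real.hasDerivAt_rpow_const (p := q - d) (Or.inl hx.ne')).sub_const (a ^ (q - d))).const_mul C).div_const (q - d)
    refine this.congr_deriv ?_
    field_simp
  exact image_norm_le_of_norm_deriv_right_le_deriv_boundary' (a := a) (b := b)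
    (f := fun x : ℝ => ((x ^ q : ℝ) : ℂ) * w1 x - ((a ^ q : ℝ) : ℂ) * w1 a)
    (fun x hx => (D x (ha.trans_le hx.1)).continuousAt.continuousWithinAt)
    (fun x hx => (D x (ha.trans_le hx.1)).hasDerivWithinAt) (by simp)
    (fun x hx => (B x (ha.trans_le hx.1)).continuousAt.continuousWithinAt)
    (fun x hx => (B x (ha.trans_le hx.1)).hasDerivWithinAt) (fun x hx => by
      have hx0 := ha.trans_le hx.1
      rw [norm_mul, Complex.norm_real, Real.norm_of_nonneg (Real.rpow_nonneg hx0.le _)]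
      have := mul_le_mul_of_nonneg_left (hh x hx0 (hx.2.le.trans hb)) (Real.rpow_nonneg hx0.le (q - 1))
      refine this.trans (le_of_eq ?_)
      have e : x ^ (q - d - 1) = x ^ (q - 1) * x ^ (-d) := by rw [← Real.rpow_add hx0]; congr 1; ring
      rw [e]; ring) ⟨hab, le_rfl⟩

lemma ode_main {q d C : ℝ} (hd : 0 < d) (hr : q - d ≠ 0) :
    ∃ C', 0 ≤ C' ∧ ∀ w w1 w2 h : ℝ → ℂ, ODE q w w1 w2 h → (∀ a, 0 < a → ‖w a‖ ≤ C * gw d a) →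
      (∀ a, 0 < a → ‖h a‖ ≤ C * (1 + a) * gw d a) →
      (q < d ∨ 1 + d < q ∨ (d < q ∧ ∃ M, ∀ a, 0 < a → a ≤ 1 → ‖w1 a‖ ≤ M)) → ∀ a, 0 < a → ‖w1 a‖ ≤ C' * gw d a := by
  by_cases hC : C < 0
  · refine ⟨0, le_rfl, fun w w1 w2 h _ hw => ?_⟩
    have := (norm_nonneg _).trans (hw 1 one_pos)
    have := gw_pos (d := d) one_pos
    nlinarith
  push_neg at hC
  set τ := 1 / (4 * (|q| + 1)) with hτ
  have hτ0 : 0 < τ := by positivity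
  have hτ1 : τ * (4 * (|q| + 1)) = 1 := by rw [hτ]; field_simp
  have hτ2 : τ ≤ 1 := by nlinarith [abs_nonneg q]
  set C1 := 3 * C / τ + 9 * τ * C with hC1
  have hC1' : 0 ≤ C1 := by positivity
  refine ⟨2 * C1 + 4 * C / |q - d|, by positivity, fun w w1 w2 h H hw hh hcase => ?_⟩
  have big : ∀ a, 1 ≤ a → ‖w1 a‖ ≤ C1 * gw d a := by
    intro a ha
    have ha0 : 0 < a := by linarith
    have := ode_loc H (l := τ) (W := C * gw d a) (K := C * (3 * a) * gw d a) ha0 hτ0 (by rw [hτ1]; exact ha)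
      (fun s hs => (hw s (ha0.trans_le hs.1)).trans (mul_le_mul_of_nonneg_left (gw_anti hd.le ha0 hs.1) hC))
      (fun s hs => (hh s (ha0.trans_le hs.1)).trans (by
        have g := gw_anti hd.le ha0 hs.1
        have g0 := gw_pos (d := d) (ha0.trans_le hs.1)
        have : C * (1 + s) ≤ C * (3 * a) := mul_le_mul_of_nonneg_left (by linarith [hs.2]) hC
        exact mul_le_mul this g g0.le (by positivity)))
    refine this.trans (le_of_eq ?_)
    rw [hC1]; field_simp
    ring
  have hh' : ∀ a, 0 < a → a ≤ 1 → ‖h a‖ ≤ (4 * C) * a ^ (-d) := by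
    intro a ha h1
    refine (hh a ha).trans ?_
    have := one_le_rp hd.le ha h1
    unfold gw
    have h1 : C * (1 + a) ≤ C * 2 := mul_le_mul_of_nonneg_left (by linarith) hC
    have h2 : (1 + a ^ (-d)) ≤ 2 * a ^ (-d) := by linarith
    calc C * (1 + a) * (1 + a ^ (-d)) ≤ (C * 2) * (2 * a ^ (-d)) := mul_le_mul h1 h2 (by linarith) (by linarith)
      _ = _ := by ring
  have w11 : ‖w1 1‖ ≤ 2 * C1 := by
    have := big 1 le_rfl
    rw [gw, Real.one_rpow] at this; linarith
  intro a ha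
  rcases le_total 1 a with h1 | h1
  · refine (big a h1).trans (mul_le_mul_of_nonneg_right ?_ (gw_pos ha).le)
    have : 0 ≤ 4 * C / |q - d| := by positivity
    linarith
  -- small a
  suffices hs : ‖w1 a‖ ≤ (2 * C1 + 4 * C / |q - d|) * a ^ (-d) by
    refine hs.trans (mul_le_mul_of_nonneg_left ?_ (by positivity))
    unfold gw; linarith
  have n1 : ∀ b, 0 < b → ‖((b ^ q : ℝ) : ℂ) * w1 b‖ = b ^ q * ‖w1 b‖ := by
    intro b hb
    rw [norm_mul, Complex.norm_real, Real.norm_of_nonneg (Real.rpow_nonneg hb.le _)]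
  have n2 : ‖w1 a‖ = a ^ (-q) * ‖((a ^ q : ℝ) : ℂ) * w1 a‖ := by
    rw [n1 a ha, ← mul_assoc, ← Real.rpow_add ha]; simp
  have n3 : a ^ (-q) * a ^ (q - d) = a ^ (-d) := by rw [← Real.rpow_add ha]; congr 1; ring
  have aq : 0 < a ^ (-q) := Real.rpow_pos_of_pos ha _
  have ad : 0 < a ^ (-d) := Real.rpow_pos_of_pos ha _
  have ar : 0 < a ^ (q - d) := Real.rpow_pos_of_pos ha _
  by_cases hqd : q < d
  · have := ode_psi H hr hh' ha h1 le_rfl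
    have e : 4 * C * ((1 : ℝ) ^ (q - d) - a ^ (q - d)) / (q - d) ≤ 4 * C / |q - d| * a ^ (q - d) := by
      rw [abs_of_neg (by linarith), Real.one_rpow]
      have hn : 0 < -(q - d) := by linarith
      have e1 : 4 * C * (1 - a ^ (q - d)) / (q - d) = 4 * C / (-(q - d)) * (a ^ (q - d) - 1) := by
        field_simp; ring
      rw [e1]
      exact mul_le_mul_of_nonneg_left (by linarith) (by positivity)
    have t := this.trans e
    have t2 : ‖((a ^ q : ℝ) : ℂ) * w1 a‖ ≤ 2 * C1 + 4 * C / |q - d| * a ^ (q - d) := by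
      have := norm_sub_norm_le (((a ^ q : ℝ) : ℂ) * w1 a) (((1 ^ q : ℝ) : ℂ) * w1 1)
      rw [norm_sub_rev] at this
      have e2 : ‖((1 ^ q : ℝ) : ℂ) * w1 1‖ = ‖w1 1‖ := by simp
      rw [e2] at this
      linarith
    rw [n2]
    have t3 := mul_le_mul_of_nonneg_left t2 aq.le
    have t4 : a ^ (-q) ≤ a ^ (-d) := Real.rpow_le_rpow_of_exponent_ge ha h1 (by linarith)
    have t5 : a ^ (-q) * (2 * C1) ≤ a ^ (-d) * (2 * C1) := mul_le_mul_of_nonneg_right t4 (by positivity)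
    have t6 : a ^ (-q) * (4 * C / |q - d| * a ^ (q - d)) = 4 * C / |q - d| * a ^ (-d) := by rw [← n3]; ring
    rw [mul_add, t6] at t3
    nlinarith
  · have hqd' : d < q := lt_of_le_of_ne (not_lt.1 hqd) (fun h => hr (by linarith))
    have hlim : Tendsto (fun e : ℝ => ‖((e ^ q : ℝ) : ℂ) * w1 e‖) (𝓝[>] 0) (𝓝 0) := by
      have rp0 : ∀ r : ℝ, 0 < r → Tendsto (fun e : ℝ => e ^ r) (𝓝[>] 0) (𝓝 0) := by
        intro r hr
        have := (Real.continuousAt_rpow_const (0 : ℝ) r (Or.inr hr.le)).tendsto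
        rw [Real.zero_rpow hr.ne'] at this
        exact this.mono_left nhdsWithin_le_nhds
      have ev : ∀ᶠ e : ℝ in 𝓝[>] 0, 0 < e ∧ e ≤ 1 := by
        have : Ioc (0 : ℝ) 1 ∈ 𝓝[>] (0 : ℝ) := Ioc_mem_nhdsGT one_pos
        filter_upwards [this] with e he using ⟨he.1, he.2⟩
      rcases hcase with hc | hc | ⟨_, M, hM⟩
      · exact absurd hc hqd
      · have lim := (rp0 (q - 1 - d) (by linarith)).const_mul (6 * C / τ + 18 * τ * C)
        rw [mul_zero] at lim
        refine squeeze_zero' (Eventually.of_forall fun _ => norm_nonneg _) ?_ lim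
        filter_upwards [ev] with e he
        obtain ⟨he, he1⟩ := he
        have := ode_loc H (l := τ * e) (W := C * (2 * e ^ (-d))) (K := C * (1 + 2 * e) * (2 * e ^ (-d))) he (by positivity)
          (by rw [mul_right_comm, hτ1, one_mul])
          (fun s hs => (hw s (he.trans_le hs.1)).trans (by
            refine mul_le_mul_of_nonneg_left ((gw_anti hd.le he hs.1).trans ?_) hC
            unfold gw; linarith [one_le_rp hd.le he he1]))
          (fun s hs => (hh s (he.trans_le hs.1)).trans (by
            have g := gw_anti hd.le he hs.1
            have g0 := gw_pos (d := d) (he.trans_le hs.1)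
            have g2 : gw d e ≤ 2 * e ^ (-d) := by unfold gw; linarith [one_le_rp hd.le he he1]
            have : C * (1 + s) ≤ C * (1 + 2 * e) := mul_le_mul_of_nonneg_left (by nlinarith [hs.2]) hC
            exact mul_le_mul this (g.trans g2) g0.le (by positivity)))
        rw [n1 e he]
        have eq0 : 0 < e ^ q := Real.rpow_pos_of_pos he _
        have ed : 0 < e ^ (-d) := Real.rpow_pos_of_pos he _
        have t := mul_le_mul_of_nonneg_left this eq0.le
        refine t.trans ?_
        have x1 : e ^ (q - 1 - d) * e = e ^ q * e ^ (-d) := by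
          rw [← Real.rpow_add_one he.ne', ← Real.rpow_add he]; congr 1; ring
        have x2 : e ^ (q - 1 - d) = e ^ q * e ^ (-d) / e := by rw [← x1]; field_simp
        have x3 : e ^ q * (3 * (C * (2 * e ^ (-d))) / (τ * e) + 3 * (τ * e) * (C * (1 + 2 * e) * (2 * e ^ (-d))) / e)
          = (6 * C / τ + 6 * τ * C * (e + 2 * e ^ 2)) * (e ^ q * e ^ (-d) / e) := by
          field_simp
          ring
        rw [x3, ← x2]
        have x0 : 0 < e ^ (q - 1 - d) := Real.rpow_pos_of_pos he _
        have b0 : e + 2 * e ^ 2 ≤ 3 := by nlinarith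
        refine mul_le_mul_of_nonneg_right ?_ x0.le
        have : 6 * τ * C * (e + 2 * e ^ 2) ≤ 6 * τ * C * 3 := mul_le_mul_of_nonneg_left b0 (by positivity)
        have : 0 ≤ τ * C := by positivity
        linarith
      · have lim := (rp0 q (by linarith)).mul_const M
        rw [zero_mul] at lim
        refine squeeze_zero' (Eventually.of_forall fun _ => norm_nonneg _) ?_ lim
        filter_upwards [ev] with e he
        rw [n1 e he.1]
        exact mul_le_mul_of_nonneg_left (hM e he.1 he.2) (Real.rpow_nonneg he.1.le _)
    have t : ‖((a ^ q : ℝ) : ℂ) * w1 a‖ ≤ 4 * C / |q - d| * a ^ (q - d) := by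
      have hle : ∀ᶠ e : ℝ in 𝓝[>] 0, ‖((a ^ q : ℝ) : ℂ) * w1 a‖ - 4 * C / |q - d| * a ^ (q - d) ≤ ‖((e ^ q : ℝ) : ℂ) * w1 e‖ := by
        have : Ioc (0 : ℝ) a ∈ 𝓝[>] (0 : ℝ) := Ioc_mem_nhdsGT ha
        filter_upwards [this] with e he
        have p := ode_psi H hr hh' he.1 he.2 h1
        have p2 := norm_sub_norm_le (((a ^ q : ℝ) : ℂ) * w1 a) (((e ^ q : ℝ) : ℂ) * w1 e)
        have p3 : 4 * C * (a ^ (q - d) - e ^ (q - d)) / (q - d) ≤ 4 * C / |q - d| * a ^ (q - d) := by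
          have hp : 0 < q - d := by linarith
          rw [abs_of_pos hp]
          have e1 : 4 * C * (a ^ (q - d) - e ^ (q - d)) / (q - d) = 4 * C / (q - d) * (a ^ (q - d) - e ^ (q - d)) := by ring
          rw [e1]
          refine mul_le_mul_of_nonneg_left ?_ (by positivity)
          linarith [Real.rpow_nonneg he.1.le (q - d)]
        linarith
      have := ge_of_tendsto hlim hle
      linarith
    rw [n2]
    have t3 := mul_le_mul_of_nonneg_left t aq.le
    have t6 : a ^ (-q) * (4 * C / |q - d| * a ^ (q - d)) = 4 * C / |q - d| * a ^ (-d) := by rw [← n3]; ring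
    rw [t6] at t3
    nlinarith
end ode

/-! ### Part 15 : bounds for smoothed solutions -/
section sbound
variable {n : ℕ}

/-- admissible test functions -/
structure Ph (φ : Sm n) : Prop where
  cs : CSx φ
  da : dv (eA n) φ = 0

lemma dA_mu {g φ : Sm n} (hg : dv (eA n) g = 0) (h : dv (eA n) φ = 0) : dv (eA n) (mu g φ) = 0 := by
  rw [mu_ap, dv_mul, hg, h]; simp
lemma dA_y (j : Fin n) : dv (eA n) (yco j) = 0 := by rw [dv_yco']; simp [eA]
lemma dA_x (j : Fin n) : dv (eA n) (xco j) = 0 := by rw [dv_xco']; simp [eA]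
lemma dA_dv {φ : Sm n} (h : dv (eA n) φ = 0) (v : Sg n) : dv (eA n) (dv v φ) = 0 := by
  rw [ap_comm (dv_comm _ _), h, map_zero]

lemma Ph.XR {φ : Sm n} (h : Ph φ) (j : Fin n) : Ph (XR j φ) := by
  refine ⟨h.cs.XR j, ?_⟩
  simp only [_root_.XR, LinearMap.sub_apply, LinearMap.smul_apply, Module.End.mul_apply, map_sub, map_smul]
  rw [dA_dv h.da, dA_mu (dA_y j) (dA_dv h.da _)]; simp
lemma Ph.YR {φ : Sm n} (h : Ph φ) (j : Fin n) : Ph (YR j φ) := by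
  refine ⟨h.cs.YR j, ?_⟩
  simp only [_root_.YR, LinearMap.add_apply, LinearMap.smul_apply, Module.End.mul_apply, map_add, map_smul]
  rw [dA_dv h.da, dA_mu (dA_x j) (dA_dv h.da _)]; simp
lemma Ph.TO {φ : Sm n} (h : Ph φ) : Ph (TO φ) := ⟨h.cs.TO, dA_dv h.da _⟩
lemma Ph.SQ {φ : Sm n} (h : Ph φ) : Ph (SQ n φ) := by
  refine ⟨h.cs.SQ, ?_⟩
  have hx : ∀ j : Fin n, ∀ ψ : Sm n, dv (eA n) ψ = 0 → dv (eA n) (_root_.XO j ψ) = 0 := fun j ψ hψ => by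
    simp only [_root_.XO, LinearMap.add_apply, LinearMap.smul_apply, Module.End.mul_apply, map_add, map_smul]
    rw [dA_dv hψ, dA_mu (dA_y j) (dA_dv hψ _)]; simp
  have hy : ∀ j : Fin n, ∀ ψ : Sm n, dv (eA n) ψ = 0 → dv (eA n) (_root_.YO j ψ) = 0 := fun j ψ hψ => by
    simp only [_root_.YO, LinearMap.sub_apply, LinearMap.smul_apply, Module.End.mul_apply, map_sub, map_smul]
    rw [dA_dv hψ, dA_mu (dA_x j) (dA_dv hψ _)]; simp
  rw [SQ_ap, map_sum]
  refine Finset.sum_eq_zero fun j _ => ?_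
  rw [map_add, hx j _ (hx j _ h.da), hy j _ (hy j _ h.da), add_zero]

lemma Ph.const {φ : Sm n} (h : Ph φ) (x : Hn n) (s : ℝ) : φ (x, s) = φ (x, 0) := by
  have D : ∀ s, HasDerivAt (fun s : ℝ => φ (x, s)) 0 s := fun s => by
    have l : HasDerivAt (fun s : ℝ => ((x, s) : Sg n)) (eA n) s := (hasDerivAt_const s x).prodMk (hasDerivAt_id s)
    have := ((φ.diff (x, s)).hasFDerivAt.comp_hasDerivAt s l)
    have e : fderiv ℝ φ.fn (x, s) (eA n) = 0 := by
      have := dv_ap (eA n) φ (x, s); rw [h.da] at this; simpa using this.symm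
    rw [e] at this; exact this
  exact is_const_of_deriv_eq_zero (fun s => (D s).differentiableAt) (fun s => (D s).deriv) s 0

lemma UU_bd {V φ : Sm n} (h : Ph φ) {C : ℝ} (hV : ∀ p, ‖V p‖ ≤ C) : ∀ p, ‖UU V φ h.cs p‖ ≤ C * ∫ w, ‖φ (w, 0)‖ := by
  intro p
  have e : ∫ w, ‖φ (w, 0)‖ = ∫ w, ‖φ (gm p.1 w, 0)‖ := by
    have m := gm_mp (n := n) p.1
    rw [← integral_map (φ := gm p.1) (f := fun w => ‖φ (w, 0)‖) m.aemeasurable, m.map_eq]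
    have : Continuous (fun w : Hn n => ‖φ (w, 0)‖) := (φ.cont.comp (by fun_prop)).norm
    exact this.aestronglyMeasurable
  have i : Integrable (fun w => ‖φ (gm p.1 w, 0)‖) := by
    have := (Kf_int (1 : Sm n) h.cs p).norm
    simp only [h.const _ p.2] at this
    simpa using this
  rw [UU_ap, e, ← integral_const_mul]
  refine (norm_integral_le_of_norm_le (i.const_mul C) (Eventually.of_forall fun w => ?_))
  rw [norm_mul, h.const]
  exact mul_le_mul_of_nonneg_right (hV _) (norm_nonneg _)

lemma AM_pow (m : ℕ) (f : Sm n) : (AO ^ m : Op n) (MA f) = MA ((AO ^ m : Op n) f) + (m : ℂ) • (AO ^ (m - 1) : Op n) f := by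
  induction m with
  | zero => simp
  | succ m ih =>
    rw [pow_succ', Module.End.mul_apply, ih, map_add, map_smul, ← Module.End.mul_apply, A_M, LinearMap.add_apply, Module.End.one_apply,
      Module.End.mul_apply, Module.End.mul_apply, ← Module.End.mul_apply AO (AO ^ (m - 1)), ← pow_succ']
    rcases m with _ | m
    · simp
    · simp only [Nat.add_sub_cancel]
      push_cast; module

lemma EqD.Ap {α c : ℝ} {V : Sm n} (h : EqD α c V) (m : ℕ) :
    MA ((AO ^ (m + 2) : Op n) V) + ((m + c : ℝ) : ℂ) • (AO ^ (m + 1) : Op n) V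
     = -(((α / 4 : ℝ) : ℂ) • SQ n ((AO ^ m : Op n) V)) - MA (TO (TO ((AO ^ m : Op n) V))) - (m : ℂ) • TO (TO ((AO ^ (m - 1) : Op n) V)) := by
  have := congrArg (AO ^ m : Op n) h
  have cT : ∀ (j : ℕ) (f : Sm n), (AO ^ j : Op n) (TO f) = TO ((AO ^ j : Op n) f) := fun j f => ap_comm ((cTA.symm.pow_left j).eq) f
  have cS : (AO ^ m : Op n) (SQ n V) = SQ n ((AO ^ m : Op n) V) := ap_comm ((cSA.symm.pow_left m).eq) V
  have e0 : ∀ (j : ℕ) (f : Sm n), (AO ^ j : Op n) (AO f) = (AO ^ (j + 1) : Op n) f := fun j f => by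
    rw [pow_succ, Module.End.mul_apply]
  rw [map_zero, map_add, map_add, map_smul, map_smul, AM_pow, De_ap] at this
  simp only [map_add, cT, cS, e0] at this
  rcases m with _ | m
  · simp only [Nat.cast_zero, zero_smul, add_zero, sub_zero] at this ⊢
    have e : (AO ^ (0 + 1 + 1) : Op n) V = (AO ^ (0 + 2) : Op n) V := rfl
    rw [e] at this
    rw [← sub_eq_zero, ← this]
    push_cast; module
  · simp only [Nat.add_sub_cancel] at this ⊢
    have e : (AO ^ (m + 1 + 1 + 1) : Op n) V = (AO ^ (m + 1 + 2) : Op n) V := rfl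
    rw [e] at this
    rw [← sub_eq_zero, ← this]
    push_cast; module

/-- the function of the height -/
def fp (V φ : Sm n) (h : Ph φ) (m : ℕ) (x : Hn n) (a : ℝ) : ℂ := UU ((AO ^ m : Op n) V) φ h.cs (x, Real.log a)

lemma fp_d (V φ : Sm n) (h : Ph φ) (m : ℕ) (x : Hn n) {a : ℝ} (ha : 0 < a) :
    HasDerivAt (fp V φ h m x) (fp V φ h (m + 1) x a) a := by
  have l : HasDerivAt (fun a : ℝ => ((x, Real.log a) : Sg n)) ((0, a⁻¹) : Sg n) a := (hasDerivAt_const a x).prodMk (Real.hasDerivAt_log ha.ne')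
  have := (((UU ((AO ^ m : Op n) V) φ h.cs).diff (x, Real.log a)).hasFDerivAt.comp_hasDerivAt a l)
  refine this.congr_deriv ?_
  have e : ((0, a⁻¹) : Sg n) = a⁻¹ • eA n := by simp [eA]
  rw [e, map_smul]
  have e2 := congrArg (fun f : Sm n => f (x, Real.log a)) (A_UU ((AO ^ m : Op n) V) φ h.cs h.da)
  rw [fp, pow_succ', Module.End.mul_apply]
  refine Eq.trans ?_ e2
  rw [AO, Module.End.mul_apply, mu_ap, Sm.mul_ap, ea_ap, dv_ap]
  simp only [Complex.real_smul]
  rw [neg_one_mul, Real.exp_neg, Real.exp_log ha]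

lemma fp_eq {α c : ℝ} {V : Sm n} (hE : EqD α c V) (φ : Sm n) (h : Ph φ) (m : ℕ) (x : Hn n) {a : ℝ} (ha : 0 < a) :
    (a : ℂ) * fp V φ h (m + 2) x a + ((m + c : ℝ) : ℂ) * fp V φ h (m + 1) x a
     = -(((α / 4 : ℝ) : ℂ) * fp V _ h.SQ m x a) - a * fp V _ h.TO.TO m x a - m * fp V _ h.TO.TO (m - 1) x a := by
  have k := congrArg (fun f : Sm n => UU f φ h.cs (x, Real.log a)) (hE.Ap m)
  have em : ∀ f : Sm n, (MA f) (x, Real.log a) = a * f (x, Real.log a) := fun f => by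
    simp [MA, ea_ap, Complex.ofReal_log, Real.exp_log ha, ← Complex.ofReal_exp]
  rw [sub_eq_add_neg, sub_eq_add_neg, ← neg_one_smul ℂ (_ • SQ n _), ← neg_one_smul ℂ (MA _), ← neg_one_smul ℂ ((m : ℂ) • _)] at k
  simp only [UU_add_left, UU_smul_left, ← MA_UU, SQ_ibp, TT_ibp, Sm.add_ap, Sm.smul_ap, em] at k
  simp only [fp]
  rw [k]; ring

variable {α : ℝ} {k : ℕ}

lemma fp_bd {V : Sm n} (hV : ∃ C, ∀ p, ‖V p‖ ≤ C) (hα : 0 < α) (hE : EqD α (-(α * n)) V) (hk : α * n < k) (hk2 : (k : ℝ) ≤ α * n + 1)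
    (hR : ∀ φ : Sm n, ∀ h : Ph φ, ∀ x, ∃ M, ∀ a, 0 < a → a ≤ 1 → ‖fp V φ h (k + 1) x a‖ ≤ M) (m : ℕ) :
    ∀ φ : Sm n, ∀ h : Ph φ, ∃ C, 0 ≤ C ∧ ∀ x a, 0 < a → ‖fp V φ h m x a‖ ≤ C * gw ((k - α * n) / 2) a := by
  set d := (k - α * n) / 2 with hd
  have hd0 : 0 < d := by rw [hd]; linarith
  have hd1 : d ≤ 1 / 2 := by rw [hd]; linarith
  induction m using Nat.strong_induction_on with
  | _ m ih =>
  rcases m with _ | m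
  · intro φ h
    obtain ⟨C, hC⟩ := hV
    have hC0 : 0 ≤ C := (norm_nonneg _).trans (hC 0)
    have i0 : 0 ≤ ∫ w, ‖φ (w, 0)‖ := integral_nonneg fun _ => norm_nonneg _
    refine ⟨C * ∫ w, ‖φ (w, 0)‖, by positivity, fun x a ha => ?_⟩
    refine (UU_bd h hC (x, Real.log a)).trans ?_
    refine le_mul_of_one_le_right (by positivity) ?_
    unfold gw; linarith [Real.rpow_pos_of_pos ha (-d)]
  · intro φ h
    obtain ⟨C0, hC0, b0⟩ := ih m (by omega) φ h
    obtain ⟨C1, hC1, b1⟩ := ih m (by omega) _ h.SQ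
    obtain ⟨C2, hC2, b2⟩ := ih m (by omega) _ h.TO.TO
    obtain ⟨C3, hC3, b3⟩ := ih (m - 1) (by omega) _ h.TO.TO
    set C := C0 + α / 4 * C1 + C2 + m * C3 with hC
    have hkm : (m : ℝ) < k ∨ m = k ∨ (k : ℝ) + 1 ≤ m := by
      rcases lt_trichotomy m k with h | h | h
      · left; exact_mod_cast h
      · right; left; exact h
      · right; right; exact_mod_cast h
    have hm1 : (m : ℝ) < k → (m : ℝ) + 1 ≤ k := by
      intro h; exact_mod_cast (Nat.cast_lt.1 h)
    have hcase : ((m : ℝ) + -(α * n)) < d ∨ (m = k ∧ d < (m : ℝ) + -(α * n)) ∨ 1 + d < (m : ℝ) + -(α * n) := by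
      rcases hkm with h | h | h
      · left; have := hm1 h; linarith
      · right; left; refine ⟨h, ?_⟩; rw [h]; linarith
      · right; right; linarith
    have hr : ((m : ℝ) + -(α * n)) - d ≠ 0 := by
      rcases hcase with h | ⟨_, h⟩ | h
      · exact ne_of_lt (by linarith)
      · exact ne_of_gt (by linarith)
      · exact ne_of_gt (by linarith)
    obtain ⟨C', hC', key⟩ := ode_main (C := C) hd0 hr
    refine ⟨C', hC', fun x => ?_⟩
    refine key (fp V φ h m x) (fp V φ h (m + 1) x) (fp V φ h (m + 2) x)
      (fun a => (a : ℂ) * fp V φ h (m + 2) x a + ((m + -(α * n) : ℝ) : ℂ) * fp V φ h (m + 1) x a)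
      ⟨fun a ha => fp_d V φ h m x ha, fun a ha => fp_d V φ h (m + 1) x ha, fun a ha => rfl⟩ ?_ ?_ ?_
    · intro a ha
      refine (b0 x a ha).trans (mul_le_mul_of_nonneg_right ?_ (gw_pos ha).le)
      rw [hC]
      have : 0 ≤ α / 4 * C1 := by positivity
      have : 0 ≤ m * C3 := by positivity
      linarith
    · intro a ha
      rw [fp_eq hE φ h m x ha]
      have g0 := gw_pos (d := d) ha
      have t1 := norm_sub_le (-(((α / 4 : ℝ) : ℂ) * fp V _ h.SQ m x a) - a * fp V _ h.TO.TO m x a) (m * fp V _ h.TO.TO (m - 1) x a)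
      have t2 := norm_sub_le (-(((α / 4 : ℝ) : ℂ) * fp V _ h.SQ m x a)) (a * fp V _ h.TO.TO m x a)
      rw [norm_neg, norm_mul, norm_mul, Complex.norm_real, Complex.norm_real, Real.norm_of_nonneg (by positivity), Real.norm_of_nonneg ha.le] at t2
      rw [norm_mul (m : ℂ), Complex.norm_natCast] at t1
      have s1 : α / 4 * ‖fp V _ h.SQ m x a‖ ≤ α / 4 * (C1 * gw d a) := mul_le_mul_of_nonneg_left (b1 x a ha) (by positivity)
      have s2 : a * ‖fp V _ h.TO.TO m x a‖ ≤ a * (C2 * gw d a) := mul_le_mul_of_nonneg_left (b2 x a ha) ha.le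
      have s3 : m * ‖fp V _ h.TO.TO (m - 1) x a‖ ≤ m * (C3 * gw d a) := mul_le_mul_of_nonneg_left (b3 x a ha) (by positivity)
      have r : α / 4 * (C1 * gw d a) + a * (C2 * gw d a) + m * (C3 * gw d a) ≤ C * (1 + a) * gw d a := by
        have : α / 4 * C1 + a * C2 + m * C3 ≤ C * (1 + a) := by
          rw [hC]
          have : 0 ≤ α / 4 * C1 * a := by positivity
          have : 0 ≤ m * C3 * a := by positivity
          have : 0 ≤ C0 * a := by positivity
          linarith
        calc _ = (α / 4 * C1 + a * C2 + m * C3) * gw d a := by ring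
          _ ≤ _ := mul_le_mul_of_nonneg_right this g0.le
      linarith
    · rcases hcase with hc | ⟨hc1, hc2⟩ | hc
      · left; exact hc
      · right; right
        refine ⟨hc2, ?_⟩
        subst hc1
        exact hR φ h x
      · right; left; exact hc

lemma gw_le {d s : ℝ} (hd0 : 0 < d) (hd : d ≤ 1) : gw d (Real.exp s) ≤ 2 * (1 + Real.exp (-s)) := by
  unfold gw
  rw [← Real.exp_mul]
  have : Real.exp (s * -d) ≤ 1 + Real.exp (-s) := by
    rcases le_total 0 s with h | h
    · have : Real.exp (s * -d) ≤ 1 := Real.exp_le_one_iff.2 (by nlinarith)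
      linarith [Real.exp_pos (-s)]
    · have : Real.exp (s * -d) ≤ Real.exp (-s) := Real.exp_le_exp.2 (by nlinarith)
      linarith
  linarith [Real.exp_pos (-s)]

/-- span -/
def SpU (V : Sm n) : Submodule ℂ (Sm n) := Submodule.span ℂ {u | ∃ (m : ℕ) (φ : Sm n) (h : Ph φ), u = UU ((AO ^ m : Op n) V) φ h.cs}

lemma SpU_stab {V : Sm n} {P : Op n} (hP : ∀ (m : ℕ) (φ : Sm n) (h : Ph φ), P (UU ((AO ^ m : Op n) V) φ h.cs) ∈ SpU V) :
    ∀ u ∈ SpU V, P u ∈ SpU V := by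
  intro u hu
  refine Submodule.span_induction ?_ ?_ ?_ ?_ hu
  · rintro _ ⟨m, φ, h, rfl⟩; exact hP m φ h
  · simp
  · intro x y _ _ hx hy; rw [map_add]; exact add_mem hx hy
  · intro c x _ hx; rw [map_smul]; exact Submodule.smul_mem _ _ hx

lemma SpU_mem {V : Sm n} (m : ℕ) (φ : Sm n) (h : Ph φ) : UU ((AO ^ m : Op n) V) φ h.cs ∈ SpU V := Submodule.subset_span ⟨m, φ, h, rfl⟩

lemma SpU_DD {V : Sm n} {P : Op n} (hP : P ∈ DD n) : ∀ u ∈ SpU V, P u ∈ SpU V := by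
  refine Algebra.adjoin_induction (p := fun P _ => ∀ u ∈ SpU V, P u ∈ SpU V) ?_ ?_ ?_ ?_ hP
  · intro P hP
    apply SpU_stab
    intro m φ h
    rcases hP with (⟨j, rfl⟩ | ⟨j, rfl⟩) | hP
    · rw [X_UU]; exact Submodule.smul_mem _ _ (SpU_mem m _ (h.XR j))
    · rw [Y_UU]; exact Submodule.smul_mem _ _ (SpU_mem m _ (h.YR j))
    · rcases hP with rfl | hP
      · rw [T_UU]; exact Submodule.smul_mem _ _ (SpU_mem m _ h.TO)
      · rw [mem_singleton_iff] at hP; subst hP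
        rw [A_UU _ _ _ h.da, ← Module.End.mul_apply, ← pow_succ']
        exact SpU_mem (m + 1) _ h
  · intro c u hu
    rw [Module.algebraMap_end_apply]; exact Submodule.smul_mem _ _ hu
  · intro P Q _ _ hP hQ u hu
    exact add_mem (hP u hu) (hQ u hu)
  · intro P Q _ _ hP hQ u hu
    exact hP _ (hQ u hu)

lemma UU_good {V : Sm n} (hV : ∃ C, ∀ p, ‖V p‖ ≤ C) (hα : 0 < α) (hE : EqD α (-(α * n)) V) (hk : α * n < k) (hk2 : (k : ℝ) ≤ α * n + 1)
    (hR : ∀ φ : Sm n, ∀ h : Ph φ, ∀ x, ∃ M, ∀ a, 0 < a → a ≤ 1 → ‖fp V φ h (k + 1) x a‖ ≤ M)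
    {φ : Sm n} (h : Ph φ) : Good (UU V φ h.cs) := by
  intro P hP
  have hm := SpU_DD hP _ (SpU_mem (V := V) 0 φ h)
  refine Submodule.span_induction (p := fun u _ => ∃ C, 0 ≤ C ∧ ∀ p, ‖u.fn p‖ ≤ C * (1 + Real.exp (-p.2))) ?_ ?_ ?_ ?_ hm
  · rintro _ ⟨m, ψ, hψ, rfl⟩
    obtain ⟨C, hC, b⟩ := fp_bd hV hα hE hk hk2 hR m ψ hψ
    refine ⟨C * 2, by positivity, fun p => ?_⟩
    have := b p.1 (Real.exp p.2) (Real.exp_pos _)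
    rw [fp, Real.log_exp] at this
    refine this.trans ?_
    rw [mul_assoc]
    exact mul_le_mul_of_nonneg_left (gw_le (by linarith) (by linarith)) hC
  · exact ⟨0, le_rfl, fun p => by simp⟩
  · rintro x y _ _ ⟨C, hC, h⟩ ⟨D, hD, k⟩
    refine ⟨C + D, by positivity, fun p => ?_⟩
    rw [Sm.add_ap, add_mul]
    exact (norm_add_le _ _).trans (add_le_add (h p) (k p))
  · rintro c x _ ⟨C, hC, h⟩
    refine ⟨‖c‖ * C, by positivity, fun p => ?_⟩
    rw [Sm.smul_ap, norm_mul, mul_assoc]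
    exact mul_le_mul_of_nonneg_left (h p) (norm_nonneg _)
end sbound

/-! ### Part 16 : radial bumps -/
section bump
variable {n : ℕ}

lemma X2_ap (j : Fin n) (φ : Sm n) : XO j (XO j φ) = dv (eXS n j) (dv (eXS n j) φ) + 4 * (yco j * dv (eTS n) (dv (eXS n j) φ)) + 4 * (yco j * (yco j * dv (eTS n) (dv (eTS n) φ))) := by
  simp only [XO, LinearMap.add_apply, LinearMap.smul_apply, Module.End.mul_apply, mu_ap, map_add, map_smul, dv_mul, dv_yco']
  rw [ap_comm (dv_comm (eXS n j) (eTS n))]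
  simp [eXS, eTS, eX, eT, Algebra.smul_def]
  have h2 : algebraMap ℂ (Sm n) 2 = 2 := map_ofNat _ 2
  rw [h2]
  ring
lemma XR2_ap (j : Fin n) (φ : Sm n) : XR j (XR j φ) = dv (eXS n j) (dv (eXS n j) φ) - 4 * (yco j * dv (eTS n) (dv (eXS n j) φ)) + 4 * (yco j * (yco j * dv (eTS n) (dv (eTS n) φ))) := by
  simp only [XR, LinearMap.sub_apply, LinearMap.smul_apply, Module.End.mul_apply, mu_ap, map_sub, map_smul, dv_mul, dv_yco']
  rw [ap_comm (dv_comm (eXS n j) (eTS n))]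
  simp [eXS, eTS, eX, eT, Algebra.smul_def]
  have h2 : algebraMap ℂ (Sm n) 2 = 2 := map_ofNat _ 2
  rw [h2]
  ring
lemma Y2_ap (j : Fin n) (φ : Sm n) : YO j (YO j φ) = dv (eYS n j) (dv (eYS n j) φ) - 4 * (xco j * dv (eTS n) (dv (eYS n j) φ)) + 4 * (xco j * (xco j * dv (eTS n) (dv (eTS n) φ))) := by
  simp only [YO, LinearMap.sub_apply, LinearMap.smul_apply, Module.End.mul_apply, mu_ap, map_sub, map_smul, dv_mul, dv_xco']
  rw [ap_comm (dv_comm (eYS n j) (eTS n))]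
  simp [eYS, eTS, eY, eT, Algebra.smul_def]
  have h2 : algebraMap ℂ (Sm n) 2 = 2 := map_ofNat _ 2
  rw [h2]
  ring
lemma YR2_ap (j : Fin n) (φ : Sm n) : YR j (YR j φ) = dv (eYS n j) (dv (eYS n j) φ) + 4 * (xco j * dv (eTS n) (dv (eYS n j) φ)) + 4 * (xco j * (xco j * dv (eTS n) (dv (eTS n) φ))) := by
  simp only [YR, LinearMap.add_apply, LinearMap.smul_apply, Module.End.mul_apply, mu_ap, map_add, map_smul, dv_mul, dv_xco']
  rw [ap_comm (dv_comm (eYS n j) (eTS n))]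
  simp [eYS, eTS, eY, eT, Algebra.smul_def]
  have h2 : algebraMap ℂ (Sm n) 2 = 2 := map_ofNat _ 2
  rw [h2]
  ring

lemma rad_SQ {φ : Sm n} (h : ∀ j, yco j * dv (eXS n j) φ = xco j * dv (eYS n j) φ) :
    ∑ j, (XR j (XR j φ) + YR j (YR j φ)) = SQ n φ := by
  rw [SQ_ap]
  refine Finset.sum_congr rfl fun j _ => ?_
  rw [X2_ap, Y2_ap, XR2_ap, YR2_ap]
  have := congrArg (dv (eTS n)) (h j)
  rw [dv_mul, dv_mul, dv_yco', dv_xco'] at this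
  have z1 : ((eTS n).1.1 j).re = 0 := by simp [eTS, eT]
  have z2 : ((eTS n).1.1 j).im = 0 := by simp [eTS, eT]
  simp [z1, z2] at this
  linear_combination (-8) * this

/-- radius squared -/
def ro (p : Sg n) : ℝ := ∑ j, ((p.1.1 j).re ^ 2 + (p.1.1 j).im ^ 2) + p.1.2 ^ 2

lemma re_cd (j : Fin n) : ContDiff ℝ (⊤ : ℕ∞) (fun p : Sg n => (p.1.1 j).re) :=
  Complex.reCLM.contDiff.comp (by fun_prop)
lemma im_cd (j : Fin n) : ContDiff ℝ (⊤ : ℕ∞) (fun p : Sg n => (p.1.1 j).im) :=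
  Complex.imCLM.contDiff.comp (by fun_prop)

lemma ro_cd : ContDiff ℝ (⊤ : ℕ∞) (ro (n := n)) := by
  unfold ro
  refine ContDiff.add (ContDiff.sum fun j _ => ((re_cd j).pow 2).add ((im_cd j).pow 2)) ?_
  exact ContDiff.pow (by fun_prop) 2

/-- bump profile -/
def hb (e : ℝ) (p : Sg n) : ℝ := Real.smoothTransition (1 - ro p / e ^ 2)
lemma hb_cd (e : ℝ) : ContDiff ℝ (⊤ : ℕ∞) (hb (n := n) e) :=
  Real.smoothTransition.contDiff.comp (contDiff_const.sub (ro_cd.div_const _))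
lemma hb_nonneg (e : ℝ) (p : Sg n) : 0 ≤ hb e p := Real.smoothTransition.nonneg _

lemma ro_norm {e : ℝ} (he : 0 < e) (p : Sg n) (h : e < ‖p.1‖) : e ^ 2 ≤ ro p := by
  by_contra hc
  push_neg at hc
  apply absurd h
  push_neg
  have h0 : ∀ j, 0 ≤ (p.1.1 j).re ^ 2 + (p.1.1 j).im ^ 2 := fun j => by positivity
  have hs : 0 ≤ ∑ j, ((p.1.1 j).re ^ 2 + (p.1.1 j).im ^ 2) := Finset.sum_nonneg fun j _ => h0 j
  unfold ro at hc
  rw [Prod.norm_def]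
  refine max_le ?_ ?_
  · rw [pi_norm_le_iff_of_nonneg he.le]
    intro j
    have := Finset.single_le_sum (fun j _ => h0 j) (Finset.mem_univ j)
    refine abs_le_of_sq_le_sq' ?_ he.le |>.2
    rw [← Complex.normSq_eq_norm_sq, Complex.normSq_apply]
    nlinarith [sq_nonneg p.1.2]
  · rw [Real.norm_eq_abs]
    exact abs_le_of_sq_le_sq (by linarith) he.le

lemma hb_supp {e : ℝ} (he : 0 < e) (p : Sg n) (h : e < ‖p.1‖) : hb e p = 0 := by
  apply Real.smoothTransition.zero_of_nonpos
  have := ro_norm he p h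
  have : 1 ≤ ro p / e ^ 2 := by rw [le_div_iff₀ (by positivity)]; linarith
  linarith
lemma hb_zero {e : ℝ} : hb e (0 : Sg n) = 1 := by
  apply Real.smoothTransition.one_of_one_le
  simp [ro]

/-- bump -/
def bm (e : ℝ) : Sm n := Sm.mk (fun p => ((hb e p : ℝ) : ℂ)) (Complex.ofRealCLM.contDiff.comp (hb_cd e))
lemma bm_ap (e : ℝ) (p : Sg n) : bm e p = ((hb e p : ℝ) : ℂ) := rfl

lemma dv_bm (e : ℝ) (v p : Sg n) : dv v (bm e) p =
    ((deriv Real.smoothTransition (1 - ro p / e ^ 2) * (-(fderiv ℝ ro p v / e ^ 2)) : ℝ) : ℂ) := by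
  have d0 : DifferentiableAt ℝ (ro (n := n)) p := (ro_cd.differentiable (by simp)) p
  have d1 : HasFDerivAt (fun p : Sg n => 1 - ro p / e ^ 2) (-((e ^ 2)⁻¹ • fderiv ℝ ro p)) p := by
    have := ((d0.hasFDerivAt).const_smul ((e ^ 2)⁻¹)).const_sub 1
    refine this.congr_of_eventuallyEq (Eventually.of_forall fun q => ?_)
    simp [div_eq_inv_mul]
  have d2 : HasDerivAt Real.smoothTransition (deriv Real.smoothTransition (1 - ro p / e ^ 2)) (1 - ro p / e ^ 2) :=
    ((Real.smoothTransition.contDiff (n := 1)).differentiable (by simp) _).hasDerivAt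
  have d3 := Complex.ofRealCLM.hasFDerivAt.comp p (d2.comp_hasFDerivAt p d1)
  rw [dv_ap]
  have := d3.fderiv
  change fderiv ℝ (Complex.ofRealCLM ∘ Real.smoothTransition ∘ fun p : Sg n => 1 - ro p / e ^ 2) p v = _
  rw [this]
  simp [div_eq_inv_mul]

lemma ro_fd (p v : Sg n) : fderiv ℝ ro p v = ∑ j, (2 * (p.1.1 j).re * (v.1.1 j).re + 2 * (p.1.1 j).im * (v.1.1 j).im) + 2 * p.1.2 * v.1.2 := by
  have d0 : DifferentiableAt ℝ (ro (n := n)) p := (ro_cd.differentiable (by simp)) p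
  rw [← d0.lineDeriv_eq_fderiv]
  apply HasDerivAt.deriv
  unfold ro
  have l : ∀ (a b : ℝ), HasDerivAt (fun t : ℝ => (a + t * b) ^ 2) (2 * a * b) 0 := by
    intro a b
    have := (((hasDerivAt_id (0 : ℝ)).mul_const b).const_add a).pow 2
    refine this.congr_deriv ?_
    simp
  refine HasDerivAt.add (HasDerivAt.fun_sum fun j _ => HasDerivAt.add ?_ ?_) ?_
  · exact (l (p.1.1 j).re (v.1.1 j).re).congr_of_eventuallyEq (Eventually.of_forall fun t => by simp)
  · exact (l (p.1.1 j).im (v.1.1 j).im).congr_of_eventuallyEq (Eventually.of_forall fun t => by simp)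
  · exact (l p.1.2 v.1.2).congr_of_eventuallyEq (Eventually.of_forall fun t => by simp)

lemma bm_ph {e : ℝ} (he : 0 < e) : Ph (bm e : Sm n) := by
  refine ⟨⟨e, fun p hp => by rw [bm_ap, hb_supp he p hp]; simp⟩, ?_⟩
  apply Sm.ext; intro p
  rw [dv_bm, ro_fd]; simp [eA]

lemma bm_rad (e : ℝ) (j : Fin n) : yco j * dv (eXS n j) (bm e) = xco j * dv (eYS n j) (bm e) := by
  apply Sm.ext; intro p
  rw [Sm.mul_ap, Sm.mul_ap, dv_bm, dv_bm, ro_fd, ro_fd, yco_ap, xco_ap]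
  have s1 : ∑ i, (2 * (p.1.1 i).re * ((eXS n j).1.1 i).re + 2 * (p.1.1 i).im * ((eXS n j).1.1 i).im) = 2 * (p.1.1 j).re := by
    rw [Finset.sum_eq_single j]
    · simp [eXS, eX]
    · intro b _ hb; simp [eXS, eX, hb]
    · simp
  have s2 : ∑ i, (2 * (p.1.1 i).re * ((eYS n j).1.1 i).re + 2 * (p.1.1 i).im * ((eYS n j).1.1 i).im) = 2 * (p.1.1 j).im := by
    rw [Finset.sum_eq_single j]
    · simp [eYS, eY]
    · intro b _ hb; simp [eYS, eY, hb]
    · simp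
  rw [s1, s2]
  simp [eXS, eYS, eX, eY]
  ring

/-- mass -/
def ms (n : ℕ) (e : ℝ) : ℝ := ∫ w : Hn n, hb e ((w, 0) : Sg n)
lemma hb_c (e : ℝ) : Continuous (fun w : Hn n => hb e ((w, 0) : Sg n)) := (hb_cd e).continuous.comp (by fun_prop)
lemma hb_cs {e : ℝ} (he : 0 < e) : HasCompactSupport (fun w : Hn n => hb e ((w, 0) : Sg n)) := by
  refine HasCompactSupport.of_support_subset_isCompact (isCompact_closedBall (0 : Hn n) e) fun w hw => ?_
  rw [mem_closedBall_zero_iff]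
  by_contra hc
  exact hw (hb_supp he _ (not_le.1 hc))
lemma ms_pos {e : ℝ} (he : 0 < e) : 0 < ms n e :=
  (hb_c e).integral_pos_of_hasCompactSupport_nonneg_nonzero (hb_cs he) (fun _ => hb_nonneg _ _)
    (x := 0) (by have := hb_zero (n := n) (e := e); rw [Prod.mk_zero_zero, this]; simp)

/-- normalised bump -/
def nb (n : ℕ) (e : ℝ) : Sm n := ((ms n e)⁻¹ : ℂ) • bm e
lemma nb_ap (e : ℝ) (p : Sg n) : nb n e p = (((ms n e)⁻¹ * hb e p : ℝ) : ℂ) := by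
  rw [nb, Sm.smul_ap, bm_ap]; push_cast; rfl
lemma nb_ph {e : ℝ} (he : 0 < e) : Ph (nb n e) := ⟨(bm_ph he).cs.smul _, by rw [nb, map_smul, (bm_ph he).da, smul_zero]⟩
lemma nb_rad (e : ℝ) : ∑ j, (XR j (XR j (nb n e)) + YR j (YR j (nb n e))) = SQ n (nb n e) := by
  apply rad_SQ
  intro j
  rw [nb, map_smul, map_smul, mul_smul_comm, mul_smul_comm, bm_rad]
lemma nb_norm {e : ℝ} (he : 0 < e) (p : Sg n) : ‖nb n e p‖ = (ms n e)⁻¹ * hb e p := by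
  rw [nb_ap, Complex.norm_real, Real.norm_of_nonneg]
  exact mul_nonneg (inv_nonneg.2 (ms_pos he).le) (hb_nonneg _ _)
lemma nb_int {e : ℝ} (he : 0 < e) : ∫ w, ‖nb n e (w, 0)‖ = 1 := by
  simp only [nb_norm he]
  rw [integral_const_mul]
  exact inv_mul_cancel₀ (ms_pos he).ne'
lemma nb_int' {e : ℝ} (he : 0 < e) : ∫ w, nb n e (w, 0) = 1 := by
  simp only [nb_ap]
  rw [integral_complex_ofReal, integral_const_mul]
  have : (ms n e)⁻¹ * ∫ w, hb e ((w, 0) : Sg n) = 1 := inv_mul_cancel₀ (ms_pos he).ne'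
  rw [this]; simp

/-- product -/
def gi (x v : Hn n) : Hn n := (x.1 + v.1, x.2 + v.2 + 2 * qf x.1 v.1)
lemma gi_gm (x w : Hn n) : gi x (gm x w) = w := by
  refine Prod.ext ?_ ?_
  · simp [gi, gm]
  · simp only [gi, gm, qf_sub, qf_self]; ring
lemma gi_cont (x : Hn n) : Continuous (gi x) := by
  have : Continuous (fun v : Hn n => qf x.1 v.1) := qf_cd.continuous.comp (by fun_prop : Continuous fun v : Hn n => (x.1, v.1))
  unfold gi; fun_prop
lemma gi_zero (x : Hn n) : gi x 0 = x := by
  refine Prod.ext ?_ ?_ <;> simp [gi, qf]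

lemma UU_gi (V : Sm n) {φ : Sm n} (h : Ph φ) (p : Sg n) : UU V φ h.cs p = ∫ v, V (gi p.1 v, p.2) * φ (v, 0) := by
  have m := gm_mp (n := n) p.1
  have c : Continuous (fun v => V (gi p.1 v, p.2) * φ (v, 0)) :=
    (V.cont.comp ((gi_cont p.1).prodMk continuous_const)).mul (φ.cont.comp (by fun_prop))
  have e := integral_map (φ := gm p.1) (f := fun v => V (gi p.1 v, p.2) * φ (v, 0)) m.aemeasurable (μ := volume) c.aestronglyMeasurable
  rw [m.map_eq] at e
  rw [e, UU_ap]
  congr 1; funext w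
  rw [gi_gm, h.const]

lemma nb_tendsto (V : Sm n) (p : Sg n) {d : ℝ} (hd : 0 < d) : ∃ e0 > 0, ∀ e, ∀ he : 0 < e, e < e0 → ‖UU V (nb n e) (nb_ph he).cs p - V p‖ ≤ d := by
  have c : Continuous (fun v : Hn n => V (gi p.1 v, p.2)) := V.cont.comp ((gi_cont p.1).prodMk continuous_const)
  have := (Metric.continuousAt_iff.1 (c.continuousAt (x := 0))) d hd
  obtain ⟨e0, h0, h⟩ := this
  refine ⟨e0, h0, fun e he hlt => ?_⟩
  have hz : ∀ w : Hn n, e < ‖w‖ → nb n e (w, 0) = 0 := fun w hw => by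
    rw [nb_ap, hb_supp he ((w, 0) : Sg n) hw, mul_zero, Complex.ofReal_zero]
  have cn : Continuous (fun w : Hn n => nb n e (w, 0)) := (nb n e).cont.comp (continuous_id.prodMk continuous_const)
  have i1 : Integrable (fun w : Hn n => nb n e (w, 0)) := supp_int cn hz
  have i2 : Integrable (fun v : Hn n => V (gi p.1 v, p.2) * nb n e (v, 0)) := supp_int (c.mul cn) (R := e) (fun w hw => by
    rw [hz w hw, mul_zero])
  have e1 : UU V (nb n e) (nb_ph he).cs p - V p = ∫ v, (V (gi p.1 v, p.2) - V p) * nb n e (v, 0) := by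
    have : V p = ∫ v, V p * nb n e (v, 0) := by rw [integral_const_mul, nb_int' he, mul_one]
    rw [UU_gi V (nb_ph he)]
    conv_lhs => rw [this]
    rw [← integral_sub i2 (i1.const_mul _)]
    congr 1; funext v; ring
  rw [e1]
  have := norm_integral_le_of_norm_le (i1.norm.const_mul d) (f := fun v => (V (gi p.1 v, p.2) - V p) * nb n e (v, 0)) (Eventually.of_forall fun v => by
    rw [norm_mul]
    by_cases hv : e < ‖v‖
    · rw [hz v hv]; simp
    · refine mul_le_mul_of_nonneg_right ?_ (norm_nonneg _)
      have := h (x := v) (by rw [dist_zero_right]; linarith)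
      rw [gi_zero, dist_eq_norm] at this
      exact this.le)
  refine this.trans (le_of_eq ?_)
  rw [integral_const_mul, nb_int he, mul_one]
end bump

/-! ### Part 17 : regularised solutions and passage to the limit -/
section reg
variable {n : ℕ}

lemma EqD_UU {α c : ℝ} {V φ : Sm n} (hE : EqD α c V) (h : Ph φ)
    (hr : ∑ j, (XR j (XR j φ) + YR j (YR j φ)) = SQ n φ) : EqD α c (UU V φ h.cs) := by
  have hE' := congrArg (fun W => UU W φ h.cs) hE
  simp only [UU_zero_left] at hE'
  rw [UU_add_left, UU_add_left, UU_smul_left, UU_smul_left, SQ_ibp, ← SQ_UU V φ h.cs hr, ← A_UU V φ h.cs h.da, ← MA_UU,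
    De_ap, UU_add_left, ← A_UU _ φ h.cs h.da, ← A_UU _ φ h.cs h.da, TT_ibp] at hE'
  have hT : TO (TO (UU V φ h.cs)) = UU V (TO (TO φ)) h.cs.TO.TO := by
    rw [T_UU, map_smul, T_UU, smul_smul]; norm_num
  rw [← hT, ← De_ap] at hE'
  exact hE'

lemma reg_fp {k : ℕ} {F : Sg n → ℂ} (hF : SH F)
    (hreg : ∀ φ : SchwartzMap (Hn n) ℂ, ∃ C : ℝ, ∀ a : ℝ, 0 < a → a ≤ 1 →
        ‖∫ w : Hn n, ((DA n)^[k + 1] F) (w, a) * φ w‖ ≤ C)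
    (φ : Sm n) (h : Ph φ) (x : Hn n) : ∃ M, ∀ a, 0 < a → a ≤ 1 → ‖fp (tl F hF) φ h (k + 1) x a‖ ≤ M := by
  have hc : ContDiff ℝ (⊤ : ℕ∞) (fun w : Hn n => φ (gm x w, 0)) := by
    have h1 : ContDiff ℝ (⊤ : ℕ∞) (fun w : Hn n => gm x w) := gm_cd.comp (contDiff_const.prodMk contDiff_id)
    exact φ.cd.comp (h1.prodMk contDiff_const)
  have hs : HasCompactSupport (fun w : Hn n => φ (gm x w, 0)) := by
    obtain ⟨R, hR⟩ := h.cs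
    refine HasCompactSupport.of_support_subset_isCompact (isCompact_closedBall (0 : Hn n) ((‖x‖ + 1) + R + 4 * n * ((‖x‖ + 1) * R))) fun w hw => ?_
    rw [mem_closedBall_zero_iff]
    refine gm_norm (x := x) (by linarith) ?_
    by_contra hcn
    exact hw (hR _ (not_le.1 hcn))
  obtain ⟨C, hC⟩ := hreg (hs.toSchwartzMap hc)
  refine ⟨C, fun a ha ha1 => ?_⟩
  have e : fp (tl F hF) φ h (k + 1) x a = ∫ w : Hn n, ((DA n)^[k + 1] F) (w, a) * φ (gm x w, 0) := by
    rw [fp, tl_Ai, UU_ap]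
    congr 1; funext w
    rw [tl_ap, h.const, EX, Real.exp_log ha]
  rw [e]
  exact hC a ha ha1

/-- compact support -/
def CC (χ : Sm n) : Prop := ∃ R, ∀ p : Sg n, R < ‖p‖ → χ p = 0

lemma CC.dv {φ : Sm n} (h : CC φ) (v : Sg n) : CC (dv v φ) := by
  obtain ⟨R, h⟩ := h
  refine ⟨R, fun p hp => ?_⟩
  rw [dv_ap]
  have ho : IsOpen {p : Sg n | R < ‖p‖} := isOpen_lt continuous_const (by fun_prop)
  have : φ.fn =ᶠ[𝓝 p] fun _ => 0 := by
    filter_upwards [ho.mem_nhds hp] with q hq using h q hq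
  rw [this.fderiv_eq]; simp
lemma CC.mul {φ : Sm n} (h : CC φ) (g : Sm n) : CC (g * φ) := by
  obtain ⟨R, h⟩ := h
  exact ⟨R, fun p hp => by rw [Sm.mul_ap, h p hp, mul_zero]⟩
lemma CC.add {φ ψ : Sm n} (h : CC φ) (k : CC ψ) : CC (φ + ψ) := by
  obtain ⟨R, h⟩ := h
  obtain ⟨S, k⟩ := k
  exact ⟨max R S, fun p hp => by rw [Sm.add_ap, h p ((le_max_left _ _).trans_lt hp), k p ((le_max_right _ _).trans_lt hp), add_zero]⟩
lemma CC.smul {φ : Sm n} (h : CC φ) (c : ℂ) : CC (c • φ) := by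
  obtain ⟨R, h⟩ := h
  exact ⟨R, fun p hp => by rw [Sm.smul_ap, h p hp]; simp⟩
lemma CC.integrable {φ : Sm n} (h : CC φ) : Integrable φ.fn := by
  obtain ⟨R, h⟩ := h
  apply φ.cont.integrable_of_hasCompactSupport
  apply HasCompactSupport.intro (isCompact_closedBall (0 : Sg n) R)
  intro w hw
  apply h
  simpa using hw

/-- transposable operators -/
def Tr (P : Op n) : Prop := ∃ Q : Op n, (∀ χ, CC χ → CC (Q χ)) ∧
  ∀ V χ : Sm n, CC χ → ∫ p, P V p * χ p = ∫ p, V p * Q χ p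

lemma Tr.dv (v : Sg n) : Tr (dv v) := by
  refine ⟨-(_root_.dv v), fun χ h => ?_, fun V χ h => ?_⟩
  · have := (h.dv v).smul (-1)
    have e : (-(_root_.dv v) : Op n) χ = (-1 : ℂ) • _root_.dv v χ := by rw [LinearMap.neg_apply]; module
    rw [e]; exact this
  · have h1 : CC (V * χ) := h.mul V
    have e := int_dv v (V * χ) h1.integrable (h1.dv v).integrable
    have i1 : Integrable (fun p => (_root_.dv v V) p * χ p) := (h.mul (_root_.dv v V)).integrable
    have i2 : Integrable (fun p => V p * (_root_.dv v χ) p) := ((h.dv v).mul V).integrable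
    have e2 : ∀ p, (_root_.dv v (V * χ) : Sm n) p = (_root_.dv v V) p * χ p + V p * (_root_.dv v χ) p := by
      intro p; rw [dv_mul, Sm.add_ap, Sm.mul_ap, Sm.mul_ap]
      try ring
    simp only [e2] at e
    rw [integral_add i1 i2] at e
    have e3 : ∀ p, ((-(_root_.dv v) : Op n) χ) p = - (_root_.dv v χ) p := by
      intro p
      have e : (-(_root_.dv v) : Op n) χ = (-1 : ℂ) • _root_.dv v χ := by rw [LinearMap.neg_apply]; module
      rw [e, Sm.smul_ap]; simp
    simp only [e3, mul_neg]
    rw [integral_neg]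
    linear_combination e
lemma Tr.mu (g : Sm n) : Tr (mu g) := by
  refine ⟨_root_.mu g, fun χ h => h.mul g, fun V χ h => ?_⟩
  congr 1; funext p
  rw [mu_ap, mu_ap, Sm.mul_ap, Sm.mul_ap]; ring
lemma Tr.add {P Q : Op n} (h : Tr P) (k : Tr Q) : Tr (P + Q) := by
  obtain ⟨P', a, b⟩ := h
  obtain ⟨Q', c, d⟩ := k
  refine ⟨P' + Q', fun χ h => (a χ h).add (c χ h), fun V χ h => ?_⟩
  have i1 : Integrable (fun p => (P V) p * χ p) := (h.mul (P V)).integrable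
  have i2 : Integrable (fun p => (Q V) p * χ p) := (h.mul (Q V)).integrable
  have i3 : Integrable (fun p => V p * (P' χ) p) := ((a χ h).mul V).integrable
  have i4 : Integrable (fun p => V p * (Q' χ) p) := ((c χ h).mul V).integrable
  simp only [LinearMap.add_apply, Sm.add_ap, add_mul, mul_add]
  rw [integral_add i1 i2, integral_add i3 i4, b V χ h, d V χ h]
lemma Tr.smul {P : Op n} (h : Tr P) (c : ℂ) : Tr (c • P) := by
  obtain ⟨P', a, b⟩ := h
  refine ⟨c • P', fun χ h => (a χ h).smul c, fun V χ h => ?_⟩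
  simp only [LinearMap.smul_apply, Sm.smul_ap, smul_eq_mul]
  have e1 : ∀ p, c * (P V) p * χ p = c * ((P V) p * χ p) := fun p => by ring
  have e2 : ∀ p, V p * (c * (P' χ) p) = c * (V p * (P' χ) p) := fun p => by ring
  simp only [e1, e2]
  rw [integral_const_mul, integral_const_mul, b V χ h]
lemma Tr.mul {P Q : Op n} (h : Tr P) (k : Tr Q) : Tr (P * Q) := by
  obtain ⟨P', a, b⟩ := h
  obtain ⟨Q', c, d⟩ := k
  refine ⟨Q' * P', fun χ h => c _ (a χ h), fun V χ h => ?_⟩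
  rw [Module.End.mul_apply, Module.End.mul_apply, b _ χ h, d _ _ (a χ h)]
lemma Tr.one : Tr (1 : Op n) := ⟨1, fun χ h => h, fun V χ h => rfl⟩
lemma Tr.DD {P : Op n} (hP : P ∈ DD n) : Tr P := by
  refine Algebra.adjoin_induction (p := fun P _ => Tr P) ?_ ?_ ?_ ?_ hP
  · intro P hP
    rcases hP with (⟨j, rfl⟩ | ⟨j, rfl⟩) | hP
    · exact (Tr.dv _).add (((Tr.mu _).mul (Tr.dv _)).smul _)
    · have e : YO j = _root_.dv (eYS n j) + (-2 : ℂ) • (_root_.mu (xco j) * _root_.dv (eTS n)) := by rw [YO]; module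
      rw [e]
      exact (Tr.dv _).add (((Tr.mu _).mul (Tr.dv _)).smul _)
    · rcases hP with rfl | hP
      · exact Tr.dv _
      · rw [mem_singleton_iff] at hP; subst hP
        exact (Tr.mu _).mul (Tr.dv _)
  · intro c
    rw [Algebra.algebraMap_eq_smul_one]; exact Tr.one.smul c
  · intro P Q _ _ hP hQ; exact hP.add hQ
  · intro P Q _ _ hP hQ; exact hP.mul hQ

lemma lim_zero {V : Sm n} {C : ℝ} (hV : ∀ p, ‖V p‖ ≤ C) {P : Op n} (hP : P ∈ DD n)
    (h0 : ∀ e, ∀ he : 0 < e, P (UU V (nb n e) (nb_ph he).cs) = 0) : P V = 0 := by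
  obtain ⟨Q, a, b⟩ := Tr.DD hP
  have key : ∀ χ : Sm n, CC χ → ∫ p, P V p * χ p = 0 := by
    intro χ h
    rw [b V χ h]
    have hpos : ∀ m : ℕ, (0 : ℝ) < 1 / ((m : ℝ) + 1) := fun m => by positivity
    let u : ℕ → Sm n := fun m => UU V (nb n (1 / ((m : ℝ) + 1))) (nb_ph (hpos m)).cs
    have t : Tendsto (fun m => ∫ p, u m p * Q χ p) atTop (𝓝 (∫ p, V p * Q χ p)) := by
      refine tendsto_integral_of_dominated_convergence (fun p => C * ‖Q χ p‖) ?_ ?_ ?_ ?_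
      · intro m; exact ((u m).cont.mul (Q χ).cont).aestronglyMeasurable
      · exact (a χ h).integrable.norm.const_mul C
      · intro m
        refine Eventually.of_forall fun p => ?_
        rw [norm_mul]
        refine mul_le_mul_of_nonneg_right ?_ (norm_nonneg _)
        have := UU_bd (nb_ph (n := n) (hpos m)) hV p
        rw [nb_int (hpos m), mul_one] at this
        exact this
      · refine Eventually.of_forall fun p => ?_
        refine Tendsto.mul_const _ ?_
        rw [Metric.tendsto_atTop]
        intro d hd
        obtain ⟨e0, h0, hh⟩ := nb_tendsto V p (half_pos hd)
        obtain ⟨N, hN⟩ := exists_nat_one_div_lt h0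
        refine ⟨N, fun m hm => ?_⟩
        have := hh _ (hpos m) (lt_of_le_of_lt (one_div_le_one_div_of_le (by positivity) (by gcongr)) hN)
        rw [dist_eq_norm]
        exact this.trans_lt (half_lt_self hd)
    have z : ∀ m, ∫ p, u m p * Q χ p = 0 := by
      intro m
      rw [← b _ χ h, h0 _ (hpos m)]
      simp
    simp only [z] at t
    exact (tendsto_nhds_unique t tendsto_const_nhds)
  have ae : ∀ᵐ p, (P V) p = 0 := by
    refine ae_eq_zero_of_integral_contDiff_smul_eq_zero (P V).cont.locallyIntegrable fun g hg hs => ?_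
    let χ : Sm n := Sm.mk (fun p => ((g p : ℝ) : ℂ)) (Complex.ofRealCLM.contDiff.comp hg)
    have hχ : CC χ := by
      obtain ⟨R, hR⟩ := hs.isCompact.isBounded.subset_closedBall (0 : Sg n)
      refine ⟨R, fun p hp => ?_⟩
      have : g p = 0 := by
        by_contra hc
        have := hR (subset_tsupport g hc)
        rw [mem_closedBall_zero_iff] at this
        linarith
      change ((g p : ℝ) : ℂ) = 0
      rw [this]; simp
    rw [← key χ hχ]
    congr 1; funext p
    change g p • (P V) p = (P V) p * ((g p : ℝ) : ℂ)
    rw [Complex.real_smul]; ring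
  apply Sm.ext; intro p
  have := (P V).cont.ae_eq_iff_eq (volume : Measure (Sg n)) (continuous_const (y := (0 : ℂ)))
  exact congrFun (this.1 ae) p

structure PLH (V : Sm n) : Prop where
  de : De V = 0
  zm : ∀ k, Zs (-1) k (Ds (-1) V) = 0
  zp : ∀ k, Zs 1 k (Ds 1 V) = 0
  q : ∀ j k, Zs (-1) k (Zs 1 j V) + (if j = k then 2 * Complex.I else 0 : ℂ) • Ds (-1) V = 0

lemma main_PLH {α : ℝ} (hα : 0 < α) {k : ℕ} (hk : k = Nat.floor ((n : ℝ) * α) + 1)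
    {F : Sg n → ℂ} (hFbdd : ∃ C, ∀ p : Sg n, 0 < p.2 → ‖F p‖ ≤ C) (hF : SH F)
    (hFharm : ∀ p : Sg n, 0 < p.2 → Lalpha n α F p = 0)
    (hreg : ∀ φ : SchwartzMap (Hn n) ℂ, ∀ p : ℕ, p ≤ k + 1 → ∃ C : ℝ,
      ∀ a : ℝ, 0 < a → a ≤ 1 → ‖∫ w : Hn n, ((DA n)^[p] F) (w, a) * φ w‖ ≤ C) : PLH (tl F hF) := by
  obtain ⟨C, hC⟩ := hFbdd
  have hV : ∀ p, ‖tl F hF p‖ ≤ C := fun p => hC _ (EX_pos p)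
  have hE := tl_eq F hF hFharm
  have hnα : 0 ≤ (n : ℝ) * α := by positivity
  have k1 : α * n < k := by
    rw [hk, mul_comm]; push_cast; exact Nat.lt_floor_add_one _
  have k2 : (k : ℝ) ≤ α * n + 1 := by
    rw [hk, mul_comm α]; push_cast; linarith [Nat.floor_le hnα]
  have hR := reg_fp hF (fun φ => hreg φ (k + 1) le_rfl)
  have g : ∀ e, ∀ he : 0 < e, Good (UU (tl F hF) (nb n e) (nb_ph he).cs) := fun e he =>
    UU_good ⟨C, hV⟩ hα hE k1 k2 hR (nb_ph he)
  have q : ∀ e, ∀ he : 0 < e, EqD α (-(α * n)) (UU (tl F hF) (nb n e) (nb_ph he).cs) := fun e he =>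
    EqD_UU hE (nb_ph he) (nb_rad e)
  have d := fun e he => De_u hα (g e he) (q e he)
  refine ⟨lim_zero hV De_mem d, fun k => ?_, fun k => ?_, fun j k => ?_⟩
  · exact lim_zero hV (P := Zs (-1) k * Ds (-1)) (mul_mem (Zs_mem _ _) (Ds_mem _))
      fun e he => ZD_u (by norm_num) hα (g e he) (q e he) (d e he) k
  · exact lim_zero hV (P := Zs 1 k * Ds 1) (mul_mem (Zs_mem _ _) (Ds_mem _))
      fun e he => ZD_u (by norm_num) hα (g e he) (q e he) (d e he) k
  · exact lim_zero hV (P := Zs (-1) k * Zs 1 j + (if j = k then 2 * Complex.I else 0 : ℂ) • Ds (-1))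
      (add_mem (mul_mem (Zs_mem _ _) (Zs_mem _ _)) (Subalgebra.smul_mem _ (Ds_mem _) _))
      fun e he => q_u hα (g e he) (q e he) j k
end reg

/-! ### Part 18 : back to the Siegel domain -/
section siegel
variable {n : ℕ}

/-- defining function -/
def rr (z : Vn n) : ℝ := z.2.im - ∑ j, ‖z.1 j‖ ^ 2
lemma rr_eq (z : Vn n) : rr z = z.2.im - ∑ j, ((z.1 j).re ^ 2 + (z.1 j).im ^ 2) := by
  unfold rr
  congr 1
  refine Finset.sum_congr rfl fun j _ => ?_
  rw [Complex.sq_norm, Complex.normSq_apply]; ring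
lemma rr_cd : ContDiff ℝ (⊤ : ℕ∞) (rr (n := n)) := by
  have : (rr (n := n)) = fun z => z.2.im - ∑ j, ((z.1 j).re ^ 2 + (z.1 j).im ^ 2) := funext rr_eq
  rw [this]
  have h1 : ∀ j, ContDiff ℝ (⊤ : ℕ∞) (fun z : Vn n => (z.1 j).re) := fun j => Complex.reCLM.contDiff.comp (by fun_prop)
  have h2 : ∀ j, ContDiff ℝ (⊤ : ℕ∞) (fun z : Vn n => (z.1 j).im) := fun j => Complex.imCLM.contDiff.comp (by fun_prop)
  have h3 : ContDiff ℝ (⊤ : ℕ∞) (fun z : Vn n => z.2.im) := Complex.imCLM.contDiff.comp (by fun_prop)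
  exact h3.sub (ContDiff.sum fun j _ => ((h1 j).pow 2).add ((h2 j).pow 2))
lemma rr_pos {z : Vn n} (hz : z ∈ Un n) : 0 < rr z := by
  have : ∑ j, ‖z.1 j‖ ^ 2 < z.2.im := hz
  unfold rr; linarith
lemma Un_open : IsOpen (Un n) := by
  have : Un n = {z : Vn n | 0 < rr z} := by
    ext z; simp [Un, rr]
  rw [this]; exact isOpen_lt continuous_const rr_cd.continuous

lemma rr_fd (z v : Vn n) : fderiv ℝ rr z v = v.2.im - ∑ j, (2 * (z.1 j).re * (v.1 j).re + 2 * (z.1 j).im * (v.1 j).im) := by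
  have d0 : DifferentiableAt ℝ (rr (n := n)) z := (rr_cd.differentiable (by simp)) z
  rw [← d0.lineDeriv_eq_fderiv]
  apply HasDerivAt.deriv
  have : (rr (n := n)) = fun z => z.2.im - ∑ j, ((z.1 j).re ^ 2 + (z.1 j).im ^ 2) := funext rr_eq
  rw [this]
  have l : ∀ (a b : ℝ), HasDerivAt (fun t : ℝ => (a + t * b) ^ 2) (2 * a * b) 0 := by
    intro a b
    have := (((hasDerivAt_id (0 : ℝ)).mul_const b).const_add a).pow 2
    refine this.congr_deriv ?_
    simp
  have l1 : ∀ (a b : ℝ), HasDerivAt (fun t : ℝ => (a + t * b)) b 0 := by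
    intro a b
    have := (((hasDerivAt_id (0 : ℝ)).mul_const b).const_add a)
    refine this.congr_deriv ?_
    simp
  refine HasDerivAt.sub ?_ (HasDerivAt.fun_sum fun j _ => HasDerivAt.add ?_ ?_)
  · exact (l1 z.2.im v.2.im).congr_of_eventuallyEq (Eventually.of_forall fun t => by simp)
  · exact (l (z.1 j).re (v.1 j).re).congr_of_eventuallyEq (Eventually.of_forall fun t => by simp)
  · exact (l (z.1 j).im (v.1 j).im).congr_of_eventuallyEq (Eventually.of_forall fun t => by simp)

/-- coordinates -/
def Ps (z : Vn n) : Sg n := ((z.1, z.2.re), Real.log (rr z))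

/-- the directional derivative of the coordinate change -/
lemma Ps_fd {z : Vn n} (hz : z ∈ Un n) : ∃ L : Vn n →L[ℝ] Sg n, HasFDerivAt Ps L z ∧ ∀ v, L v = ((v.1, v.2.re), (rr z)⁻¹ * fderiv ℝ rr z v) := by
  have h1 : HasFDerivAt (fun z : Vn n => z.1) (ContinuousLinearMap.fst ℝ (Fin n → ℂ) ℂ) z := hasFDerivAt_fst
  have h2 : HasFDerivAt (fun z : Vn n => z.2.re) (Complex.reCLM.comp (ContinuousLinearMap.snd ℝ (Fin n → ℂ) ℂ)) z :=
    (Complex.reCLM.comp (ContinuousLinearMap.snd ℝ (Fin n → ℂ) ℂ)).hasFDerivAt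
  have h3 := ((rr_cd (n := n)).differentiable (by simp) z).hasFDerivAt.log (rr_pos hz).ne'
  exact ⟨_, (h1.prodMk h2).prodMk h3, fun v => rfl⟩

/-- pull-back -/
def pb (V : Sm n) (z : Vn n) : ℂ := V (Ps z)

lemma pb_fd (V : Sm n) {z : Vn n} (hz : z ∈ Un n) (v : Vn n) :
    fderiv ℝ (pb V) z v = dv ((v.1, v.2.re), 0) V (Ps z) + ((fderiv ℝ rr z v : ℝ) : ℂ) * AO V (Ps z) := by
  obtain ⟨L, hL, e⟩ := Ps_fd hz
  have d := ((V.diff (Ps z)).hasFDerivAt.comp z hL).fderiv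
  have e0 : pb V = V.fn ∘ Ps := rfl
  rw [e0, d, ContinuousLinearMap.comp_apply, e]
  have e1 : (((v.1, v.2.re), (rr z)⁻¹ * fderiv ℝ rr z v) : Sg n) = ((v.1, v.2.re), 0) + ((rr z)⁻¹ * fderiv ℝ rr z v) • eA n := by
    simp [eA]
  have e2 : AO V (Ps z) = (((rr z)⁻¹ : ℝ) : ℂ) * fderiv ℝ V.fn (Ps z) (eA n) := by
    rw [AO, Module.End.mul_apply, mu_ap, Sm.mul_ap, ea_ap, dv_ap]
    congr 2
    rw [neg_one_mul, Real.exp_neg]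
    simp only [Ps]
    rw [Real.exp_log (rr_pos hz)]
  rw [e1, map_add, map_smul, e2, dv_ap, Complex.real_smul]
  push_cast; ring

/-- horizontal basis vector -/
def bz (n : ℕ) (j : Fin n) : Vn n := (fun i => if i = j then (1 : ℂ) else 0, 0)

lemma fd_T (V : Sm n) {z : Vn n} (hz : z ∈ Un n) : fderiv ℝ (pb V) z (0, 1) = TO V (Ps z) := by
  rw [pb_fd V hz, rr_fd]; simp [TO, eTS, eT]
lemma fd_A (V : Sm n) {z : Vn n} (hz : z ∈ Un n) : fderiv ℝ (pb V) z (Complex.I • (0, 1)) = AO V (Ps z) := by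
  rw [pb_fd V hz, rr_fd]
  have : (((Complex.I • ((0, 1) : Vn n)).1, (Complex.I • ((0, 1) : Vn n)).2.re), (0 : ℝ)) = (0 : Sg n) := by simp
  rw [this, dv_ap]; simp
lemma fd_X (V : Sm n) {z : Vn n} (hz : z ∈ Un n) (j : Fin n) : fderiv ℝ (pb V) z (bz n j) =
    XO j V (Ps z) - 2 * ((z.1 j).im : ℂ) * TO V (Ps z) - 2 * ((z.1 j).re : ℂ) * AO V (Ps z) := by
  rw [pb_fd V hz, rr_fd]
  have s : ∑ i, (2 * (z.1 i).re * ((bz n j).1 i).re + 2 * (z.1 i).im * ((bz n j).1 i).im) = 2 * (z.1 j).re := by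
    rw [Finset.sum_eq_single j]
    · simp [bz]
    · intro b _ hb; simp [bz, hb]
    · simp
  have e : ((((bz n j).1, (bz n j).2.re), (0 : ℝ)) : Sg n) = eXS n j := by simp [bz, eXS, eX]
  rw [s, e, XO, LinearMap.add_apply, LinearMap.smul_apply, Module.End.mul_apply, mu_ap, Sm.add_ap, Sm.smul_ap, Sm.mul_ap, yco_ap, TO]
  simp [bz, Ps]; ring
lemma fd_Y (V : Sm n) {z : Vn n} (hz : z ∈ Un n) (j : Fin n) : fderiv ℝ (pb V) z (Complex.I • bz n j) =
    YO j V (Ps z) + 2 * ((z.1 j).re : ℂ) * TO V (Ps z) - 2 * ((z.1 j).im : ℂ) * AO V (Ps z) := by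
  rw [pb_fd V hz, rr_fd]
  have s : ∑ i, (2 * (z.1 i).re * ((Complex.I • bz n j).1 i).re + 2 * (z.1 i).im * ((Complex.I • bz n j).1 i).im) = 2 * (z.1 j).im := by
    rw [Finset.sum_eq_single j]
    · simp [bz]
    · intro b _ hb; simp [bz, hb]
    · simp
  have e : ((((Complex.I • bz n j).1, (Complex.I • bz n j).2.re), (0 : ℝ)) : Sg n) = eYS n j := by
    refine Prod.ext (Prod.ext ?_ ?_) ?_
    · funext i; simp [bz, eYS, eY]
    · simp [bz, eYS, eY]
    · simp [eYS]
  rw [s, e, YO, LinearMap.sub_apply, LinearMap.smul_apply, Module.End.mul_apply, mu_ap, Sm.sub_ap, Sm.smul_ap, Sm.mul_ap, xco_ap, TO]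
  simp [bz, Ps]; ring

/-- complex coordinate (`e = 1`) and its conjugate (`e = -1`) -/
def zc (e : ℝ) (j : Fin n) : Sm n := xco j + ((e : ℂ) * Complex.I) • yco j
lemma zc_ap (e : ℝ) (j : Fin n) (p : Sg n) : zc e j p = ((p.1.1 j).re : ℂ) + e * Complex.I * ((p.1.1 j).im : ℂ) := by
  rw [zc, Sm.add_ap, Sm.smul_ap, xco_ap, yco_ap]

/-- `∂_{z̄_j}` for `e = 1`, `∂_{z_j}` for `e = -1` -/
def Bh (e : ℝ) (j : Fin n) : Op n := Zs e j + ((e : ℂ) * 2 * Complex.I) • (mu (zc e j) * Ds (-e))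

lemma Zs_ap (e : ℝ) (j : Fin n) (V : Sm n) (p : Sg n) : Zs e j V p = 1 / 2 * (XO j V p + e * Complex.I * YO j V p) := by
  simp only [Zs, LinearMap.smul_apply, LinearMap.add_apply, Sm.smul_ap, Sm.add_ap, smul_eq_mul]
lemma Ds_apt (e : ℝ) (V : Sm n) (p : Sg n) : Ds e V p = 1 / 2 * (TO V p - e * Complex.I * AO V p) := by
  simp only [Ds, LinearMap.smul_apply, LinearMap.sub_apply, Sm.smul_ap, Sm.sub_ap, smul_eq_mul]
lemma Bh_ap (e : ℝ) (j : Fin n) (V : Sm n) (p : Sg n) : Bh e j V p = Zs e j V p + e * 2 * Complex.I * (zc e j p * Ds (-e) V p) := by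
  simp only [Bh, LinearMap.smul_apply, LinearMap.add_apply, Module.End.mul_apply, mu_ap, Sm.smul_ap, Sm.add_ap, Sm.mul_ap, smul_eq_mul]

lemma dzbar_h (V : Sm n) {z : Vn n} (hz : z ∈ Un n) (j : Fin n) : dzbarV n (bz n j) (pb V) z = pb (Bh 1 j V) z := by
  rw [dzbarV, fd_X V hz, fd_Y V hz, pb, Bh_ap, Zs_ap, Ds_apt, zc_ap]
  have : (Ps z).1.1 = z.1 := rfl
  rw [this]; push_cast
  linear_combination (-((z.1 j).im : ℂ) * (Complex.I * AO V (Ps z) + TO V (Ps z)) - ((z.1 j).re : ℂ) * AO V (Ps z)) * Complex.I_sq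
lemma dz_h (V : Sm n) {z : Vn n} (hz : z ∈ Un n) (j : Fin n) : dzV n (bz n j) (pb V) z = pb (Bh (-1) j V) z := by
  rw [dzV, fd_X V hz, fd_Y V hz, pb, Bh_ap, Zs_ap, Ds_apt, zc_ap]
  have : (Ps z).1.1 = z.1 := rfl
  rw [this]; push_cast
  linear_combination (((z.1 j).im : ℂ) * (Complex.I * AO V (Ps z) - TO V (Ps z)) - ((z.1 j).re : ℂ) * AO V (Ps z)) * Complex.I_sq
lemma dzbar_v (V : Sm n) {z : Vn n} (hz : z ∈ Un n) : dzbarV n (0, 1) (pb V) z = pb (Ds (-1) V) z := by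
  rw [dzbarV, fd_T V hz, fd_A V hz, pb, Ds_apt]; push_cast; ring
lemma dz_v (V : Sm n) {z : Vn n} (hz : z ∈ Un n) : dzV n (0, 1) (pb V) z = pb (Ds 1 V) z := by
  rw [dzV, fd_T V hz, fd_A V hz, pb, Ds_apt]; push_cast; ring

lemma basisV_h (j : Fin (n + 1)) (h : (j : ℕ) < n) : basisV n j = bz n ⟨j, h⟩ := by
  rw [basisV, dif_pos h, bz]
  congr 1; funext i
  simp [Fin.ext_iff]
lemma basisV_v (j : Fin (n + 1)) (h : ¬ (j : ℕ) < n) : basisV n j = (0, 1) := by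
  rw [basisV, dif_neg h]

/-- the full operators -/
def Bf (e : ℝ) (j : Fin (n + 1)) : Op n := if h : (j : ℕ) < n then Bh e ⟨j, h⟩ else Ds (-e)

lemma dzbar_B (V : Sm n) {z : Vn n} (hz : z ∈ Un n) (j : Fin (n + 1)) : dzbarV n (basisV n j) (pb V) z = pb (Bf 1 j V) z := by
  by_cases h : (j : ℕ) < n
  · rw [basisV_h j h, Bf, dif_pos h, dzbar_h V hz]
  · rw [basisV_v j h, Bf, dif_neg h, dzbar_v V hz]
lemma dz_B (V : Sm n) {z : Vn n} (hz : z ∈ Un n) (j : Fin (n + 1)) : dzV n (basisV n j) (pb V) z = pb (Bf (-1) j V) z := by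
  by_cases h : (j : ℕ) < n
  · rw [basisV_h j h, Bf, dif_pos h, dz_h V hz]
  · rw [basisV_v j h, Bf, dif_neg h, dz_v V hz, neg_neg]

lemma isDer_Zs (e : ℝ) (j : Fin n) : IsDer (Zs e j) := ((isDer_X j).add ((isDer_Y j).smul _)).smul _
lemma isDer_Ds (e : ℝ) : IsDer (Ds e : Op n) := (isDer_T.sub (isDer_A.smul _)).smul _

lemma Ds_zc (d e : ℝ) (j : Fin n) : Ds d (zc e j) = 0 := by
  apply Sm.ext; intro p
  simp [Ds, TO, AO, zc, dv_xco', dv_yco', eTS, eT, eA]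
lemma Zs_zc (j k : Fin n) : Zs (-1) k (zc 1 j) = (if j = k then 1 else 0 : ℂ) • (1 : Sm n) := by
  apply Sm.ext; intro p
  by_cases h : j = k
  · subst h
    simp [Zs, XO, YO, zc, dv_xco', dv_yco', eTS, eT, eXS, eX, eYS, eY, ← sub_eq_add_neg]
    ring
  · simp [Zs, XO, YO, zc, dv_xco', dv_yco', eTS, eT, eXS, eX, eYS, eY, h]

lemma PLH.B {V : Sm n} (H : PLH V) (j k : Fin (n + 1)) : Bf (-1) k (Bf 1 j V) = 0 := by
  have hD : Ds 1 (Ds (-1) V) = 0 := by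
    have := congrArg (fun P : Op n => P V) (DsD (n := n) (-1) (by norm_num))
    simp only [neg_neg, Module.End.mul_apply, LinearMap.smul_apply, H.de, smul_zero] at this
    exact this
  have hDZ : ∀ j, Ds 1 (Zs 1 j V) = 0 := fun j => by
    rw [← ap_comm (cZD 1 1 j).eq, H.zp]
  have hDB : ∀ j, Ds 1 (Bh 1 j V) = 0 := fun j => by
    rw [Bh, LinearMap.add_apply, LinearMap.smul_apply, Module.End.mul_apply, mu_ap, map_add, map_smul, isDer_Ds, Ds_zc, hDZ, hD]
    simp
  unfold Bf
  split_ifs with h1 h2 h2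
  · rw [Bh, LinearMap.add_apply, LinearMap.smul_apply, Module.End.mul_apply, neg_neg, hDB, map_zero, smul_zero, add_zero,
      Bh, LinearMap.add_apply, LinearMap.smul_apply, Module.End.mul_apply, mu_ap, map_add, map_smul, isDer_Zs, Zs_zc, H.zm, mul_zero, add_zero,
      smul_mul_assoc, one_mul, smul_smul, ← H.q ⟨j, h2⟩ ⟨k, h1⟩]
    congr 2
    push_cast
    split_ifs <;> ring
  · rw [Bh, LinearMap.add_apply, LinearMap.smul_apply, Module.End.mul_apply, neg_neg, hD, H.zm, map_zero, smul_zero, add_zero]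
  · rw [neg_neg, hDB]
  · rw [neg_neg, hD]

lemma Fu_pb {F : Sg n → ℂ} (hF : SH F) {z : Vn n} (hz : z ∈ Un n) : Fu n F z = pb (tl F hF) z := by
  rw [pb, tl_ap, EX, Fu, Ps]
  simp only
  rw [Real.exp_log (rr_pos hz), rr]

lemma PLH.pluri {F : Sg n → ℂ} (hF : SH F) (H : PLH (tl F hF)) : IsPluriharmonic n F := by
  intro z hz j k
  have e1 : ∀ w ∈ Un n, dzbarV n (basisV n j) (Fu n F) w = pb (Bf 1 j (tl F hF)) w := by
    intro w hw
    have : Fu n F =ᶠ[𝓝 w] pb (tl F hF) := by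
      filter_upwards [Un_open.mem_nhds hw] with q hq using Fu_pb hF hq
    rw [← dzbar_B _ hw, dzbarV, dzbarV, this.fderiv_eq]
  have e2 : dzbarV n (basisV n j) (Fu n F) =ᶠ[𝓝 z] pb (Bf 1 j (tl F hF)) := by
    filter_upwards [Un_open.mem_nhds hz] with q hq using e1 q hq
  have e3 : dzV n (basisV n k) (dzbarV n (basisV n j) (Fu n F)) z = dzV n (basisV n k) (pb (Bf 1 j (tl F hF))) z := by
    rw [dzV, dzV, e2.fderiv_eq]
  rw [e3, dz_B _ hz, H.B, pb, Sm.zero_ap]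
end siegel

/-- A bounded smooth `L_α`-harmonic function `F` on `S` whose transversal
derivatives `∂_a^p F`, `0 ≤ p ≤ k+1` (where `k` is the smallest integer bigger than `nα`),
are bounded against every Schwartz function on `H^n`, is pluriharmonic. -/
theorem stmt6 (n : ℕ) (hn : 1 ≤ n) (α : ℝ) (hα : 0 < α)
    (k : ℕ) (hk : k = Nat.floor ((n : ℝ) * α) + 1)
    (F : Sg n → ℂ) (hFbdd : ∃ C, ∀ p : Sg n, 0 < p.2 → ‖F p‖ ≤ C)
    (hFsmooth : ContDiffOn ℝ (⊤ : ℕ∞) F {p : Sg n | 0 < p.2})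
    (hFharm : ∀ p : Sg n, 0 < p.2 → Lalpha n α F p = 0)
    (hreg : ∀ φ : SchwartzMap (Hn n) ℂ, ∀ p : ℕ, p ≤ k + 1 → ∃ C : ℝ,
      ∀ a : ℝ, 0 < a → a ≤ 1 →
        ‖∫ w : Hn n, ((DA n)^[p] F) (w, a) * φ w‖ ≤ C) :
    IsPluriharmonic n F := by
  exact (main_PLH hα hk hFbdd hFsmooth hFharm hreg).pluri hFsmooth
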